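/- Let n ≥ 3 and let 0 ≤ a < (n-2)/2, 0 < b, a ≤ b < a+1, p = 2n/(n-2+2(b-a)), ν > 0, α, β > 1 with α + β = p. Let (u, v) be a positive finite-energy solution of the Hénon–Sobolev system (S). Then u and v are radially symmetric about the origin: for all x, y ∈ ℝⁿ \ {0} with |x| = |y| one has u(x) = u(y) and v(x) = v(y). -/

import Mathlib

open MeasureTheory Real Filter Topology

noncomputable section

/-- Coordinate Laplacian on Euclidean space. -/
def lapl {n : ℕ} (w : EuclideanSpace ℝ (Fin n) → ℝ) (x : EuclideanSpace ℝ (Fin n)) : ℝ :=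
  ∑ i : Fin n, fderiv ℝ (fun y => fderiv ℝ w y (EuclideanSpace.single i 1)) x
    (EuclideanSpace.single i 1)

/-- The weighted divergence `div(|x|^(-2a) ∇w)(x) = |x|^(-2a) (Δw(x) - 2a⟨x,∇w(x)⟩/|x|²)`. -/
def wdiv {n : ℕ} (a : ℝ) (w : EuclideanSpace ℝ (Fin n) → ℝ) (x : EuclideanSpace ℝ (Fin n)) : ℝ :=
  ‖x‖ ^ (-(2*a)) * (lapl w x - 2*a * (@inner ℝ _ _ x (gradient w x)) / ‖x‖^2)

/-- Finiteness of the weighted Dirichlet energy `∫ |x|^(-2a) |∇w|² < ∞`. -/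
def finiteEnergy {n : ℕ} (a : ℝ) (w : EuclideanSpace ℝ (Fin n) → ℝ) : Prop :=
  Integrable (fun x : EuclideanSpace ℝ (Fin n) => ‖x‖ ^ (-(2*a)) * ‖gradient w x‖^2)

namespace HenonSobolev

variable {n : ℕ}

local notation "𝔼" => EuclideanSpace ℝ (Fin n)

local notation "⟪" x "," y "⟫" => @inner ℝ _ _ x y

/-- The `i`-th standard basis vector. -/
abbrev bv (i : Fin n) : 𝔼 := EuclideanSpace.single i (1 : ℝ)

section Laplacian

lemma inner_bv (x : 𝔼) (i : Fin n) : ⟪x, bv i⟫ = x i := by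
  simp [bv, EuclideanSpace.inner_single_right]

lemma sum_coord_smul_bv (x : 𝔼) : ∑ i, x i • (bv i : 𝔼) = x := by
  have h := (EuclideanSpace.basisFun (Fin n) ℝ).sum_repr x
  simpa [EuclideanSpace.basisFun_apply] using h

lemma sum_clm_mul_coord (L : 𝔼 →L[ℝ] ℝ) (x : 𝔼) : ∑ i, x i * L (bv i) = L x := by
  conv_rhs => rw [← sum_coord_smul_bv x]
  simp [map_sum]

lemma sum_coord_sq (x : 𝔼) : ∑ i, x i ^ 2 = ‖x‖ ^ 2 := by
  rw [EuclideanSpace.norm_sq_eq]; simp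

lemma differentiableAt_fderiv {f : 𝔼 → ℝ} {x : 𝔼} (hf : ContDiffAt ℝ 2 f x) :
    DifferentiableAt ℝ (fderiv ℝ f) x :=
  (hf.fderiv_right (m := 1) (by norm_num)).differentiableAt (by norm_num)

lemma eventually_differentiableAt {F : Type*} [NormedAddCommGroup F] [NormedSpace ℝ F]
    {f : 𝔼 → F} {x : 𝔼} (hf : ContDiffAt ℝ 2 f x) :
    ∀ᶠ y in 𝓝 x, DifferentiableAt ℝ f y :=
  (hf.eventually (by simp)).mono fun _ h => h.differentiableAt (by norm_num)

lemma fderiv_fderiv_apply {f : 𝔼 → ℝ} {x : 𝔼} (hf : ContDiffAt ℝ 2 f x) (v : 𝔼) :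
    fderiv ℝ (fun y => fderiv ℝ f y v) x v = fderiv ℝ (fderiv ℝ f) x v v := by
  rw [fderiv_clm_apply (differentiableAt_fderiv hf) (differentiableAt_const v)]
  simp

lemma lapl_eq_sum {f : 𝔼 → ℝ} {x : 𝔼} (hf : ContDiffAt ℝ 2 f x) :
    lapl f x = ∑ i : Fin n, fderiv ℝ (fderiv ℝ f) x (bv i) (bv i) :=
  Finset.sum_congr rfl fun _ _ => fderiv_fderiv_apply hf _

lemma lapl_congr {f g : 𝔼 → ℝ} {x : 𝔼} (h : f =ᶠ[𝓝 x] g) : lapl f x = lapl g x := by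
  refine Finset.sum_congr rfl fun i _ => ?_
  have : (fun y => fderiv ℝ f y (bv i)) =ᶠ[𝓝 x] fun y => fderiv ℝ g y (bv i) := by
    filter_upwards [h.eventuallyEq_nhds] with y hy
    rw [hy.fderiv_eq]
  rw [this.fderiv_eq]

lemma differentiableAt_fderiv_apply {f : 𝔼 → ℝ} {x : 𝔼} (hf : ContDiffAt ℝ 2 f x) (v : 𝔼) :
    DifferentiableAt ℝ (fun y => fderiv ℝ f y v) x :=
  (differentiableAt_fderiv hf).clm_apply (differentiableAt_const v)

lemma lapl_add {f g : 𝔼 → ℝ} {x : 𝔼} (hf : ContDiffAt ℝ 2 f x) (hg : ContDiffAt ℝ 2 g x) :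
    lapl (fun y => f y + g y) x = lapl f x + lapl g x := by
  unfold lapl
  rw [← Finset.sum_add_distrib]
  refine Finset.sum_congr rfl fun i _ => ?_
  have : (fun y => fderiv ℝ (fun z => f z + g z) y (bv i)) =ᶠ[𝓝 x]
      fun y => fderiv ℝ f y (bv i) + fderiv ℝ g y (bv i) := by
    filter_upwards [(eventually_differentiableAt hf), (eventually_differentiableAt hg)] with y h1 h2
    rw [fderiv_fun_add h1 h2]; rfl
  rw [this.fderiv_eq, fderiv_fun_add (differentiableAt_fderiv_apply hf _)
    (differentiableAt_fderiv_apply hg _)]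
  rfl

lemma lapl_mul {f g : 𝔼 → ℝ} {x : 𝔼} (hf : ContDiffAt ℝ 2 f x) (hg : ContDiffAt ℝ 2 g x) :
    lapl (fun y => f y * g y) x = f x * lapl g x + g x * lapl f x
      + 2 * ∑ i : Fin n, fderiv ℝ f x (bv i) * fderiv ℝ g x (bv i) := by
  unfold lapl
  rw [Finset.mul_sum, Finset.mul_sum, Finset.mul_sum, ← Finset.sum_add_distrib,
    ← Finset.sum_add_distrib]
  refine Finset.sum_congr rfl fun i _ => ?_
  have : (fun y => fderiv ℝ (fun z => f z * g z) y (bv i)) =ᶠ[𝓝 x]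
      fun y => f y * fderiv ℝ g y (bv i) + g y * fderiv ℝ f y (bv i) := by
    filter_upwards [(eventually_differentiableAt hf), (eventually_differentiableAt hg)] with y h1 h2
    rw [fderiv_fun_mul h1 h2]; rfl
  have hf1 := hf.differentiableAt (by norm_num)
  have hg1 := hg.differentiableAt (by norm_num)
  have hf2 := differentiableAt_fderiv_apply hf (bv i)
  have hg2 := differentiableAt_fderiv_apply hg (bv i)
  rw [this.fderiv_eq, fderiv_fun_add (hf1.fun_mul hg2) (hg1.fun_mul hf2), fderiv_fun_mul hf1 hg2,
    fderiv_fun_mul hg1 hf2]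
  simp only [add_apply, smul_apply, smul_eq_mul]
  ring

lemma lapl_const (c : ℝ) (x : 𝔼) : lapl (fun _ => c) x = 0 := by
  simp [lapl]

lemma lapl_const_mul {f : 𝔼 → ℝ} {x : 𝔼} (c : ℝ) (hf : ContDiffAt ℝ 2 f x) :
    lapl (fun y => c * f y) x = c * lapl f x := by
  rw [lapl_mul contDiffAt_const hf, lapl_const]
  simp

lemma lapl_sub {f g : 𝔼 → ℝ} {x : 𝔼} (hf : ContDiffAt ℝ 2 f x) (hg : ContDiffAt ℝ 2 g x) :
    lapl (fun y => f y - g y) x = lapl f x - lapl g x := by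
  have : (fun y => f y - g y) = fun y => f y + (-1) * g y := by ext; ring
  rw [this, lapl_add hf (contDiffAt_const.mul hg), lapl_const_mul _ hg]
  ring

/-- The Laplacian of a composition `f ∘ Φ` with a `C²` change of variables. -/
lemma lapl_comp {f : 𝔼 → ℝ} {Φ : 𝔼 → 𝔼} {x : 𝔼} (hf : ContDiffAt ℝ 2 f (Φ x))
    (hΦ : ContDiffAt ℝ 2 Φ x) :
    lapl (fun y => f (Φ y)) x =
      ∑ i : Fin n, (fderiv ℝ (fderiv ℝ f) (Φ x) (fderiv ℝ Φ x (bv i)) (fderiv ℝ Φ x (bv i))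
        + fderiv ℝ f (Φ x) (fderiv ℝ (fun y => fderiv ℝ Φ y (bv i)) x (bv i))) := by
  refine Finset.sum_congr rfl fun i _ => ?_
  have hΦ1 := hΦ.differentiableAt (by norm_num : (2 : WithTop ℕ∞) ≠ 0)
  have : (fun y => fderiv ℝ (fun z => f (Φ z)) y (bv i)) =ᶠ[𝓝 x]
      fun y => fderiv ℝ f (Φ y) (fderiv ℝ Φ y (bv i)) := by
    filter_upwards [hΦ.continuousAt.eventually (eventually_differentiableAt hf),
      (eventually_differentiableAt hΦ)] with y h1 h2
    rw [show (fun z => f (Φ z)) = f ∘ Φ from rfl, fderiv_comp y h1 h2]; rfl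
  have hD : DifferentiableAt ℝ (fun y => fderiv ℝ Φ y (bv i)) x :=
    ((hΦ.fderiv_right (m := 1) (by norm_num)).differentiableAt (by norm_num)).clm_apply
      (differentiableAt_const _)
  have hc : HasFDerivAt (fun y => fderiv ℝ f (Φ y))
      ((fderiv ℝ (fderiv ℝ f) (Φ x)).comp (fderiv ℝ Φ x)) x :=
    (differentiableAt_fderiv hf).hasFDerivAt.comp x hΦ1.hasFDerivAt
  rw [this.fderiv_eq, fderiv_clm_apply hc.differentiableAt hD, hc.fderiv]
  simp [add_comm]

lemma lapl_nonneg_of_isLocalMin {f : 𝔼 → ℝ} {x : 𝔼} (hf : ContDiffAt ℝ 2 f x)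
    (hmin : IsLocalMin f x) : 0 ≤ lapl f x := by
  refine Finset.sum_nonneg fun i _ => ?_
  by_contra! hneg
  set g : ℝ → ℝ := fun t => f (x + t • (bv i : 𝔼)) with hg
  have hline : ∀ t, HasDerivAt (fun t : ℝ => x + t • (bv i : 𝔼)) (bv i) t := fun t => by
    simpa using ((hasDerivAt_id t).smul_const (bv i : 𝔼)).const_add x
  have hcont : ContinuousAt (fun t : ℝ => x + t • (bv i : 𝔼)) 0 := (hline 0).continuousAt
  have h0 : x + (0 : ℝ) • (bv i : 𝔼) = x := by simp
  have hd : ∀ᶠ t in 𝓝 (0 : ℝ), HasDerivAt g (fderiv ℝ f (x + t • (bv i : 𝔼)) (bv i)) t := by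
    have := hcont.eventually (show ∀ᶠ y in 𝓝 (x + (0 : ℝ) • (bv i : 𝔼)), DifferentiableAt ℝ f y by
      rw [h0]; exact eventually_differentiableAt hf)
    filter_upwards [this] with t ht
    exact ht.hasFDerivAt.comp_hasDerivAt t (hline t)
  have hdd : deriv g =ᶠ[𝓝 0] fun t => fderiv ℝ f (x + t • (bv i : 𝔼)) (bv i) :=
    hd.mono fun t ht => ht.deriv
  have h2 : deriv (deriv g) 0 =
      fderiv ℝ (fun y => fderiv ℝ f y (bv i)) x (bv i) := by
    rw [hdd.deriv_eq]
    have := (differentiableAt_fderiv_apply hf (bv i)).hasFDerivAt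
    rw [← h0] at this
    have := this.comp_hasDerivAt (0 : ℝ) (hline 0)
    rw [h0] at this
    exact this.deriv
  have hgc : ContinuousAt g 0 := hd.self_of_nhds.continuousAt
  have hming : IsLocalMin g 0 := by
    have : ∀ᶠ t in 𝓝 (0 : ℝ), f x ≤ f (x + t • (bv i : 𝔼)) :=
      hcont.eventually (show ∀ᶠ y in 𝓝 (x + (0 : ℝ) • (bv i : 𝔼)), f x ≤ f y by
        rw [h0]; exact hmin)
    filter_upwards [this] with t ht
    simpa [hg] using ht
  have hmaxg := isLocalMax_of_deriv_deriv_neg (by rw [h2]; exact hneg) hming.deriv_eq_zero hgc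
  have hconst : g =ᶠ[𝓝 0] fun _ => g 0 := by
    filter_upwards [hming, hmaxg] with t h1 h2
    exact le_antisymm h2 h1
  have hc' : deriv g =ᶠ[𝓝 0] fun _ => 0 := by
    filter_upwards [hconst.eventuallyEq_nhds] with t ht
    rw [ht.deriv_eq]; simp
  have : deriv (deriv g) 0 = 0 := by rw [hc'.deriv_eq]; simp
  rw [h2] at this
  exact hneg.ne this

end Laplacian

section Transformations

lemma hasFDerivAt_norm_rpow_of_ne_zero (κ : ℝ) {x : 𝔼} (hx : x ≠ 0) :
    HasFDerivAt (fun y : 𝔼 => ‖y‖ ^ κ) ((κ * ‖x‖ ^ (κ - 2)) • innerSL ℝ x) x := by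
  have h1 : HasFDerivAt (fun y : 𝔼 => ‖y‖ ^ 2) ((2 : ℝ) • innerSL ℝ x) x := by
    simpa [two_smul] using (hasStrictFDerivAt_norm_sq x).hasFDerivAt
  have hpos : 0 < ‖x‖ := norm_pos_iff.2 hx
  have h2 := h1.rpow_const (p := κ / 2) (Or.inl (by positivity))
  have hpow : ∀ (y : 𝔼) (t : ℝ), (‖y‖ ^ 2) ^ (t / 2) = ‖y‖ ^ t := fun y t => by
    rw [← Real.rpow_natCast_mul (norm_nonneg y)]
    congr 1
    push_cast
    ring
  have h3 : κ / 2 - 1 = (κ - 2) / 2 := by ring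
  simp only [hpow, h3] at h2
  rw [smul_smul, show κ / 2 * ‖x‖ ^ (κ - 2) * 2 = κ * ‖x‖ ^ (κ - 2) by ring] at h2
  exact h2

lemma contDiffAt_norm_rpow (κ : ℝ) {x : 𝔼} (hx : x ≠ 0) :
    ContDiffAt ℝ 2 (fun y : 𝔼 => ‖y‖ ^ κ) x :=
  (contDiffAt_norm ℝ hx).rpow_const_of_ne (norm_ne_zero_iff.2 hx)

lemma fderiv_norm_rpow_apply (κ : ℝ) {x : 𝔼} (hx : x ≠ 0) (v : 𝔼) :
    fderiv ℝ (fun y : 𝔼 => ‖y‖ ^ κ) x v = κ * ‖x‖ ^ (κ - 2) * ⟪x, v⟫ := by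
  rw [(hasFDerivAt_norm_rpow_of_ne_zero κ hx).fderiv]
  simp

lemma hasFDerivAt_inner_left (v x : 𝔼) :
    HasFDerivAt (fun y : 𝔼 => ⟪y, v⟫) (innerSL ℝ v) x := by
  have := (innerSL ℝ v).hasFDerivAt (x := x)
  refine this.congr_of_eventuallyEq (Eventually.of_forall fun y => ?_)
  simp [real_inner_comm]

lemma norm_rpow_sub_two_mul_sq (κ : ℝ) {x : 𝔼} (hx : x ≠ 0) :
    ‖x‖ ^ (κ - 2) * ‖x‖ ^ 2 = ‖x‖ ^ κ := by
  rw [← Real.rpow_natCast, ← Real.rpow_add (norm_pos_iff.2 hx)]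
  norm_num

lemma lapl_norm_rpow (κ : ℝ) {x : 𝔼} (hx : x ≠ 0) :
    lapl (fun y : 𝔼 => ‖y‖ ^ κ) x = κ * (κ + n - 2) * ‖x‖ ^ (κ - 2) := by
  have key : ∀ i : Fin n, fderiv ℝ (fun y => fderiv ℝ (fun y : 𝔼 => ‖y‖ ^ κ) y (bv i)) x (bv i)
      = κ * (κ - 2) * ‖x‖ ^ (κ - 2 - 2) * x i ^ 2 + κ * ‖x‖ ^ (κ - 2) := fun i => by
    have h1 : (fun y => fderiv ℝ (fun y : 𝔼 => ‖y‖ ^ κ) y (bv i)) =ᶠ[𝓝 x]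
        fun y => κ * ‖y‖ ^ (κ - 2) * ⟪y, bv i⟫ := by
      filter_upwards [isOpen_ne.mem_nhds hx] with y hy
      exact fderiv_norm_rpow_apply κ hy _
    have h2 := ((hasFDerivAt_norm_rpow_of_ne_zero (κ - 2) hx).const_mul κ).fun_mul
      (hasFDerivAt_inner_left (bv i) x)
    rw [h1.fderiv_eq, h2.fderiv]
    simp only [add_apply, smul_apply, smul_eq_mul, innerSL_apply_apply, inner_bv]
    simp only [bv, PiLp.single_apply, if_true]
    ring
  have : lapl (fun y : 𝔼 => ‖y‖ ^ κ) x
      = ∑ i : Fin n, (κ * (κ - 2) * ‖x‖ ^ (κ - 2 - 2) * x i ^ 2 + κ * ‖x‖ ^ (κ - 2)) :=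
    Finset.sum_congr rfl fun i _ => key i
  rw [this, Finset.sum_add_distrib, ← Finset.mul_sum, sum_coord_sq]
  simp only [Finset.sum_const, Finset.card_univ, Fintype.card_fin, nsmul_eq_mul]
  have h := norm_rpow_sub_two_mul_sq (κ - 2) hx
  linear_combination (κ * (κ - 2)) * h

/-- The Laplacian of `|x|^κ f`. -/
lemma lapl_norm_rpow_mul (κ : ℝ) {f : 𝔼 → ℝ} {x : 𝔼} (hx : x ≠ 0) (hf : ContDiffAt ℝ 2 f x) :
    lapl (fun y => ‖y‖ ^ κ * f y) x = ‖x‖ ^ κ * lapl f x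
      + 2 * κ * ‖x‖ ^ (κ - 2) * fderiv ℝ f x x
      + κ * (κ + n - 2) * ‖x‖ ^ (κ - 2) * f x := by
  rw [lapl_mul (contDiffAt_norm_rpow κ hx) hf, lapl_norm_rpow κ hx]
  have : ∑ i : Fin n, fderiv ℝ (fun y : 𝔼 => ‖y‖ ^ κ) x (bv i) * fderiv ℝ f x (bv i)
      = κ * ‖x‖ ^ (κ - 2) * fderiv ℝ f x x := by
    rw [← sum_clm_mul_coord (fderiv ℝ f x) x, Finset.mul_sum]
    refine Finset.sum_congr rfl fun i _ => ?_
    rw [fderiv_norm_rpow_apply κ hx, inner_bv]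
    ring
  rw [this]
  ring

/-- The trace of a bilinear form is invariant under a hyperplane reflection. -/
lemma sum_bilin_reflection (B : 𝔼 →L[ℝ] 𝔼 →L[ℝ] ℝ) (w : 𝔼) (c : ℝ) (hc : c * ‖w‖ ^ 2 = 2) :
    ∑ i : Fin n, B (bv i - (c * w i) • w) (bv i - (c * w i) • w) =
      ∑ i : Fin n, B (bv i) (bv i) := by
  have h : ∀ i : Fin n, B (bv i - (c * w i) • w) (bv i - (c * w i) • w) =
      B (bv i) (bv i) - c * (w i * (B w) (bv i)) - c * (w i * (B.flip w) (bv i))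
        + c ^ 2 * B w w * w i ^ 2 := fun i => by
    simp only [map_sub, map_smul, sub_apply, smul_apply, smul_eq_mul,
      ContinuousLinearMap.flip_apply]
    ring
  rw [Finset.sum_congr rfl fun i _ => h i, Finset.sum_add_distrib, Finset.sum_sub_distrib,
    Finset.sum_sub_distrib, ← Finset.mul_sum, ← Finset.mul_sum, ← Finset.mul_sum, sum_coord_sq,
    sum_clm_mul_coord, sum_clm_mul_coord]
  simp only [ContinuousLinearMap.flip_apply]
  linear_combination (c * B w w) * hc

/-- Inversion in the unit sphere. -/
def inv (y : 𝔼) : 𝔼 := ‖y‖ ^ (-2 : ℝ) • y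

lemma norm_inv (y : 𝔼) : ‖inv y‖ = ‖y‖⁻¹ := by
  rcases eq_or_ne y 0 with rfl | hy
  · simp [inv]
  have : 0 < ‖y‖ := norm_pos_iff.2 hy
  rw [inv, norm_smul, Real.norm_of_nonneg (by positivity), Real.rpow_neg this.le]
  norm_num
  field_simp

lemma inv_ne_zero {y : 𝔼} (hy : y ≠ 0) : inv y ≠ 0 := by
  rw [← norm_pos_iff, norm_inv]
  have : 0 < ‖y‖ := norm_pos_iff.2 hy
  positivity

lemma inv_inv {y : 𝔼} (hy : y ≠ 0) : inv (inv y) = y := by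
  have : 0 < ‖y‖ := norm_pos_iff.2 hy
  conv_lhs => rw [inv, norm_inv]
  rw [inv, smul_smul, Real.inv_rpow this.le, inv_mul_cancel₀ (by positivity), one_smul]

lemma contDiffAt_inv {y : 𝔼} (hy : y ≠ 0) : ContDiffAt ℝ 2 (inv : 𝔼 → 𝔼) y :=
  (contDiffAt_norm_rpow _ hy).smul contDiffAt_id

lemma fderiv_inv_apply {y : 𝔼} (hy : y ≠ 0) (v : 𝔼) :
    fderiv ℝ (inv : 𝔼 → 𝔼) y v =
      ‖y‖ ^ (-2 : ℝ) • v + (-2 * ‖y‖ ^ (-4 : ℝ) * ⟪y, v⟫) • y := by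
  have h := (hasFDerivAt_norm_rpow_of_ne_zero (-2) hy).fun_smul (hasFDerivAt_id y)
  have h' : HasFDerivAt (inv : 𝔼 → 𝔼) _ y := h
  rw [h'.fderiv]
  norm_num [smul_smul]

lemma fderiv_fderiv_inv {y : 𝔼} (hy : y ≠ 0) (i : Fin n) :
    fderiv ℝ (fun z => fderiv ℝ (inv : 𝔼 → 𝔼) z (bv i)) y (bv i) =
      (-4 * ‖y‖ ^ (-4 : ℝ) * y i) • bv i
        + (8 * ‖y‖ ^ (-6 : ℝ) * y i ^ 2 - 2 * ‖y‖ ^ (-4 : ℝ)) • y := by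
  have h1 : (fun z => fderiv ℝ (inv : 𝔼 → 𝔼) z (bv i)) =ᶠ[𝓝 y]
      fun z => ‖z‖ ^ (-2 : ℝ) • bv i + (-2 * ‖z‖ ^ (-4 : ℝ) * ⟪z, bv i⟫) • z := by
    filter_upwards [isOpen_ne.mem_nhds hy] with z hz
    exact fderiv_inv_apply hz _
  have h2 := ((hasFDerivAt_norm_rpow_of_ne_zero (-2) hy).fun_smul
    (hasFDerivAt_const (bv i : 𝔼) y)).fun_add
    ((((hasFDerivAt_norm_rpow_of_ne_zero (-4) hy).const_mul (-2)).fun_mul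
      (hasFDerivAt_inner_left (bv i) y)).fun_smul (hasFDerivAt_id y))
  simp only [id] at h2
  rw [h1.fderiv_eq, h2.fderiv]
  have hb : (⟪bv i, bv i⟫ : ℝ) = 1 := by rw [inner_bv]; simp [bv]
  simp only [add_apply, smul_apply, smul_eq_mul, innerSL_apply_apply, inner_bv, hb,
    ContinuousLinearMap.smulRight_apply, ContinuousLinearMap.id_apply, zero_apply, smul_zero]
  norm_num
  module

/-- The Laplacian of a function composed with the inversion. -/
lemma lapl_comp_inv {f : 𝔼 → ℝ} {y : 𝔼} (hy : y ≠ 0) (hf : ContDiffAt ℝ 2 f (inv y)) :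
    lapl (fun z => f (inv z)) y = ‖y‖ ^ (-4 : ℝ) *
      (lapl f (inv y) - 2 * (n - 2) * fderiv ℝ f (inv y) y) := by
  rw [lapl_comp hf (contDiffAt_inv hy), Finset.sum_add_distrib]
  have hpos : 0 < ‖y‖ := norm_pos_iff.2 hy
  have e1 : ‖y‖ ^ (-6 : ℝ) * ‖y‖ ^ 2 = ‖y‖ ^ (-4 : ℝ) := by
    convert norm_rpow_sub_two_mul_sq (-4) hy using 3; norm_num
  have e2 : ‖y‖ ^ (-4 : ℝ) * ‖y‖ ^ 2 = ‖y‖ ^ (-2 : ℝ) := by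
    convert norm_rpow_sub_two_mul_sq (-2) hy using 3; norm_num
  have e3 : ‖y‖ ^ (-2 : ℝ) * ‖y‖ ^ 2 = 1 := by
    convert norm_rpow_sub_two_mul_sq 0 hy using 1
    · norm_num
    · simp
  have hfirst : ∑ i : Fin n, fderiv ℝ (fderiv ℝ f) (inv y) (fderiv ℝ inv y (bv i))
      (fderiv ℝ inv y (bv i)) = ‖y‖ ^ (-4 : ℝ) * lapl f (inv y) := by
    rw [lapl_eq_sum hf, ← sum_bilin_reflection _ y (2 * ‖y‖ ^ (-2 : ℝ))
      (by rw [mul_assoc, e3]; simp),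
      Finset.mul_sum]
    refine Finset.sum_congr rfl fun i _ => ?_
    have : fderiv ℝ inv y (bv i) =
        ‖y‖ ^ (-2 : ℝ) • (bv i - ((2 * ‖y‖ ^ (-2 : ℝ)) * y i) • y) := by
      rw [fderiv_inv_apply hy, inner_bv, smul_sub, smul_smul, sub_eq_add_neg, ← neg_smul]
      congr 2
      linear_combination (2 * y i * ‖y‖ ^ (-4 : ℝ)) * e3 - (2 * y i * ‖y‖ ^ (-2 : ℝ)) * e2
    rw [this]
    simp only [map_smul, smul_apply, smul_eq_mul]
    rw [← mul_assoc, ← Real.rpow_add hpos]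
    norm_num
  rw [hfirst]
  have hsecond : ∀ i : Fin n, fderiv ℝ f (inv y)
      (fderiv ℝ (fun z => fderiv ℝ (inv : 𝔼 → 𝔼) z (bv i)) y (bv i)) =
      -4 * ‖y‖ ^ (-4 : ℝ) * (y i * fderiv ℝ f (inv y) (bv i))
      + (8 * ‖y‖ ^ (-6 : ℝ) * fderiv ℝ f (inv y) y * y i ^ 2
        - 2 * ‖y‖ ^ (-4 : ℝ) * fderiv ℝ f (inv y) y) := fun i => by
    rw [fderiv_fderiv_inv hy]
    simp only [map_add, map_smul, smul_eq_mul]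
    ring
  rw [Finset.sum_congr rfl fun i _ => hsecond i, Finset.sum_add_distrib, Finset.sum_sub_distrib,
    ← Finset.mul_sum, ← Finset.mul_sum, sum_clm_mul_coord, sum_coord_sq]
  simp only [Finset.sum_const, Finset.card_univ, Fintype.card_fin, nsmul_eq_mul]
  linear_combination 8 * fderiv ℝ f (inv y) y * e1

/-- The Kelvin transform. -/
def kelvin (f : 𝔼 → ℝ) (y : 𝔼) : ℝ := ‖y‖ ^ (2 - n : ℝ) * f (inv y)

lemma lapl_kelvin {f : 𝔼 → ℝ} {y : 𝔼} (hy : y ≠ 0) (hf : ContDiffAt ℝ 2 f (inv y)) :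
    lapl (kelvin f) y = ‖y‖ ^ (-(n : ℝ) - 2) * lapl f (inv y) := by
  have hpos : 0 < ‖y‖ := norm_pos_iff.2 hy
  have hc : ContDiffAt ℝ 2 (fun z => f (inv z)) y := hf.comp y (contDiffAt_inv hy)
  have h0 : lapl (kelvin f) y = lapl (fun z => ‖z‖ ^ (2 - n : ℝ) * f (inv z)) y := rfl
  have hd : fderiv ℝ (fun z => f (inv z)) y y = -(‖y‖ ^ (-2 : ℝ) * fderiv ℝ f (inv y) y) := by
    rw [show (fun z => f (inv z)) = f ∘ inv from rfl, fderiv_comp y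
      (hf.differentiableAt (by norm_num)) ((contDiffAt_inv hy).differentiableAt (by norm_num)),
      ContinuousLinearMap.comp_apply, fderiv_inv_apply hy, real_inner_self_eq_norm_sq]
    have e2 : ‖y‖ ^ (-4 : ℝ) * ‖y‖ ^ 2 = ‖y‖ ^ (-2 : ℝ) := by
      convert norm_rpow_sub_two_mul_sq (-2) hy using 3; norm_num
    simp only [map_add, map_smul, smul_eq_mul]
    linear_combination (-2 * fderiv ℝ f (inv y) y) * e2
  rw [h0, lapl_norm_rpow_mul _ hy hc, lapl_comp_inv hy hf, hd]
  have p1 : ‖y‖ ^ (-(n : ℝ) - 2) = ‖y‖ ^ (2 - n : ℝ) * ‖y‖ ^ (-4 : ℝ) := by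
    rw [← Real.rpow_add hpos]; congr 1; ring
  have p2 : ‖y‖ ^ (2 - n - 2 : ℝ) * ‖y‖ ^ (-2 : ℝ) = ‖y‖ ^ (2 - n : ℝ) * ‖y‖ ^ (-4 : ℝ) := by
    rw [← Real.rpow_add hpos, ← Real.rpow_add hpos]; congr 1; ring
  rw [p1]
  linear_combination (-2 * (2 - n) * fderiv ℝ f (inv y) y) * p2

lemma contDiffAt_kelvin {f : 𝔼 → ℝ} {y : 𝔼} (hy : y ≠ 0) (hf : ContDiffAt ℝ 2 f (inv y)) :
    ContDiffAt ℝ 2 (kelvin f) y :=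
  (contDiffAt_norm_rpow _ hy).mul (hf.comp y (contDiffAt_inv hy))

/-- Reflection in the hyperplane `⟨x, e⟩ = l` (for a unit vector `e`). -/
def refl (e : 𝔼) (l : ℝ) (x : 𝔼) : 𝔼 := x + (2 * (l - ⟪x, e⟫)) • e

lemma hasFDerivAt_refl (e : 𝔼) (l : ℝ) (x : 𝔼) :
    HasFDerivAt (refl e l)
      (ContinuousLinearMap.id ℝ 𝔼 + ((2 : ℝ) • (-innerSL ℝ e)).smulRight e) x :=
  (hasFDerivAt_id x).fun_add
    ((((hasFDerivAt_inner_left e x).const_sub l).const_mul 2).smul_const e)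

lemma contDiff_refl (e : 𝔼) (l : ℝ) : ContDiff ℝ 2 (refl e l) :=
  contDiff_id.add ((contDiff_const.mul
    (contDiff_const.sub (contDiff_id.inner ℝ contDiff_const))).smul
    contDiff_const)

lemma lapl_comp_refl {f : 𝔼 → ℝ} {e x : 𝔼} (he : ‖e‖ = 1) (l : ℝ)
    (hf : ContDiffAt ℝ 2 f (refl e l x)) :
    lapl (fun z => f (refl e l z)) x = lapl f (refl e l x) := by
  have hD : ∀ (z : 𝔼) (i : Fin n), fderiv ℝ (refl e l) z (bv i) = bv i - (2 * e i) • e := by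
    intro z i
    rw [(hasFDerivAt_refl e l z).fderiv]
    simp only [add_apply, smul_apply, smul_eq_mul, innerSL_apply_apply, inner_bv,
      ContinuousLinearMap.smulRight_apply, ContinuousLinearMap.id_apply, neg_apply]
    module
  rw [lapl_comp hf (contDiff_refl e l).contDiffAt, lapl_eq_sum hf,
    ← sum_bilin_reflection _ e 2 (by rw [he]; norm_num)]
  refine Finset.sum_congr rfl fun i _ => ?_
  simp [hD]

lemma inner_refl {e : 𝔼} (he : ‖e‖ = 1) (l : ℝ) (x : 𝔼) :
    ⟪refl e l x, e⟫ = 2 * l - ⟪x, e⟫ := by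
  rw [refl, inner_add_left, real_inner_smul_left, real_inner_self_eq_norm_sq, he]
  ring

lemma refl_refl {e : 𝔼} (he : ‖e‖ = 1) (l : ℝ) (x : 𝔼) : refl e l (refl e l x) = x := by
  conv_lhs => rw [refl, inner_refl he]
  rw [refl]
  module

lemma norm_refl_sq {e : 𝔼} (he : ‖e‖ = 1) (l : ℝ) (x : 𝔼) :
    ‖refl e l x‖ ^ 2 = ‖x‖ ^ 2 + 4 * l * (l - ⟪x, e⟫) := by
  rw [refl, norm_add_sq_real, norm_smul, real_inner_smul_right, he, Real.norm_eq_abs, mul_one,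
    sq_abs]
  ring

lemma continuous_refl_prod (e : 𝔼) : Continuous fun q : ℝ × 𝔼 => refl e q.1 q.2 := by
  unfold refl
  fun_prop

lemma fderiv_exp_inner (e x v : 𝔼) (N c : ℝ) :
    fderiv ℝ (fun y : 𝔼 => Real.exp (N * ⟪y, e⟫ + c)) x v =
      N * Real.exp (N * ⟪x, e⟫ + c) * ⟪v, e⟫ := by
  have := (((hasFDerivAt_inner_left e x).const_mul N).add_const c).exp
  rw [this.fderiv]
  simp [real_inner_comm]
  ring

lemma contDiff_exp_inner (e : 𝔼) (N c : ℝ) :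
    ContDiff ℝ 2 (fun y : 𝔼 => Real.exp (N * ⟪y, e⟫ + c)) :=
  ((contDiff_const.mul (contDiff_id.inner ℝ contDiff_const)).add contDiff_const).exp

/-- The Laplacian of an exponential profile in `⟨x, e⟩`. -/
lemma lapl_exp_inner {e : 𝔼} (he : ‖e‖ = 1) (x : 𝔼) (N c : ℝ) :
    lapl (fun y : 𝔼 => Real.exp (N * ⟪y, e⟫ + c)) x = N ^ 2 * Real.exp (N * ⟪x, e⟫ + c) := by
  unfold lapl
  have h : ∀ i : Fin n, fderiv ℝ (fun y => fderiv ℝ (fun y : 𝔼 => Real.exp (N * ⟪y, e⟫ + c)) y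
      (bv i)) x (bv i) = N ^ 2 * Real.exp (N * ⟪x, e⟫ + c) * e i ^ 2 := fun i => by
    simp only [fderiv_exp_inner]
    have := ((((((hasFDerivAt_inner_left e x).const_mul N).add_const c).exp).const_mul N).mul_const
      (⟪bv i, e⟫))
    rw [this.fderiv]
    simp only [smul_apply, smul_eq_mul, innerSL_apply_apply, inner_bv, real_inner_comm]
    ring
  rw [Finset.sum_congr rfl fun i _ => h i, ← Finset.mul_sum, sum_coord_sq, he]
  ring

end Transformations

section Comparison

/-- Comparison on an annulus for functions with ordered logarithmic Laplacians. -/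
lemma le_on_annulus {A B : 𝔼 → ℝ} {r₁ r₂ : ℝ}
    (hA : ∀ x : 𝔼, r₁ ≤ ‖x‖ → ‖x‖ ≤ r₂ → ContDiffAt ℝ 2 A x)
    (hB : ∀ x : 𝔼, r₁ ≤ ‖x‖ → ‖x‖ ≤ r₂ → ContDiffAt ℝ 2 B x)
    (hpos : ∀ x : 𝔼, r₁ ≤ ‖x‖ → ‖x‖ ≤ r₂ → 0 < B x)
    (h₁ : ∀ x : 𝔼, ‖x‖ = r₁ → A x ≤ B x) (h₂ : ∀ x : 𝔼, ‖x‖ = r₂ → A x ≤ B x)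
    (h : ∀ x : 𝔼, r₁ < ‖x‖ → ‖x‖ < r₂ → 0 < A x → -lapl A x * B x < -lapl B x * A x)
    {x : 𝔼} (hx₁ : r₁ ≤ ‖x‖) (hx₂ : ‖x‖ ≤ r₂) : A x ≤ B x := by
  by_contra! hlt
  set S : Set 𝔼 := {y | r₁ ≤ ‖y‖ ∧ ‖y‖ ≤ r₂} with hS
  have hclosed : IsClosed S :=
    (isClosed_le continuous_const continuous_norm).inter
      (isClosed_le continuous_norm continuous_const)
  have hcomp : IsCompact S := by
    refine (isCompact_closedBall (0 : 𝔼) r₂).of_isClosed_subset hclosed fun y hy => ?_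
    simpa using hy.2
  obtain ⟨z, hz, hmax⟩ := hcomp.exists_isMaxOn ⟨x, hx₁, hx₂⟩
    (f := fun y => A y / B y) (fun y hy => ((hA y hy.1 hy.2).continuousAt.div
      (hB y hy.1 hy.2).continuousAt (hpos y hy.1 hy.2).ne').continuousWithinAt)
  have hBz := hpos z hz.1 hz.2
  set T := A z / B z with hT
  have hTx : A x / B x ≤ T := hmax (show x ∈ S from ⟨hx₁, hx₂⟩)
  have hT1 : 1 < T := lt_of_lt_of_le ((one_lt_div (hpos x hx₁ hx₂)).2 hlt) hTx
  have hAz : A z = T * B z := by rw [hT]; field_simp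
  have hAB : B z < A z := by rw [hAz]; nlinarith
  have hz1 : r₁ < ‖z‖ := lt_of_le_of_ne hz.1 fun e => absurd (h₁ z e.symm) (not_le.2 hAB)
  have hz2 : ‖z‖ < r₂ := lt_of_le_of_ne hz.2 fun e => absurd (h₂ z e) (not_le.2 hAB)
  have hAc := hA z hz.1 hz.2
  have hBc := hB z hz.1 hz.2
  have hmin : IsLocalMin (fun y => T * B y - A y) z := by
    have hopen : IsOpen {y : 𝔼 | r₁ < ‖y‖ ∧ ‖y‖ < r₂} :=
      (isOpen_lt continuous_const continuous_norm).inter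
        (isOpen_lt continuous_norm continuous_const)
    filter_upwards [hopen.mem_nhds ⟨hz1, hz2⟩] with y hy
    have hy' : A y / B y ≤ T := hmax (show y ∈ S from ⟨hy.1.le, hy.2.le⟩)
    rw [div_le_iff₀ (hpos y hy.1.le hy.2.le)] at hy'
    linarith
  have hlap := lapl_nonneg_of_isLocalMin ((contDiffAt_const.mul hBc).sub hAc) hmin
  rw [lapl_sub (contDiffAt_const.mul hBc) hAc, lapl_const_mul _ hBc] at hlap
  have := h z hz1 hz2 (hBz.trans hAB)
  rw [hAz] at this
  nlinarith

lemma rpow_sub_rpow_le {q x y : ℝ} (hq : 0 < q) (hy : 0 < y) (hyx : y ≤ x) :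
    x ^ q - y ^ q ≤ (q + 1) * x ^ (q - 1) * (x - y) := by
  have hx : 0 < x := hy.trans_le hyx
  have ht0 : 0 < y / x := by positivity
  have ht1 : y / x ≤ 1 := (div_le_one hx).2 hyx
  have key : 1 - (q + 1) * (1 - y / x) ≤ (y / x) ^ q := by
    rcases le_total 1 q with h1 | h1
    · have := one_add_mul_self_le_rpow_one_add (s := y / x - 1) (by linarith) h1
      rw [add_sub_cancel] at this
      nlinarith
    · have := Real.rpow_le_rpow_of_exponent_ge ht0 ht1 h1
      rw [Real.rpow_one] at this
      nlinarith
  rw [Real.div_rpow hy.le hx.le, le_div_iff₀ (by positivity)] at key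
  have e : x ^ (q - 1) * x = x ^ q := by
    rw [← Real.rpow_add_one hx.ne']; norm_num
  have e2 : x ^ q * (1 - y / x) = x ^ (q - 1) * (x - y) := by
    rw [← e]; field_simp
  nlinarith

/-- The potential controlling the linearised nonlinearity. -/
def pot (p c F G : ℝ) : ℝ := (p + c * (p + 1)) * ((F + G) ^ p / (min F G) ^ 2)

lemma pot_comm (p c F G : ℝ) : pot p c F G = pot p c G F := by
  simp [pot, add_comm F G, min_comm F G]

lemma nonlinearity_sub_le {p c α β F F' G G' d : ℝ} (hc : 0 < c) (hα : 1 < α) (hβ : 1 < β)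
    (hp : α + β = p) (hF' : 0 < F') (hG : 0 < G) (hG' : 0 < G') (hd : 0 < d)
    (hF : F - F' = d) (hGd : G - G' ≤ d) :
    F ^ (p - 1) + c * F ^ (α - 1) * G ^ β - (F' ^ (p - 1) + c * F' ^ (α - 1) * G' ^ β)
      ≤ pot p c F G * d := by
  have hFpos : 0 < F := by linarith
  have hFF : F' ≤ F := by linarith
  set m := min F G with hm
  have hmpos : 0 < m := lt_min hFpos hG
  set S := F + G with hS
  have hSpos : 0 < S := by positivity
  have hmF : m ≤ F := min_le_left _ _
  have hmG : m ≤ G := min_le_right _ _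
  set Q := S ^ p / m ^ 2 with hQ
  have hQpos : 0 < Q := by positivity
  have hpow : ∀ {z t : ℝ}, 0 < z → z ≤ S → 0 ≤ t → z ^ t ≤ S ^ t := fun hz hzS ht =>
    Real.rpow_le_rpow hz.le hzS ht
  have b1 : F ^ (p - 2) ≤ Q := by
    rw [hQ, le_div_iff₀ (by positivity)]
    calc F ^ (p - 2) * m ^ 2 ≤ F ^ (p - 2) * F ^ 2 := by gcongr
      _ = F ^ p := by rw [← Real.rpow_natCast, ← Real.rpow_add hFpos]; norm_num
      _ ≤ S ^ p := hpow hFpos (by linarith) (by linarith)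
  have b2 : F ^ (α - 2) * G ^ β ≤ Q := by
    rw [hQ, le_div_iff₀ (by positivity)]
    calc F ^ (α - 2) * G ^ β * m ^ 2 ≤ F ^ (α - 2) * G ^ β * F ^ 2 := by gcongr
      _ = F ^ α * G ^ β := by
        rw [mul_right_comm, ← Real.rpow_natCast, ← Real.rpow_add hFpos]; norm_num
      _ ≤ S ^ α * S ^ β := mul_le_mul (hpow hFpos (by linarith) (by linarith))
          (hpow hG (by linarith) (by linarith)) (by positivity) (by positivity)
      _ = S ^ p := by rw [← Real.rpow_add hSpos, hp]
  have b3 : F ^ (α - 1) * G ^ (β - 1) ≤ Q := by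
    rw [hQ, le_div_iff₀ (by positivity)]
    calc F ^ (α - 1) * G ^ (β - 1) * m ^ 2 ≤ F ^ (α - 1) * G ^ (β - 1) * (F * G) := by
          rw [sq]; gcongr
      _ = F ^ (α - 1) * F * (G ^ (β - 1) * G) := by ring
      _ = F ^ α * G ^ β := by
        rw [← Real.rpow_add_one hFpos.ne', ← Real.rpow_add_one hG.ne']; norm_num
      _ ≤ S ^ α * S ^ β := mul_le_mul (hpow hFpos (by linarith) (by linarith))
          (hpow hG (by linarith) (by linarith)) (by positivity) (by positivity)
      _ = S ^ p := by rw [← Real.rpow_add hSpos, hp]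
  have t1 : F ^ (p - 1) - F' ^ (p - 1) ≤ p * Q * d := by
    have := rpow_sub_rpow_le (q := p - 1) (by linarith) hF' hFF
    rw [hF, show p - 1 - 1 = p - 2 by ring, sub_add_cancel] at this
    refine this.trans ?_
    have : 0 < p := by linarith
    gcongr
  have t2 : (F ^ (α - 1) - F' ^ (α - 1)) * G ^ β ≤ α * Q * d := by
    have := rpow_sub_rpow_le (q := α - 1) (by linarith) hF' hFF
    rw [hF, show α - 1 - 1 = α - 2 by ring, sub_add_cancel] at this
    calc (F ^ (α - 1) - F' ^ (α - 1)) * G ^ β ≤ α * F ^ (α - 2) * d * G ^ β := by gcongr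
      _ = α * (F ^ (α - 2) * G ^ β) * d := by ring
      _ ≤ α * Q * d := by gcongr
  have t3 : F' ^ (α - 1) * (G ^ β - G' ^ β) ≤ (β + 1) * Q * d := by
    rcases le_total G G' with h | h
    · have h1 : G ^ β ≤ G' ^ β := Real.rpow_le_rpow hG.le h (by linarith)
      have h2 : 0 ≤ (β + 1) * Q * d := by positivity
      have h3 : 0 < F' ^ (α - 1) := by positivity
      nlinarith
    · have h1 := rpow_sub_rpow_le (q := β) (by linarith) hG' h
      have h4 : F' ^ (α - 1) ≤ F ^ (α - 1) := Real.rpow_le_rpow hF'.le hFF (by linarith)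
      calc F' ^ (α - 1) * (G ^ β - G' ^ β)
          ≤ F ^ (α - 1) * ((β + 1) * G ^ (β - 1) * d) := by
            refine mul_le_mul h4 (h1.trans (by gcongr)) ?_ (by positivity)
            exact sub_nonneg.2 (Real.rpow_le_rpow hG'.le h (by linarith))
        _ = (β + 1) * (F ^ (α - 1) * G ^ (β - 1)) * d := by ring
        _ ≤ (β + 1) * Q * d := by gcongr
  have e : pot p c F G * d = p * Q * d + c * (α * Q * d + (β + 1) * Q * d) := by
    have e0 : pot p c F G = (p + c * (p + 1)) * Q := rfl
    rw [e0]
    linear_combination (-(c * Q * d)) * hp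
  rw [e]
  have := mul_le_mul_of_nonneg_left (add_le_add t2 t3) hc.le
  linear_combination t1 + this

/-- Half of the transformed system: `f` is a positive `C²` solution, off the origin, of
`-Δf = μ |x|⁻² f + |x|⁻ˢ (f^(p-1) + c f^(α-1) g^β)` with `g > 0`. -/
structure HalfSystem (μ s p c α β : ℝ) (f g : 𝔼 → ℝ) : Prop where
  contDiffAt : ∀ x : 𝔼, x ≠ 0 → ContDiffAt ℝ 2 f x
  pos : ∀ x : 𝔼, x ≠ 0 → 0 < f x
  pos' : ∀ x : 𝔼, x ≠ 0 → 0 < g x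
  eq : ∀ x : 𝔼, x ≠ 0 → -lapl f x = μ * ‖x‖ ^ (-2 : ℝ) * f x +
    ‖x‖ ^ (-s) * (f x ^ (p - 1) + c * f x ^ (α - 1) * g x ^ β)

lemma HalfSystem.lapl_neg {μ s p c α β : ℝ} {f g : 𝔼 → ℝ} (h : HalfSystem μ s p c α β f g)
    (hc : 0 < c) {x : 𝔼} (hx : x ≠ 0) :
    μ * ‖x‖ ^ (-2 : ℝ) * f x < -lapl f x := by
  have h1 := h.pos x hx
  have h2 := h.pos' x hx
  have h3 : 0 < ‖x‖ := norm_pos_iff.2 hx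
  rw [h.eq x hx, lt_add_iff_pos_right]
  positivity

end Comparison

section MovingPlane

variable {μ s p c α β : ℝ} {f g : EuclideanSpace ℝ (Fin n) → ℝ}
  {e : EuclideanSpace ℝ (Fin n)} {l : ℝ}

lemma ne_zero_of_inner_lt {x : 𝔼} (hl : l ≤ 0) (hx : ⟪x, e⟫ < l) : x ≠ 0 := by
  rintro rfl
  simp at hx
  linarith

lemma norm_refl_lt {x : 𝔼} (he : ‖e‖ = 1) (hl : l < 0) (hx : ⟪x, e⟫ < l) :
    ‖refl e l x‖ < ‖x‖ := by
  have := norm_refl_sq he l x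
  refine lt_of_pow_lt_pow_left₀ 2 (norm_nonneg _) ?_
  rw [this]
  nlinarith

lemma refl_eq_self {x : 𝔼} (hx : ⟪x, e⟫ = l) : refl e l x = x := by
  simp [refl, hx]

/-- The nonlinear right-hand side increases under reflection when both components do. -/
lemma rhs_mono (hμ : 0 ≤ μ) (hs : 0 ≤ s) (hc : 0 < c) (hα : 1 < α) (hβ : 1 < β)
    (hμs : 0 < μ + s)
    {r r' F F' G G' : ℝ} (hp : 1 < p) (hr' : 0 < r') (hr : r' < r) (hF : 0 < F) (hFF : F ≤ F')
    (hG : 0 < G) (hGG : G ≤ G') :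
    μ * r ^ (-2 : ℝ) * F + r ^ (-s) * (F ^ (p - 1) + c * F ^ (α - 1) * G ^ β) <
      μ * r' ^ (-2 : ℝ) * F' + r' ^ (-s) * (F' ^ (p - 1) + c * F' ^ (α - 1) * G' ^ β) := by
  have hrp : 0 < r := hr'.trans hr
  have hF' := hF.trans_le hFF
  have hG' := hG.trans_le hGG
  have a1 : r ^ (-2 : ℝ) < r' ^ (-2 : ℝ) := Real.rpow_lt_rpow_of_neg hr' hr (by norm_num)
  have a2 : r ^ (-s) ≤ r' ^ (-s) := Real.rpow_le_rpow_of_nonpos hr' hr.le (by linarith)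
  have n1 : F ^ (p - 1) ≤ F' ^ (p - 1) := Real.rpow_le_rpow hF.le hFF (by linarith)
  have n2 : F ^ (α - 1) ≤ F' ^ (α - 1) := Real.rpow_le_rpow hF.le hFF (by linarith)
  have n3 : G ^ β ≤ G' ^ β := Real.rpow_le_rpow hG.le hGG (by linarith)
  have n4 : F ^ (p - 1) + c * F ^ (α - 1) * G ^ β ≤ F' ^ (p - 1) + c * F' ^ (α - 1) * G' ^ β := by
    gcongr
  have n5 : 0 < F ^ (p - 1) + c * F ^ (α - 1) * G ^ β := by positivity
  rcases hμ.eq_or_lt with h0 | h0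
  · have hs' : 0 < s := by linarith
    have a3 : r ^ (-s) < r' ^ (-s) := Real.rpow_lt_rpow_of_neg hr' hr (by linarith)
    simp only [← h0, zero_mul, zero_add]
    exact mul_lt_mul a3 n4 n5 (by positivity)
  · refine add_lt_add_of_lt_of_le ?_ (mul_le_mul a2 n4 n5.le (by positivity))
    exact mul_lt_mul (by gcongr) hFF hF (by positivity)

/-- A negative touching point for `f ∘ refl - f` contradicts a strict supersolution. -/
lemma touching (hf : HalfSystem μ s p c α β f g) (hμ : 0 ≤ μ) (hs : 0 ≤ s) (hc : 0 < c)
    (hα : 1 < α) (hβ : 1 < β) (hp : α + β = p) (he : ‖e‖ = 1) (hl : l < 0) {x : 𝔼}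
    (hx : ⟪x, e⟫ < l) (hrx : refl e l x ≠ 0) {T : ℝ} (hT : 0 < T) {Γ : 𝔼 → ℝ}
    (hΓ : ContDiffAt ℝ 2 Γ x) (hΓpos : 0 < Γ x)
    (h₁ : f (refl e l x) - f x = -(T * Γ x)) (h₂ : -(T * Γ x) ≤ g (refl e l x) - g x)
    (hloc : ∀ᶠ y in 𝓝 x, 0 ≤ f (refl e l y) - f y + T * Γ y)
    (hsuper : (μ * ‖x‖ ^ (-2 : ℝ) + ‖x‖ ^ (-s) * pot p c (f x) (g x)) * Γ x < -lapl Γ x) :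
    False := by
  have hx0 : x ≠ 0 := ne_zero_of_inner_lt hl.le hx
  have hfx := hf.contDiffAt x hx0
  have hfr := hf.contDiffAt _ hrx
  have hfr' : ContDiffAt ℝ 2 (fun y => f (refl e l y)) x :=
    hfr.comp x (contDiff_refl e l).contDiffAt
  have hmin : IsLocalMin (fun y => (f (refl e l y) - f y) + T * Γ y) x := by
    filter_upwards [hloc] with y hy
    rw [h₁]
    linarith
  have hlap := lapl_nonneg_of_isLocalMin ((hfr'.sub hfx).add (contDiffAt_const.mul hΓ)) hmin
  rw [lapl_add (hfr'.sub hfx) (contDiffAt_const.mul hΓ), lapl_sub hfr' hfx,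
    lapl_const_mul _ hΓ, lapl_comp_refl he l hfr] at hlap
  have e1 := hf.eq x hx0
  have e2 := hf.eq _ hrx
  have hrpos : 0 < ‖refl e l x‖ := norm_pos_iff.2 hrx
  have hlt := norm_refl_lt he hl hx
  have p1 := hf.pos _ hrx
  have p2 := hf.pos' _ hrx
  have a1 : ‖x‖ ^ (-2 : ℝ) ≤ ‖refl e l x‖ ^ (-2 : ℝ) :=
    Real.rpow_le_rpow_of_nonpos hrpos hlt.le (by norm_num)
  have a2 : ‖x‖ ^ (-s) ≤ ‖refl e l x‖ ^ (-s) :=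
    Real.rpow_le_rpow_of_nonpos hrpos hlt.le (by linarith)
  have hd : 0 < T * Γ x := by positivity
  have hN := nonlinearity_sub_le hc hα hβ hp p1 (hf.pos' x hx0) p2 hd
    (by linarith : f x - f (refl e l x) = T * Γ x) (by linarith : g x - g (refl e l x) ≤ T * Γ x)
  have hxpos : 0 < ‖x‖ := norm_pos_iff.2 hx0
  have b1 : μ * ‖x‖ ^ (-2 : ℝ) * f (refl e l x) ≤
      μ * ‖refl e l x‖ ^ (-2 : ℝ) * f (refl e l x) := by gcongr
  have b2 : ‖x‖ ^ (-s) * (f (refl e l x) ^ (p - 1) +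
        c * f (refl e l x) ^ (α - 1) * g (refl e l x) ^ β) ≤
      ‖refl e l x‖ ^ (-s) * (f (refl e l x) ^ (p - 1) +
        c * f (refl e l x) ^ (α - 1) * g (refl e l x) ^ β) := by gcongr
  have b3 := mul_le_mul_of_nonneg_left hN (by positivity : 0 ≤ ‖x‖ ^ (-s))
  have b4 := mul_lt_mul_of_pos_left hsuper hT
  have b5 : μ * ‖x‖ ^ (-2 : ℝ) * f x =
      μ * ‖x‖ ^ (-2 : ℝ) * f (refl e l x) + μ * ‖x‖ ^ (-2 : ℝ) * (T * Γ x) := by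
    rw [show f x = f (refl e l x) + T * Γ x by linarith]
    ring
  linarith

end MovingPlane

/-- Admissible parameters of the transformed system. -/
structure Params (n : ℕ) (h μ s p c c' α β : ℝ) : Prop where
  three_le : 3 ≤ n
  two_mul_h : 2 * h = n - 2
  μ_nonneg : 0 ≤ μ
  μ_lt : μ < h ^ 2
  s_nonneg : 0 ≤ s
  μ_add_s : 0 < μ + s
  c_pos : 0 < c
  c'_pos : 0 < c'
  one_lt_α : 1 < α
  one_lt_β : 1 < β
  add_eq : α + β = p
  scaling : h * (p - 2) = 2 - s

namespace Params

variable {h μ s p c c' α β : ℝ}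

lemma h_pos (P : Params n h μ s p c c' α β) : 0 < h := by
  have h1 : (3 : ℝ) ≤ n := by exact_mod_cast P.three_le
  linarith [P.two_mul_h]

lemma two_lt_p (P : Params n h μ s p c c' α β) : 2 < p := by
  linarith [P.add_eq, P.one_lt_α, P.one_lt_β]

lemma swap (P : Params n h μ s p c c' α β) : Params n h μ s p c' c β α where
  three_le := P.three_le
  two_mul_h := P.two_mul_h
  μ_nonneg := P.μ_nonneg
  μ_lt := P.μ_lt
  s_nonneg := P.s_nonneg
  μ_add_s := P.μ_add_s
  c_pos := P.c'_pos
  c'_pos := P.c_pos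
  one_lt_α := P.one_lt_β
  one_lt_β := P.one_lt_α
  add_eq := by rw [add_comm, P.add_eq]
  scaling := P.scaling

end Params

/-- The full transformed system together with its admissible parameters. -/
structure System (h μ s p c c' α β : ℝ) (f g : 𝔼 → ℝ) : Prop where
  params : Params n h μ s p c c' α β
  left : HalfSystem μ s p c α β f g
  right : HalfSystem μ s p c' β α g f

/-- `f + g = o(|x|⁻ʰ)` at infinity. -/
def Decays (h : ℝ) (f g : 𝔼 → ℝ) : Prop :=
  ∀ ε > 0, ∃ R > 0, ∀ x : 𝔼, R ≤ ‖x‖ → f x + g x ≤ ε * ‖x‖ ^ (-h)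

lemma exists_rpow_neg_ge {q M r : ℝ} (hq : 0 < q) (hr : 0 < r) :
    ∃ t, 0 < t ∧ t ≤ r ∧ M ≤ t ^ (-q) := by
  have h1 := (tendsto_rpow_neg_nhdsGT_zero (neg_lt_zero.2 hq)).eventually_ge_atTop M
  have h2 : ∀ᶠ t : ℝ in 𝓝[>] 0, t ∈ Set.Ioc 0 r := Ioc_mem_nhdsGT hr
  obtain ⟨t, ht1, ht2⟩ := (h1.and h2).exists
  exact ⟨t, ht2.1, ht2.2, ht1⟩

lemma exists_forall_rpow_neg_le {q : ℝ} (hq : 0 < q) {ε : ℝ} (hε : 0 < ε) :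
    ∃ R > 0, ∀ t, R ≤ t → t ^ (-q) ≤ ε := by
  have h1 := (tendsto_rpow_neg_atTop hq).eventually_le_const hε
  obtain ⟨R, hR⟩ := eventually_atTop.1 h1
  exact ⟨max R 1, by positivity, fun t ht => hR t ((le_max_left _ _).trans ht)⟩

lemma le_of_forall_le_add_mul {A B D : ℝ} (h : ∀ δ > 0, A ≤ B + δ * D) : A ≤ B := by
  refine le_of_forall_pos_le_add fun ε hε => ?_
  have h1 : 0 < ε / (|D| + 1) := by positivity
  refine (h _ h1).trans ?_
  gcongr
  rw [div_mul_eq_mul_div, div_le_iff₀ (by positivity)]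
  gcongr
  linarith [le_abs_self D]

lemma superharmonic_ge (hn : 3 ≤ n) {W : 𝔼 → ℝ} {r m : ℝ} (hm : 0 < m)
    (hW : ∀ x : 𝔼, x ≠ 0 → ‖x‖ ≤ r → ContDiffAt ℝ 2 W x)
    (hpos : ∀ x : 𝔼, x ≠ 0 → ‖x‖ ≤ r → 0 < W x)
    (hlap : ∀ x : 𝔼, x ≠ 0 → ‖x‖ ≤ r → lapl W x < 0)
    (hbd : ∀ x : 𝔼, ‖x‖ = r → m ≤ W x) {x : 𝔼} (hx : x ≠ 0) (hxr : ‖x‖ ≤ r) : m ≤ W x := by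
  have hn' : (3 : ℝ) ≤ n := by exact_mod_cast hn
  refine le_of_forall_le_add_mul (D := ‖x‖ ^ (2 - n : ℝ)) fun δ hδ => ?_
  obtain ⟨t, ht, htx, hle⟩ := exists_rpow_neg_ge (q := n - 2) (M := m / δ) (by linarith)
    (norm_pos_iff.2 hx)
  rw [neg_sub] at hle
  have ne0 : ∀ y : 𝔼, t ≤ ‖y‖ → y ≠ 0 := fun y hy => norm_pos_iff.1 (ht.trans_le hy)
  have hcd : ∀ y : 𝔼, y ≠ 0 → ContDiffAt ℝ 2 (fun y : 𝔼 => δ * ‖y‖ ^ (2 - n : ℝ)) y :=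
    fun y hy => contDiffAt_const.mul (contDiffAt_norm_rpow _ hy)
  refine le_on_annulus (A := fun _ => m) (B := fun y => W y + δ * ‖y‖ ^ (2 - n : ℝ))
    (r₁ := t) (r₂ := r) (fun y _ _ => contDiffAt_const)
    (fun y h1 h2 => (hW y (ne0 y h1) h2).add (hcd y (ne0 y h1))) (fun y h1 h2 => ?_)
    (fun y hy => ?_) (fun y hy => ?_) (fun y h1 h2 _ => ?_) htx hxr
  · have := hpos y (ne0 y h1) h2
    positivity
  · have := hpos y (ne0 y hy.ge) (hy.le.trans (htx.trans hxr))
    rw [hy]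
    rw [div_le_iff₀ hδ] at hle
    linarith
  · by_cases hy0 : y = 0
    · rw [hy0, norm_zero] at hy
      exact absurd ((norm_pos_iff.2 hx).trans_le hxr) (by linarith)
    · have := hbd y hy
      have : 0 ≤ δ * ‖y‖ ^ (2 - n : ℝ) := by positivity
      linarith
  · have hy := ne0 y h1.le
    rw [lapl_const, lapl_add (hW y hy h2.le) (hcd y hy), lapl_const_mul _
      (contDiffAt_norm_rpow _ hy), lapl_norm_rpow _ hy]
    have := mul_pos_of_neg_of_neg (hlap y hy h2.le) (neg_lt_zero.2 hm)
    ring_nf at this ⊢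
    linarith

section Asymptotics

variable {h μ s p c c' α β : ℝ} {f g : EuclideanSpace ℝ (Fin n) → ℝ}

lemma System.swap (H : System h μ s p c c' α β f g) : System h μ s p c' c β α g f :=
  ⟨H.params.swap, H.right, H.left⟩

lemma nonlinearity_le {F G : ℝ} (hF : 0 < F) (hG : 0 < G) (hc : 0 < c) (hα : 1 < α) (hβ : 1 < β)
    (hp : α + β = p) :
    F ^ (p - 1) + c * F ^ (α - 1) * G ^ β ≤ (1 + c) * (F + G) ^ (p - 1) := by
  have h1 : F ^ (p - 1) ≤ (F + G) ^ (p - 1) :=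
    Real.rpow_le_rpow hF.le (by linarith) (by linarith)
  have h2 : F ^ (α - 1) ≤ (F + G) ^ (α - 1) :=
    Real.rpow_le_rpow hF.le (by linarith) (by linarith)
  have h3 : G ^ β ≤ (F + G) ^ β := Real.rpow_le_rpow hG.le (by linarith) (by linarith)
  have h4 : (F + G) ^ (α - 1) * (F + G) ^ β = (F + G) ^ (p - 1) := by
    rw [← Real.rpow_add (by positivity), ← hp]
    ring_nf
  calc F ^ (p - 1) + c * F ^ (α - 1) * G ^ β
      ≤ (F + G) ^ (p - 1) + c * (F + G) ^ (α - 1) * (F + G) ^ β := by gcongr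
    _ = _ := by rw [mul_assoc, h4]; ring

lemma System.neg_lapl_add_le (H : System h μ s p c c' α β f g) {x : 𝔼} (hx : x ≠ 0) :
    -lapl (fun y => f y + g y) x ≤
      (μ * ‖x‖ ^ (-2 : ℝ) + (2 + c + c') * (‖x‖ ^ (-s) * (f x + g x) ^ (p - 2))) *
        (f x + g x) := by
  have P := H.params
  have hf := H.left.pos x hx
  have hg := H.right.pos x hx
  rw [lapl_add (H.left.contDiffAt x hx) (H.right.contDiffAt x hx)]
  have e1 := H.left.eq x hx
  have e2 := H.right.eq x hx
  have n1 := nonlinearity_le hf hg P.c_pos P.one_lt_α P.one_lt_β P.add_eq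
  have n2 := nonlinearity_le hg hf P.c'_pos P.one_lt_β P.one_lt_α P.swap.add_eq
  rw [add_comm (g x)] at n2
  have e3 : (f x + g x) ^ (p - 1) = (f x + g x) ^ (p - 2) * (f x + g x) := by
    rw [← Real.rpow_add_one (by positivity)]
    ring_nf
  rw [e3] at n1 n2
  have n3 := mul_le_mul_of_nonneg_left (add_le_add n1 n2) (by positivity : 0 ≤ ‖x‖ ^ (-s))
  linarith

/-- Upper bound at infinity by a power between `h` and the larger indicial root. -/
lemma System.exists_upper (H : System h μ s p c c' α β f g) (hd : Decays h f g) {τ : ℝ}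
    (hτμ : μ < τ * (2 * h - τ)) :
    ∃ C > 0, ∃ R > 0, ∀ x : 𝔼, R ≤ ‖x‖ → f x + g x ≤ C * ‖x‖ ^ (-τ) := by
  have P := H.params
  have hh := P.h_pos
  have hp2 := P.two_lt_p
  have hc := P.c_pos
  have hc' := P.c'_pos
  set lam := τ * (2 * h - τ) with hlam
  have hlamh : lam ≤ h ^ 2 := by nlinarith [sq_nonneg (τ - h)]
  set C₀ := 2 + c + c'
  have hC₀ : 0 < C₀ := by positivity
  set ε := ((lam - μ) / (2 * C₀)) ^ (1 / (p - 2)) with hε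
  have hεpos : 0 < ε := by
    have : 0 < lam - μ := by linarith
    positivity
  have hεp : C₀ * ε ^ (p - 2) = (lam - μ) / 2 := by
    rw [hε, ← Real.rpow_mul (div_nonneg (by linarith) (by positivity)), one_div,
      inv_mul_cancel₀ (by linarith), Real.rpow_one]
    field_simp
  obtain ⟨R, hR, hRd⟩ := hd ε hεpos
  have ne0 : ∀ y : 𝔼, R ≤ ‖y‖ → y ≠ 0 := fun y hy => norm_pos_iff.1 (hR.trans_le hy)
  refine ⟨ε * R ^ (τ - h), by positivity, R, hR, fun x hx => ?_⟩
  set C₁ := ε * R ^ (τ - h) with hC₁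
  refine le_of_forall_le_add_mul (D := ‖x‖ ^ (-h)) fun δ hδ => ?_
  obtain ⟨R', hR', hRd'⟩ := hd δ hδ
  have c1 : ∀ y : 𝔼, y ≠ 0 → ContDiffAt ℝ 2 (fun y : 𝔼 => C₁ * ‖y‖ ^ (-τ)) y :=
    fun y hy => contDiffAt_const.mul (contDiffAt_norm_rpow _ hy)
  have c2 : ∀ y : 𝔼, y ≠ 0 → ContDiffAt ℝ 2 (fun y : 𝔼 => δ * ‖y‖ ^ (-h)) y :=
    fun y hy => contDiffAt_const.mul (contDiffAt_norm_rpow _ hy)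
  refine le_on_annulus (A := fun y => f y + g y) (B := fun y => C₁ * ‖y‖ ^ (-τ) + δ * ‖y‖ ^ (-h))
    (r₁ := R) (r₂ := max ‖x‖ R')
    (fun y h1 _ => (H.left.contDiffAt y (ne0 y h1)).add (H.right.contDiffAt y (ne0 y h1)))
    (fun y h1 h2 => (c1 y (ne0 y h1)).add (c2 y (ne0 y h1))) (fun y h1 h2 => ?_)
    (fun y hy => ?_) (fun y hy => ?_) (fun y h1 h2 h3 => ?_) hx (le_max_left _ _)
  · have := hR.trans_le h1
    positivity
  · have h1 := hRd y hy.ge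
    rw [hy] at h1 ⊢
    have h2 : C₁ * R ^ (-τ) = ε * R ^ (-h) := by
      rw [hC₁, mul_assoc, ← Real.rpow_add hR]
      ring_nf
    rw [h2]
    have : 0 ≤ δ * R ^ (-h) := by positivity
    linarith
  · have h1 := hRd' y (by rw [hy]; exact le_max_right _ _)
    have : 0 ≤ C₁ * ‖y‖ ^ (-τ) := by positivity
    linarith
  · have hy := ne0 y h1.le
    have hyp : 0 < ‖y‖ := norm_pos_iff.2 hy
    have k1 := H.neg_lapl_add_le hy
    have k2 := hRd y h1.le
    have k3 : ‖y‖ ^ (-s) * (f y + g y) ^ (p - 2) ≤ ‖y‖ ^ (-2 : ℝ) * ε ^ (p - 2) := by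
      calc ‖y‖ ^ (-s) * (f y + g y) ^ (p - 2)
          ≤ ‖y‖ ^ (-s) * (ε * ‖y‖ ^ (-h)) ^ (p - 2) := by
            gcongr
        _ = ‖y‖ ^ (-s + -h * (p - 2)) * ε ^ (p - 2) := by
            rw [Real.mul_rpow hεpos.le (by positivity), ← Real.rpow_mul hyp.le,
              Real.rpow_add hyp]
            ring
        _ = _ := by
            rw [show -s + -h * (p - 2) = -2 by linarith [P.scaling]]
    set S := f y + g y with hS
    set D := ‖y‖ ^ (-2 : ℝ) with hD
    have hDpos : 0 < D := by positivity
    have k4 : -lapl (fun y => f y + g y) y ≤ (lam + μ) / 2 * D * S := by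
      refine k1.trans ?_
      have : C₀ * (‖y‖ ^ (-s) * S ^ (p - 2)) ≤ (lam - μ) / 2 * D := by
        rw [← hεp]
        calc _ ≤ C₀ * (D * ε ^ (p - 2)) := by gcongr
          _ = _ := by ring
      have := mul_le_mul_of_nonneg_right this h3.le
      linarith
    set B1 := C₁ * ‖y‖ ^ (-τ) with hB1
    set B2 := δ * ‖y‖ ^ (-h) with hB2
    have hB1p : 0 < B1 := by positivity
    have hB2p : 0 < B2 := by positivity
    have k5 : -lapl (fun y : 𝔼 => C₁ * ‖y‖ ^ (-τ) + δ * ‖y‖ ^ (-h)) y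
        = lam * D * B1 + h ^ 2 * D * B2 := by
      rw [lapl_add (c1 y hy) (c2 y hy), lapl_const_mul _ (contDiffAt_norm_rpow _ hy),
        lapl_const_mul _ (contDiffAt_norm_rpow _ hy), lapl_norm_rpow _ hy, lapl_norm_rpow _ hy,
        show -τ - 2 = -τ + -2 by ring, show -h - 2 = -h + -2 by ring, Real.rpow_add hyp,
        Real.rpow_add hyp, hB1, hB2, hlam, show (n : ℝ) = 2 * h + 2 by linarith [P.two_mul_h]]
      ring
    rw [k5]
    calc -lapl (fun y => f y + g y) y * (B1 + B2)
        ≤ (lam + μ) / 2 * D * S * (B1 + B2) := by gcongr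
      _ < lam * D * S * (B1 + B2) := by
          gcongr
          linarith
      _ = (lam * D * B1 + lam * D * B2) * S := by ring
      _ ≤ (lam * D * B1 + h ^ 2 * D * B2) * S := by gcongr

lemma exists_pos_le_of_compact {K : Set (EuclideanSpace ℝ (Fin n))} (hK : IsCompact K)
    {w : EuclideanSpace ℝ (Fin n) → ℝ}
    (hw : ContinuousOn w K) (hpos : ∀ x ∈ K, 0 < w x) : ∃ m > 0, ∀ x ∈ K, m ≤ w x := by
  rcases K.eq_empty_or_nonempty with rfl | hne
  · exact ⟨1, one_pos, by simp⟩
  · obtain ⟨z, hz, hmin⟩ := hK.exists_isMinOn hne hw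
    exact ⟨w z, hpos z hz, fun x hx => hmin hx⟩

/-- Lower bound at infinity by the larger indicial root. -/
lemma HalfSystem.exists_lower (P : Params n h μ s p c c' α β) (hf : HalfSystem μ s p c α β f g)
    {γ : ℝ} (hγ : h < γ) (hγμ : γ * (2 * h - γ) = μ) :
    ∃ m > 0, ∀ x : 𝔼, 1 ≤ ‖x‖ → m * ‖x‖ ^ (-γ) ≤ f x := by
  have hh := P.h_pos
  have ne0 : ∀ y : 𝔼, 1 ≤ ‖y‖ → y ≠ 0 := fun y hy => norm_pos_iff.1 (one_pos.trans_le hy)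
  obtain ⟨m, hm, hmle⟩ := exists_pos_le_of_compact (isCompact_sphere (0 : 𝔼) 1) (w := f)
    (fun x hx => (hf.contDiffAt x (ne0 x (by simp at hx; exact hx.ge))
      ).continuousAt.continuousWithinAt)
    (fun x hx => hf.pos x (ne0 x (by simp at hx; exact hx.ge)))
  refine ⟨m, hm, fun x hx => ?_⟩
  refine le_of_forall_le_add_mul (D := ‖x‖ ^ (-h)) fun δ hδ => ?_
  obtain ⟨R', hR', hRd'⟩ := exists_forall_rpow_neg_le (q := γ - h) (by linarith)
    (ε := δ / m) (by positivity)
  have c1 : ∀ y : 𝔼, y ≠ 0 → ContDiffAt ℝ 2 (fun y : 𝔼 => m * ‖y‖ ^ (-γ)) y :=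
    fun y hy => contDiffAt_const.mul (contDiffAt_norm_rpow _ hy)
  have c2 : ∀ y : 𝔼, y ≠ 0 → ContDiffAt ℝ 2 (fun y : 𝔼 => δ * ‖y‖ ^ (-h)) y :=
    fun y hy => contDiffAt_const.mul (contDiffAt_norm_rpow _ hy)
  refine le_on_annulus (A := fun y => m * ‖y‖ ^ (-γ)) (B := fun y => f y + δ * ‖y‖ ^ (-h))
    (r₁ := 1) (r₂ := max ‖x‖ R') (fun y h1 _ => c1 y (ne0 y h1))
    (fun y h1 h2 => (hf.contDiffAt y (ne0 y h1)).add (c2 y (ne0 y h1))) (fun y h1 h2 => ?_)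
    (fun y hy => ?_) (fun y hy => ?_) (fun y h1 h2 h3 => ?_) hx (le_max_left _ _)
  · have := hf.pos y (ne0 y h1)
    positivity
  · have h1 := hmle y (by simp [hy])
    simp only [hy, Real.one_rpow]
    linarith
  · have h1 := hRd' ‖y‖ (by rw [hy]; exact le_max_right _ _)
    have hyp : 1 ≤ ‖y‖ := by rw [hy]; exact hx.trans (le_max_left _ _)
    have h2 := hf.pos y (ne0 y hyp)
    rw [le_div_iff₀ hm] at h1
    have h3 : ‖y‖ ^ (-γ) = ‖y‖ ^ (-(γ - h)) * ‖y‖ ^ (-h) := by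
      rw [← Real.rpow_add (by positivity)]
      ring_nf
    have h4 : m * ‖y‖ ^ (-γ) ≤ δ * ‖y‖ ^ (-h) := by
      rw [h3, ← mul_assoc, mul_comm m]
      gcongr
    linarith
  · have hy := ne0 y h1.le
    have hyp : 0 < ‖y‖ := norm_pos_iff.2 hy
    have k1 := hf.lapl_neg P.c_pos hy
    set D := ‖y‖ ^ (-2 : ℝ) with hD
    have hDpos : 0 < D := by positivity
    set B2 := δ * ‖y‖ ^ (-h) with hB2
    set A := m * ‖y‖ ^ (-γ) with hA
    have hB2p : 0 < B2 := by positivity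
    have k4 : -lapl (fun y : 𝔼 => m * ‖y‖ ^ (-γ)) y = μ * D * A := by
      rw [lapl_const_mul _ (contDiffAt_norm_rpow _ hy), lapl_norm_rpow _ hy,
        show -γ - 2 = -γ + -2 by ring, Real.rpow_add hyp, hA, ← hγμ,
        show (n : ℝ) = 2 * h + 2 by linarith [P.two_mul_h]]
      ring
    have k5 : -lapl (fun y : 𝔼 => f y + δ * ‖y‖ ^ (-h)) y = -lapl f y + h ^ 2 * D * B2 := by
      rw [lapl_add (hf.contDiffAt y hy) (c2 y hy),
        lapl_const_mul _ (contDiffAt_norm_rpow _ hy), lapl_norm_rpow _ hy,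
        show -h - 2 = -h + -2 by ring, Real.rpow_add hyp, hB2,
        show (n : ℝ) = 2 * h + 2 by linarith [P.two_mul_h]]
      ring
    rw [k4, k5]
    calc μ * D * A * (f y + B2) = (μ * D * f y + μ * D * B2) * A := by ring
      _ < (-lapl f y + h ^ 2 * D * B2) * A := by
        have : μ * D * B2 ≤ h ^ 2 * D * B2 := by gcongr; exact P.μ_lt.le
        exact mul_lt_mul_of_pos_right (by linarith) h3

lemma System.pot_decay (H : System h μ s p c c' α β f g) (hd : Decays h f g) (c₀ : ℝ)
    (hc₀ : 0 < c₀) {ε : ℝ} (hε : 0 < ε) :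
    ∃ R > 0, ∀ x : 𝔼, R ≤ ‖x‖ →
      ‖x‖ ^ (-s) * pot p c₀ (f x) (g x) ≤ ε * ‖x‖ ^ (-2 : ℝ) := by
  have P := H.params
  have hh := P.h_pos
  have hp2 := P.two_lt_p
  set d := √(h ^ 2 - μ) with hdd
  have hdpos : 0 < d := Real.sqrt_pos.2 (by linarith [P.μ_lt])
  have hd2 : d ^ 2 = h ^ 2 - μ := Real.sq_sqrt (by linarith [P.μ_lt])
  set γ := h + d with hγ
  have hγμ : γ * (2 * h - γ) = μ := by rw [hγ]; linear_combination -hd2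
  have hlt : (2 * γ + (2 - s)) / p < γ := by
    rw [div_lt_iff₀ (by linarith), ← P.scaling]
    nlinarith
  obtain ⟨τ, hτ1, hτ2⟩ := exists_between (max_lt (by linarith : h < γ) hlt)
  have hτh : h < τ := (le_max_left _ _).trans_lt hτ1
  have hτp : (2 * γ + (2 - s)) / p < τ := (le_max_right _ _).trans_lt hτ1
  rw [div_lt_iff₀ (by linarith)] at hτp
  obtain ⟨C, hC, R₁, hR₁, hup⟩ := H.exists_upper hd (τ := τ) (by
    rw [← hγμ]; nlinarith)
  obtain ⟨m₁, hm₁, hlo₁⟩ := H.left.exists_lower P (by linarith : h < γ) hγμ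
  obtain ⟨m₂, hm₂, hlo₂⟩ := H.right.exists_lower P.swap (by linarith : h < γ) hγμ
  set m := min m₁ m₂ with hm
  have hmpos : 0 < m := lt_min hm₁ hm₂
  set L := (p + c₀ * (p + 1)) * (C ^ p / m ^ 2) with hL
  have hLpos : 0 < L := by
    have : 0 < p := by linarith
    positivity
  obtain ⟨R₂, hR₂, hsm⟩ := exists_forall_rpow_neg_le (q := τ * p - 2 * γ - (2 - s))
    (by linarith) (ε := ε / L) (by positivity)
  refine ⟨max (max R₁ R₂) 1, by positivity, fun x hx => ?_⟩
  have hx1 : 1 ≤ ‖x‖ := (le_max_right _ _).trans hx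
  have hxp : 0 < ‖x‖ := by linarith
  have hxR1 : R₁ ≤ ‖x‖ := ((le_max_left _ _).trans (le_max_left _ _)).trans hx
  have hxR2 : R₂ ≤ ‖x‖ := ((le_max_right _ _).trans (le_max_left _ _)).trans hx
  have k1 := hup x hxR1
  have k2 : m * ‖x‖ ^ (-γ) ≤ min (f x) (g x) := by
    refine le_min (le_trans ?_ (hlo₁ x hx1)) (le_trans ?_ (hlo₂ x hx1))
    · gcongr; exact min_le_left _ _
    · gcongr; exact min_le_right _ _
  have hx0 : x ≠ 0 := norm_pos_iff.1 hxp
  have hfp := H.left.pos x hx0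
  have hgp := H.right.pos x hx0
  have k3 := hsm _ hxR2
  rw [le_div_iff₀ hLpos] at k3
  have hpp : 0 < p := by linarith
  calc ‖x‖ ^ (-s) * pot p c₀ (f x) (g x)
      ≤ ‖x‖ ^ (-s) * ((p + c₀ * (p + 1)) * ((C * ‖x‖ ^ (-τ)) ^ p / (m * ‖x‖ ^ (-γ)) ^ 2)) := by
        unfold pot
        gcongr
    _ = (‖x‖ ^ (-s) * (‖x‖ ^ (-τ)) ^ p * ((‖x‖ ^ (-γ)) ^ 2)⁻¹) * L := by
        rw [Real.mul_rpow hC.le (by positivity), hL, mul_pow]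
        field_simp
    _ = (‖x‖ ^ (-(τ * p - 2 * γ - (2 - s))) * L) * ‖x‖ ^ (-2 : ℝ) := by
        rw [← Real.rpow_mul hxp.le, ← Real.rpow_natCast, ← Real.rpow_mul hxp.le,
          ← Real.rpow_neg hxp.le, ← Real.rpow_add hxp, ← Real.rpow_add hxp, mul_right_comm,
          ← Real.rpow_add hxp]
        congr 2
        push_cast
        ring
    _ ≤ ε * ‖x‖ ^ (-2 : ℝ) := by gcongr

end Asymptotics

section Sliding

variable {h μ s p c c' α β : ℝ} {f g : EuclideanSpace ℝ (Fin n) → ℝ}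
  {e : EuclideanSpace ℝ (Fin n)} {l : ℝ}

/-- Both components increase under reflection across the hyperplane `⟨x, e⟩ = l`. -/
def Moved (e : 𝔼) (f g : 𝔼 → ℝ) (l : ℝ) : Prop :=
  ∀ x, ⟪x, e⟫ < l → refl e l x ≠ 0 → f x ≤ f (refl e l x) ∧ g x ≤ g (refl e l x)

lemma Moved.swap (hm : Moved e f g l) : Moved e g f l := fun x hx hr => (hm x hx hr).symm

/-- A positive comparison function, strictly superharmonic for a large potential. -/
def barrier (h N l₀ : ℝ) (e x : 𝔼) : ℝ :=
  ‖x‖ ^ (-h) * (1 + -(1 / 2) * Real.exp (N * ⟪x, e⟫ + (-(N * l₀) - 1)))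

lemma barrier_factor_bounds {N l₀ : ℝ} {x : 𝔼} (hx : N * (⟪x, e⟫ - l₀) ≤ 1) :
    1 / 2 ≤ 1 + -(1 / 2) * Real.exp (N * ⟪x, e⟫ + (-(N * l₀) - 1)) ∧
      1 + -(1 / 2) * Real.exp (N * ⟪x, e⟫ + (-(N * l₀) - 1)) ≤ 1 := by
  have h1 : Real.exp (N * ⟪x, e⟫ + (-(N * l₀) - 1)) ≤ 1 := Real.exp_le_one_iff.2 (by linarith)
  have h2 := Real.exp_pos (N * ⟪x, e⟫ + (-(N * l₀) - 1))
  constructor <;> linarith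

lemma contDiffAt_barrier_factor (N c₀ : ℝ) (e x : 𝔼) :
    ContDiffAt ℝ 2 (fun y : 𝔼 => 1 + -(1 / 2) * Real.exp (N * ⟪y, e⟫ + c₀)) x :=
  contDiffAt_const.add (contDiffAt_const.mul (contDiff_exp_inner e N c₀).contDiffAt)

lemma contDiffAt_barrier (N l₀ : ℝ) (e : 𝔼) {x : 𝔼} (hx : x ≠ 0) :
    ContDiffAt ℝ 2 (barrier h N l₀ e) x :=
  (contDiffAt_norm_rpow _ hx).mul (contDiffAt_barrier_factor _ _ _ _)

lemma barrier_super (h_eq : 2 * h = n - 2) (h_pos : 0 < h) (he : ‖e‖ = 1) {N l₀ : ℝ} (hN : 0 ≤ N)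
    {x : 𝔼} (hx0 : x ≠ 0) (hxe : ⟪x, e⟫ ≤ 0) (hx : N * (⟪x, e⟫ - l₀) ≤ 1) {V : ℝ}
    (hV : V < h ^ 2 * ‖x‖ ^ (-2 : ℝ) +
      1 / 2 * N ^ 2 * Real.exp (N * ⟪x, e⟫ + (-(N * l₀) - 1))) :
    V * barrier h N l₀ e x < -lapl (barrier h N l₀ e) x := by
  obtain ⟨b1, b2⟩ := barrier_factor_bounds hx
  have hxp : 0 < ‖x‖ := norm_pos_iff.2 hx0
  have hexp := (contDiff_exp_inner e N (-(N * l₀) - 1)).contDiffAt (x := x)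
  have e1 : lapl (fun y : 𝔼 => 1 + -(1 / 2) * Real.exp (N * ⟪y, e⟫ + (-(N * l₀) - 1))) x =
      -(1 / 2) * (N ^ 2 * Real.exp (N * ⟪x, e⟫ + (-(N * l₀) - 1))) := by
    rw [lapl_add contDiffAt_const (contDiffAt_const.mul hexp), lapl_const,
      lapl_const_mul _ hexp, lapl_exp_inner he, zero_add]
  have e2 : fderiv ℝ (fun y : 𝔼 => 1 + -(1 / 2) * Real.exp (N * ⟪y, e⟫ + (-(N * l₀) - 1))) x x =
      -(1 / 2) * (N * Real.exp (N * ⟪x, e⟫ + (-(N * l₀) - 1)) * ⟪x, e⟫) := by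
    rw [fderiv_const_add, fderiv_const_mul (hexp.differentiableAt (by norm_num)),
      ← fderiv_exp_inner]
    rfl
  have e3 : ‖x‖ ^ (-h - 2) = ‖x‖ ^ (-h) * ‖x‖ ^ (-2 : ℝ) := by
    rw [← Real.rpow_add hxp]; ring_nf
  unfold barrier
  rw [lapl_norm_rpow_mul _ hx0 (contDiffAt_barrier_factor _ _ _ _), e1, e2, e3,
    show (n : ℝ) = 2 * h + 2 by linarith]
  set E := Real.exp (N * ⟪x, e⟫ + (-(N * l₀) - 1))
  set A := ‖x‖ ^ (-h)
  set D := ‖x‖ ^ (-2 : ℝ)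
  have hE : 0 < E := Real.exp_pos _
  have hA : 0 < A := by positivity
  have hD : 0 < D := by positivity
  set φ := 1 + -(1 / 2) * E with hφ
  have hφp : 0 < φ := by linarith
  have i1 : V * φ < h ^ 2 * D * φ + 1 / 2 * N ^ 2 * E := by
    have := mul_lt_mul_of_pos_right hV hφp
    have h3 : 1 / 2 * N ^ 2 * E * φ ≤ 1 / 2 * N ^ 2 * E * 1 := by gcongr
    linarith
  have i2 : 0 ≤ h * (A * D) * (N * E * -⟪x, e⟫) := by
    have : 0 ≤ -⟪x, e⟫ := by linarith
    positivity
  have i3 := mul_lt_mul_of_pos_left i1 hA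
  linarith

lemma pot_mono {F G : ℝ} (hp : 0 < p) (hF : 0 < F) (hG : 0 < G) (hcc : c ≤ c') :
    pot p c F G ≤ pot p c' F G := by
  unfold pot
  have : 0 < min F G := lt_min hF hG
  gcongr

/-- The moving plane step: a sufficient condition for both components to increase under
reflection. -/
lemma System.moved (H : System h μ s p c c' α β f g) (hd : Decays h f g) (he : ‖e‖ = 1)
    (hl : l < 0) {N l₀ : ℝ} (hN : 0 ≤ N) (hNl : N * (l - l₀) ≤ 1)
    (hV : ∀ x, ⟪x, e⟫ < l → refl e l x ≠ 0 →
      (f x ≤ f (refl e l x) ∧ g x ≤ g (refl e l x)) ∨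
      μ * ‖x‖ ^ (-2 : ℝ) + ‖x‖ ^ (-s) * pot p (c + c') (f x) (g x) <
        h ^ 2 * ‖x‖ ^ (-2 : ℝ) + 1 / 2 * N ^ 2 * Real.exp (N * ⟪x, e⟫ + (-(N * l₀) - 1)))
    (h0 : ∃ r > 0, ∀ y, y ≠ 0 → ‖y‖ ≤ r → f (refl e l y) ≤ f y ∧ g (refl e l y) ≤ g y) :
    Moved e f g l := by
  have P := H.params
  have hh := P.h_pos
  set Γ := barrier h N l₀ e with hΓ
  set m : 𝔼 → ℝ := fun x => min (f (refl e l x) - f x) (g (refl e l x) - g x) with hm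
  have hNx : ∀ x : 𝔼, ⟪x, e⟫ ≤ l → N * (⟪x, e⟫ - l₀) ≤ 1 := fun x hx =>
    le_trans (mul_le_mul_of_nonneg_left (by linarith) hN) hNl
  have x0 : ∀ x : 𝔼, ⟪x, e⟫ ≤ l → x ≠ 0 := by
    rintro x hx rfl
    rw [inner_zero_left] at hx
    linarith
  have hΓlo : ∀ x : 𝔼, ⟪x, e⟫ ≤ l → 1 / 2 * ‖x‖ ^ (-h) ≤ Γ x := fun x hx => by
    have := (barrier_factor_bounds (hNx x hx)).1
    rw [hΓ, barrier, mul_comm]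
    gcongr
  have hΓpos : ∀ x : 𝔼, ⟪x, e⟫ ≤ l → 0 < Γ x := fun x hx => by
    refine lt_of_lt_of_le ?_ (hΓlo x hx)
    have := norm_pos_iff.2 (x0 x hx)
    positivity
  suffices hmain : ∀ x, ⟪x, e⟫ < l → refl e l x ≠ 0 → 0 ≤ m x by
    intro x hx hr
    have := hmain x hx hr
    rw [hm, le_min_iff] at this
    exact ⟨by linarith, by linarith⟩
  by_contra! hcon
  obtain ⟨x₁, hx₁l, hx₁r, hx₁m⟩ := hcon
  set T₁ := -(m x₁ / Γ x₁) with hT₁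
  have hT₁pos : 0 < T₁ := by
    have := div_neg_of_neg_of_pos hx₁m (hΓpos x₁ hx₁l.le)
    linarith
  obtain ⟨R, hR, hdec⟩ := hd (T₁ / 2) (by positivity)
  obtain ⟨r, hr, hnear⟩ := h0
  have hfar : ∀ x, ⟪x, e⟫ ≤ l → refl e l x ≠ 0 → R ≤ ‖x‖ → -(T₁ * Γ x) ≤ m x := by
    intro x hx hrx hxR
    have h1 := hdec x hxR
    have h2 := hΓlo x hx
    have h3 := H.left.pos x (x0 x hx)
    have h4 := H.right.pos x (x0 x hx)
    have h5 := H.left.pos _ hrx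
    have h6 := H.right.pos _ hrx
    have h7 := mul_le_mul_of_nonneg_left h2 hT₁pos.le
    refine le_min ?_ ?_ <;> linarith
  have hclose : ∀ x, refl e l x ≠ 0 → ‖refl e l x‖ ≤ r → 0 ≤ m x := by
    intro x hrx hxr
    have := hnear _ hrx hxr
    rw [refl_refl he] at this
    exact le_min (by linarith) (by linarith)
  set r' := min r ‖refl e l x₁‖ with hr'
  have hr'pos : 0 < r' := lt_min hr (norm_pos_iff.2 hx₁r)
  set R' := max R ‖x₁‖ with hR'
  have hcont : Continuous (refl e l) := (contDiff_refl e l).continuous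
  set K : Set 𝔼 := {x | ⟪x, e⟫ ≤ l} ∩ {x | ‖x‖ ≤ R'} ∩ {x | r' ≤ ‖refl e l x‖} with hK
  have hKcl : IsClosed K := by
    refine ((isClosed_le ?_ ?_).inter (isClosed_le ?_ ?_)).inter (isClosed_le ?_ ?_) <;> fun_prop
  have hKc : IsCompact K := by
    refine (isCompact_closedBall (0 : 𝔼) R').of_isClosed_subset hKcl fun y hy => ?_
    simpa using hy.1.2
  have hKr : ∀ x ∈ K, refl e l x ≠ 0 := fun x hx => norm_pos_iff.1 (hr'pos.trans_le hx.2)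
  have hfr : ∀ {w : 𝔼 → ℝ}, (∀ y : 𝔼, y ≠ 0 → ContDiffAt ℝ 2 w y) → ∀ x ∈ K,
      ContinuousAt (fun x => w (refl e l x) - w x) x := fun hw x hx =>
    ((hw _ (hKr x hx)).continuousAt.comp (f := refl e l) hcont.continuousAt).sub
      (hw x (x0 x hx.1.1)).continuousAt
  have hx₁K : x₁ ∈ K := ⟨⟨hx₁l.le, le_max_right R ‖x₁‖⟩, min_le_right r ‖refl e l x₁‖⟩
  obtain ⟨z, hz, hzmin⟩ := hKc.exists_isMinOn ⟨x₁, hx₁K⟩ (f := fun x => m x / Γ x)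
    (fun x hx => ContinuousAt.continuousWithinAt <|
      ContinuousAt.div ((hfr H.left.contDiffAt x hx).min (hfr H.right.contDiffAt x hx))
      (contDiffAt_barrier N l₀ e (x0 x hx.1.1)).continuousAt (hΓpos x hx.1.1).ne')
  set T := -(m z / Γ z) with hT
  have hTT : T₁ ≤ T := by
    have : m z / Γ z ≤ m x₁ / Γ x₁ := hzmin hx₁K
    linarith
  have hTpos : 0 < T := hT₁pos.trans_le hTT
  have hmz : m z = -(T * Γ z) := by
    have := (hΓpos z hz.1.1).ne'
    rw [hT]; field_simp
  have hglob : ∀ x, ⟪x, e⟫ < l → refl e l x ≠ 0 → -(T * Γ x) ≤ m x := by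
    intro x hx hrx
    have hΓx := hΓpos x hx.le
    by_cases h1 : r' ≤ ‖refl e l x‖
    · by_cases h2 : ‖x‖ ≤ R'
      · have h3 : m z / Γ z ≤ m x / Γ x := hzmin (show x ∈ K from ⟨⟨hx.le, h2⟩, h1⟩)
        rw [le_div_iff₀ hΓx] at h3
        linarith
      · have h3 := hfar x hx.le hrx ((le_max_left _ _).trans (not_le.1 h2).le)
        have h4 := mul_le_mul_of_nonneg_right hTT hΓx.le
        linarith
    · have h3 := hclose x hrx ((not_le.1 h1).le.trans (min_le_left _ _))
      have : 0 < T * Γ x := by positivity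
      linarith
  have hzl : ⟪z, e⟫ < l := by
    refine lt_of_le_of_ne hz.1.1 fun heq => ?_
    have hz0 : m z = 0 := by simp [hm, refl_eq_self heq]
    have := hΓpos z hz.1.1
    have : 0 < T * Γ z := by positivity
    linarith
  have hzr := hKr z hz
  have hΓz := hΓpos z hz.1.1
  have hTΓ : 0 < T * Γ z := by positivity
  have hnhds : ∀ᶠ y in 𝓝 z, -(T * Γ y) ≤ m y := by
    have o1 : IsOpen {y : 𝔼 | ⟪y, e⟫ < l} := isOpen_lt (by fun_prop) continuous_const
    have o2 : IsOpen {y : 𝔼 | refl e l y ≠ 0} := isOpen_ne_fun hcont continuous_const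
    filter_upwards [o1.mem_nhds hzl, o2.mem_nhds hzr] with y h1 h2
    exact hglob y h1 h2
  have hz0 := x0 z hz.1.1
  have hzp : 0 < ‖z‖ := norm_pos_iff.2 hz0
  have hpz := H.left.pos z hz0
  have hqz := H.right.pos z hz0
  rcases hV z hzl hzr with ⟨h1, h2⟩ | hVz
  · have : 0 ≤ m z := le_min (by linarith) (by linarith)
    linarith
  have hp0 : 0 < p := by linarith [P.two_lt_p]
  rcases min_choice (f (refl e l z) - f z) (g (refl e l z) - g z) with hc | hc
  · refine touching H.left P.μ_nonneg P.s_nonneg P.c_pos P.one_lt_α P.one_lt_β P.add_eq he hl hzl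
      hzr hTpos (contDiffAt_barrier N l₀ e hz0) hΓz (hc.symm.trans hmz)
      (hmz.symm.le.trans (min_le_right _ _)) ?_
      (barrier_super P.two_mul_h hh he hN hz0 (by linarith) (hNx z hz.1.1)
        (lt_of_le_of_lt ?_ hVz))
    · filter_upwards [hnhds] with y hy
      have := hy.trans (min_le_left _ _)
      linarith
    · have := pot_mono hp0 hpz hqz (by linarith [P.c'_pos] : c ≤ c + c')
      gcongr
  · refine touching H.right P.μ_nonneg P.s_nonneg P.c'_pos P.one_lt_β P.one_lt_α P.swap.add_eq he
      hl hzl hzr hTpos (contDiffAt_barrier N l₀ e hz0) hΓz (hc.symm.trans hmz)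
      (hmz.symm.le.trans (min_le_left _ _)) ?_
      (barrier_super P.two_mul_h hh he hN hz0 (by linarith) (hNx z hz.1.1)
        (lt_of_le_of_lt ?_ hVz))
    · filter_upwards [hnhds] with y hy
      have := hy.trans (min_le_right _ _)
      linarith
    · have := pot_mono hp0 hqz hpz (by linarith [P.c_pos] : c' ≤ c + c')
      rw [pot_comm p (c + c')]
      gcongr

end Sliding

section Continuation

variable {h μ s p c c' α β : ℝ} {f g : EuclideanSpace ℝ (Fin n) → ℝ}
  {e : EuclideanSpace ℝ (Fin n)} {l : ℝ}

lemma HalfSystem.lapl_neg_of_params (P : Params n h μ s p c c' α β)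
    (hf : HalfSystem μ s p c α β f g) {x : 𝔼} (hx : x ≠ 0) : lapl f x < 0 := by
  have h1 := hf.lapl_neg P.c_pos hx
  have h2 := hf.pos x hx
  have h3 := P.μ_nonneg
  have h4 : 0 ≤ μ * ‖x‖ ^ (-2 : ℝ) * f x := by positivity
  linarith

lemma abs_inner_le_norm_of_unit (he : ‖e‖ = 1) (x : 𝔼) : |⟪x, e⟫| ≤ ‖x‖ := by
  simpa [he] using abs_real_inner_le_norm x e

lemma refl_ne_zero (he : ‖e‖ = 1) {y : 𝔼} (hy : 2 * l < ⟪y, e⟫) :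
    refl e l y ≠ 0 := by
  intro h0
  have h1 := inner_refl he l y
  rw [h0, inner_zero_left] at h1
  linarith

lemma HalfSystem.exists_lower_near_zero (P : Params n h μ s p c c' α β)
    (hf : HalfSystem μ s p c α β f g) :
    ∃ m > 0, ∀ y : 𝔼, y ≠ 0 → ‖y‖ ≤ 1 → m ≤ f y := by
  have ne0 : ∀ y ∈ Metric.sphere (0 : 𝔼) 1, y ≠ 0 := fun y hy =>
    norm_pos_iff.1 (by rw [mem_sphere_zero_iff_norm.1 hy]; exact one_pos)
  obtain ⟨m, hm, hle⟩ := exists_pos_le_of_compact (isCompact_sphere (0 : 𝔼) 1) (w := f)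
    (fun x hx => (hf.contDiffAt x (ne0 x hx)).continuousAt.continuousWithinAt)
    (fun x hx => hf.pos x (ne0 x hx))
  exact ⟨m, hm, fun y hy hy1 => superharmonic_ge P.three_le hm (fun x hx _ => hf.contDiffAt x hx)
    (fun x hx _ => hf.pos x hx) (fun x hx _ => hf.lapl_neg_of_params P hx)
    (fun x hx => hle x (mem_sphere_zero_iff_norm.2 hx)) hy hy1⟩

lemma System.potential_lt (H : System h μ s p c c' α β f g) (hd : Decays h f g) :
    ∃ R > 0, ∀ x : 𝔼, R ≤ ‖x‖ →
      μ * ‖x‖ ^ (-2 : ℝ) + ‖x‖ ^ (-s) * pot p (c + c') (f x) (g x) < h ^ 2 * ‖x‖ ^ (-2 : ℝ) := by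
  have P := H.params
  obtain ⟨R, hR, hpot⟩ := H.pot_decay hd (c + c') (add_pos P.c_pos P.c'_pos)
    (ε := (h ^ 2 - μ) / 2) (by linarith [P.μ_lt])
  refine ⟨R, hR, fun x hx => ?_⟩
  have h1 := hpot x hx
  have h2 : 0 < ‖x‖ ^ (-2 : ℝ) := by
    have := hR.trans_le hx
    positivity
  have h3 := mul_pos (sub_pos.2 P.μ_lt) h2
  linarith

/-- The moving plane procedure can be started. -/
lemma System.exists_moved (H : System h μ s p c c' α β f g) (hd : Decays h f g) (he : ‖e‖ = 1) :
    ∃ l < 0, Moved e f g l := by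
  have P := H.params
  have hh := P.h_pos
  obtain ⟨R, hR, hpot⟩ := H.potential_lt hd
  obtain ⟨m₁, hm₁, hlo₁⟩ := H.left.exists_lower_near_zero P
  obtain ⟨m₂, hm₂, hlo₂⟩ := H.right.exists_lower_near_zero P.swap
  have hmpos : 0 < min m₁ m₂ := lt_min hm₁ hm₂
  obtain ⟨R₁, hR₁, hdec⟩ := hd _ hmpos
  set L := max (max R R₁) 1 with hL
  have hL1 : 1 ≤ L := le_max_right _ _
  have hLR : R ≤ L := (le_max_left _ _).trans (le_max_left _ _)
  have hLR₁ : R₁ ≤ L := (le_max_right _ _).trans (le_max_left _ _)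
  refine ⟨-L, by linarith, H.moved hd he (by linarith) (N := 0) (l₀ := 0) le_rfl (by norm_num)
    (fun x hx _ => Or.inr ?_) ⟨1, one_pos, fun y hy hy1 => ?_⟩⟩
  · have h1 := (abs_le.1 (abs_inner_le_norm_of_unit he x)).1
    have h2 := hpot x (by linarith)
    simpa using h2
  · have h1 := (abs_le.1 (abs_inner_le_norm_of_unit he (refl e (-L) y))).1
    have h2 := (abs_le.1 (abs_inner_le_norm_of_unit he y)).1
    rw [inner_refl he] at h1
    have h3 : L ≤ ‖refl e (-L) y‖ := by linarith
    have h4 := hdec _ (hLR₁.trans h3)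
    have h5 : ‖refl e (-L) y‖ ^ (-h) ≤ 1 :=
      Real.rpow_le_one_of_one_le_of_nonpos (hL1.trans h3) (by linarith)
    have h6 : f (refl e (-L) y) + g (refl e (-L) y) ≤ min m₁ m₂ :=
      h4.trans (mul_le_of_le_one_right hmpos.le h5)
    have hne : refl e (-L) y ≠ 0 := norm_pos_iff.1 (by linarith)
    have h7 := H.left.pos _ hne
    have h8 := H.right.pos _ hne
    have h9 := hlo₁ y hy hy1
    have h10 := hlo₂ y hy hy1
    have h11 := min_le_left m₁ m₂
    have h12 := min_le_right m₁ m₂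
    constructor <;> linarith

lemma System.lapl_refl_lt (H : System h μ s p c c' α β f g) (he : ‖e‖ = 1) (hl : l < 0)
    (hm : Moved e f g l) {x : 𝔼} (hx : ⟪x, e⟫ < l) (hr : refl e l x ≠ 0) :
    lapl f (refl e l x) < lapl f x := by
  have P := H.params
  have hx0 : x ≠ 0 := ne_zero_of_inner_lt hl.le hx
  obtain ⟨h1, h2⟩ := hm x hx hr
  have := rhs_mono P.μ_nonneg P.s_nonneg P.c_pos P.one_lt_α P.one_lt_β P.μ_add_s
    (p := p) (by linarith [P.two_lt_p]) (norm_pos_iff.2 hr) (norm_refl_lt he hl hx)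
    (H.left.pos x hx0) h1 (H.right.pos x hx0) h2
  rw [← H.left.eq x hx0, ← H.left.eq _ hr] at this
  linarith

lemma contDiffAt_comp_refl {w : 𝔼 → ℝ} {x : 𝔼} (hw : ContDiffAt ℝ 2 w (refl e l x)) :
    ContDiffAt ℝ 2 (fun y => w (refl e l y)) x :=
  hw.comp x (contDiff_refl e l).contDiffAt

lemma System.strict (H : System h μ s p c c' α β f g) (he : ‖e‖ = 1) (hl : l < 0)
    (hm : Moved e f g l) {x : 𝔼} (hx : ⟪x, e⟫ < l) (hr : refl e l x ≠ 0) :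
    f x < f (refl e l x) := by
  refine lt_of_le_of_ne (hm x hx hr).1 fun heq => ?_
  have hfx := H.left.contDiffAt x (ne_zero_of_inner_lt hl.le hx)
  have hfr := H.left.contDiffAt _ hr
  have hmin : IsLocalMin (fun y => f (refl e l y) - f y) x := by
    have o1 : IsOpen {y : 𝔼 | ⟪y, e⟫ < l} := isOpen_lt (by fun_prop) continuous_const
    have o2 : IsOpen {y : 𝔼 | refl e l y ≠ 0} :=
      isOpen_ne_fun (contDiff_refl e l).continuous continuous_const
    filter_upwards [o1.mem_nhds hx, o2.mem_nhds hr] with y h1 h2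
    have := (hm y h1 h2).1
    linarith
  have hlap := lapl_nonneg_of_isLocalMin ((contDiffAt_comp_refl hfr).sub hfx) hmin
  rw [lapl_sub (contDiffAt_comp_refl hfr) hfx, lapl_comp_refl he l hfr] at hlap
  linarith [H.lapl_refl_lt he hl hm hx hr]

lemma System.near_zero (H : System h μ s p c c' α β f g) (he : ‖e‖ = 1) (hl : l < 0)
    (hm : Moved e f g l) :
    ∃ m > 0, ∀ y : 𝔼, y ≠ 0 → ‖y‖ ≤ -l / 2 → f (refl e l y) + m ≤ f y := by
  have hin : ∀ y : 𝔼, ‖y‖ ≤ -l / 2 → l < ⟪y, e⟫ := fun y hy => by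
    have := (abs_le.1 (abs_inner_le_norm_of_unit he y)).1
    linarith
  have hne : ∀ y : 𝔼, ‖y‖ ≤ -l / 2 → refl e l y ≠ 0 := fun y hy =>
    refl_ne_zero he (by linarith [hin y hy])
  have hlt : ∀ y : 𝔼, ‖y‖ ≤ -l / 2 → ⟪refl e l y, e⟫ < l := fun y hy => by
    rw [inner_refl he]
    linarith [hin y hy]
  have hpos : ∀ y : 𝔼, y ≠ 0 → ‖y‖ ≤ -l / 2 → 0 < f y - f (refl e l y) := fun y hy0 hy => by
    have := H.strict he hl hm (hlt y hy) (by rwa [refl_refl he])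
    rw [refl_refl he] at this
    linarith
  have hcd : ∀ y : 𝔼, y ≠ 0 → ‖y‖ ≤ -l / 2 →
      ContDiffAt ℝ 2 (fun y => f y - f (refl e l y)) y := fun y hy0 hy =>
    (H.left.contDiffAt y hy0).sub (contDiffAt_comp_refl (H.left.contDiffAt _ (hne y hy)))
  have ne0 : ∀ y ∈ Metric.sphere (0 : 𝔼) (-l / 2), y ≠ 0 := fun y hy =>
    norm_pos_iff.1 (by rw [mem_sphere_zero_iff_norm.1 hy]; linarith)
  obtain ⟨m, hmpos, hle⟩ := exists_pos_le_of_compact (isCompact_sphere (0 : 𝔼) (-l / 2))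
    (w := fun y => f y - f (refl e l y))
    (fun x hx => (hcd x (ne0 x hx) (mem_sphere_zero_iff_norm.1 hx).le
      ).continuousAt.continuousWithinAt)
    (fun x hx => hpos x (ne0 x hx) (mem_sphere_zero_iff_norm.1 hx).le)
  refine ⟨m, hmpos, fun y hy0 hy => ?_⟩
  have := superharmonic_ge H.params.three_le hmpos hcd hpos (fun x hx0 hx => ?_)
    (fun x hx => hle x (mem_sphere_zero_iff_norm.2 hx)) hy0 hy
  · linarith
  · have h1 := H.left.contDiffAt _ (hne x hx)
    rw [lapl_sub (H.left.contDiffAt x hx0) (contDiffAt_comp_refl h1), lapl_comp_refl he l h1]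
    have h2 := H.lapl_refl_lt he hl hm (hlt x hx) (by rwa [refl_refl he])
    rw [refl_refl he] at h2
    linarith

lemma continuousAt_refl_prod {w : 𝔼 → ℝ} {x : 𝔼} (hw : ContinuousAt w (refl e l x)) :
    ContinuousAt (fun q : ℝ × 𝔼 => w (refl e q.1 q.2)) (l, x) :=
  ContinuousAt.comp (f := fun q : ℝ × 𝔼 => refl e q.1 q.2) (g := w) hw
    (continuous_refl_prod e).continuousAt

lemma System.eventually_near_zero (H : System h μ s p c c' α β f g) (he : ‖e‖ = 1) (hl : l < 0)
    (hm : Moved e f g l) :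
    ∀ᶠ l' in 𝓝 l, ∀ y : 𝔼, y ≠ 0 → ‖y‖ ≤ -l / 2 → f (refl e l' y) ≤ f y := by
  obtain ⟨m, hmpos, hle⟩ := H.near_zero he hl hm
  have key : ∀ᶠ l' in 𝓝 l, ∀ y ∈ Metric.closedBall (0 : 𝔼) (-l / 2),
      f (refl e l' y) < f (refl e l y) + m := by
    refine (isCompact_closedBall (0 : 𝔼) (-l / 2)).eventually_forall_of_forall_eventually
      fun y hy => ?_
    have hy' : ‖y‖ ≤ -l / 2 := by simpa using hy
    have h0 : refl e l y ≠ 0 := refl_ne_zero he (by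
      have := (abs_le.1 (abs_inner_le_norm_of_unit he y)).1
      linarith)
    have hc := (H.left.contDiffAt _ h0).continuousAt
    have c1 := continuousAt_refl_prod hc
    have c2 : ContinuousAt (fun q : ℝ × 𝔼 => f (refl e l q.2)) (l, y) :=
      ContinuousAt.comp (f := fun q : ℝ × 𝔼 => refl e l q.2) (g := f) hc
        ((contDiff_refl e l).continuous.comp continuous_snd).continuousAt
    have := (c1.sub c2).eventually_lt (g := fun _ => m) continuousAt_const (by simpa using hmpos)
    filter_upwards [this] with q hq
    simp only [Pi.sub_apply] at hq
    linarith
  filter_upwards [key] with l' hl' y hy0 hy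
  exact (hl' y (by simpa using hy)).le.trans (hle y hy0 hy)

lemma exists_sq_mul_exp_gt (M : ℝ) : ∃ N ≥ 1, M < 1 / 2 * N ^ 2 * Real.exp (-2) := by
  have he := Real.exp_pos (-2)
  refine ⟨max 1 (2 * M / Real.exp (-2) + 1), le_max_left _ _, ?_⟩
  set N := max 1 (2 * M / Real.exp (-2) + 1) with hN
  have h1 : 1 ≤ N := le_max_left _ _
  have h2 : 2 * M / Real.exp (-2) < N := by
    have : 2 * M / Real.exp (-2) + 1 ≤ N := le_max_right _ _
    linarith
  rw [div_lt_iff₀ he] at h2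
  have h3 : N * Real.exp (-2) ≤ N ^ 2 * Real.exp (-2) := by
    gcongr
    nlinarith
  linarith

/-- The set of admissible positions of the plane is open in `l < 0`. -/
lemma System.eventually_moved (H : System h μ s p c c' α β f g) (hd : Decays h f g)
    (he : ‖e‖ = 1) (hl : l < 0) (hm : Moved e f g l) : ∀ᶠ l' in 𝓝 l, Moved e f g l' := by
  have P := H.params
  have hh := P.h_pos
  obtain ⟨R, hR, hpot⟩ := H.potential_lt hd
  set V : 𝔼 → ℝ := fun x =>
    μ * ‖x‖ ^ (-2 : ℝ) + ‖x‖ ^ (-s) * pot p (c + c') (f x) (g x) with hV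
  obtain ⟨M, hM⟩ : ∃ M, ∀ x : 𝔼, -l / 2 ≤ ‖x‖ → ‖x‖ ≤ R → V x ≤ M := by
    set K : Set 𝔼 := {x | -l / 2 ≤ ‖x‖} ∩ {x | ‖x‖ ≤ R} with hK
    have hKc : IsCompact K := by
      refine (isCompact_closedBall (0 : 𝔼) R).of_isClosed_subset
        ((isClosed_le ?_ ?_).inter (isClosed_le ?_ ?_)) fun y hy => ?_
      any_goals fun_prop
      simpa using hy.2
    have hVc : ContinuousOn V K := by
      intro x hx
      have hxp : 0 < ‖x‖ := lt_of_lt_of_le (by linarith) hx.1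
      have hx0 : x ≠ 0 := norm_pos_iff.1 hxp
      have hfp := H.left.pos x hx0
      have hgp := H.right.pos x hx0
      have hfc := (H.left.contDiffAt x hx0).continuousAt
      have hgc := (H.right.contDiffAt x hx0).continuousAt
      have hmin : 0 < min (f x) (g x) := lt_min hfp hgp
      have hpw : ∀ κ : ℝ, ContinuousAt (fun y : 𝔼 => ‖y‖ ^ κ) x := fun κ =>
        (contDiffAt_norm_rpow κ hx0).continuousAt
      have c1 : ContinuousAt (fun y => (f y + g y) ^ p) x :=
        (hfc.add hgc).rpow_const (Or.inl (add_pos hfp hgp).ne')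
      have c2 : ContinuousAt (fun y => (min (f y) (g y)) ^ 2) x :=
        ContinuousAt.pow (Filter.Tendsto.min hfc hgc) 2
      have c3 : ContinuousAt (fun y => pot p (c + c') (f y) (g y)) x :=
        continuousAt_const.mul (c1.div c2 (by positivity))
      exact ((continuousAt_const.mul (hpw _)).add ((hpw _).mul c3)).continuousWithinAt
    obtain ⟨M, hM⟩ := hKc.bddAbove_image hVc
    exact ⟨M, fun x h1 h2 => hM ⟨x, ⟨h1, h2⟩, rfl⟩⟩
  obtain ⟨N, hN1, hNM⟩ := exists_sq_mul_exp_gt M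
  have hNpos : 0 < N := by linarith
  have ev1 : ∀ᶠ l' in 𝓝 l, ∀ x ∈ Metric.closedBall (0 : 𝔼) R ∩ {x | ⟪x, e⟫ ≤ l - 1 / N},
      ‖refl e l' x‖ < -l / 2 ∨ (f x < f (refl e l' x) ∧ g x < g (refl e l' x)) := by
    have hKc : IsCompact (Metric.closedBall (0 : 𝔼) R ∩ {x | ⟪x, e⟫ ≤ l - 1 / N}) :=
      (isCompact_closedBall _ _).inter_right (isClosed_le (by fun_prop) continuous_const)
    refine hKc.eventually_forall_of_forall_eventually fun x hx => ?_
    have hxl : ⟪x, e⟫ < l := lt_of_le_of_lt hx.2 (by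
      have : 0 < 1 / N := by positivity
      linarith)
    have hx0 := ne_zero_of_inner_lt hl.le hxl
    rcases lt_or_ge ‖refl e l x‖ (-l / 2) with hlt | hge
    · have hc : Continuous fun q : ℝ × 𝔼 => ‖refl e q.1 q.2‖ := (continuous_refl_prod e).norm
      filter_upwards [hc.continuousAt.eventually_lt (g := fun _ => -l / 2) (x₀ := (l, x))
        continuousAt_const hlt] with q hq
      exact Or.inl hq
    · have hr : refl e l x ≠ 0 := norm_pos_iff.1 (lt_of_lt_of_le (by linarith) hge)
      have f1 := H.strict he hl hm hxl hr
      have g1 := H.swap.strict he hl hm.swap hxl hr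
      have fc : ContinuousAt (fun q : ℝ × 𝔼 => f q.2) (l, x) :=
        ContinuousAt.comp (f := Prod.snd) (g := f) (H.left.contDiffAt x hx0).continuousAt
          continuousAt_snd
      have gc : ContinuousAt (fun q : ℝ × 𝔼 => g q.2) (l, x) :=
        ContinuousAt.comp (f := Prod.snd) (g := g) (H.right.contDiffAt x hx0).continuousAt
          continuousAt_snd
      filter_upwards [fc.eventually_lt
        (continuousAt_refl_prod (H.left.contDiffAt _ hr).continuousAt) f1, gc.eventually_lt
        (continuousAt_refl_prod (H.right.contDiffAt _ hr).continuousAt) g1] with q h1 h2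
      exact Or.inr ⟨h1, h2⟩
  have ev2 := H.eventually_near_zero he hl hm
  have ev3 := H.swap.eventually_near_zero he hl hm.swap
  have ev4 : ∀ᶠ l' in 𝓝 l, l' < l + 1 / N := Iio_mem_nhds (by
    have : 0 < 1 / N := by positivity
    linarith)
  have ev5 : ∀ᶠ l' in 𝓝 l, l' < l / 2 := Iio_mem_nhds (by linarith)
  filter_upwards [ev1, ev2, ev3, ev4, ev5] with l' k1 k2 k3 k4 k5
  have hl' : l' < 0 := by linarith
  refine H.moved hd he hl' (N := N) (l₀ := l) hNpos.le ?_ (fun x hx hr => ?_)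
    ⟨-l / 2, by linarith, fun y hy0 hy => ⟨k2 y hy0 hy, k3 y hy0 hy⟩⟩
  · have : N * (l' - l) ≤ N * (1 / N) := by
      gcongr
      linarith
    rwa [mul_one_div_cancel hNpos.ne'] at this
  · have hE := Real.exp_pos (N * ⟪x, e⟫ + (-(N * l) - 1))
    have hxa := (abs_le.1 (abs_inner_le_norm_of_unit he x)).1
    have hx0 : x ≠ 0 := ne_zero_of_inner_lt hl'.le hx
    have hxp := norm_pos_iff.2 hx0
    rcases le_total R ‖x‖ with h1 | h1
    · right
      have := hpot x h1
      have : 0 ≤ 1 / 2 * N ^ 2 * Real.exp (N * ⟪x, e⟫ + (-(N * l) - 1)) := by positivity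
      linarith
    rcases le_total (⟪x, e⟫) (l - 1 / N) with h2 | h2
    · left
      rcases k1 x ⟨by simpa using h1, h2⟩ with h3 | h3
      · have a1 := k2 _ hr h3.le
        have a2 := k3 _ hr h3.le
        rw [refl_refl he] at a1 a2
        exact ⟨a1, a2⟩
      · exact ⟨h3.1.le, h3.2.le⟩
    · right
      have a1 : V x ≤ M := hM x (by linarith) h1
      have a2 : Real.exp (-2) ≤ Real.exp (N * ⟪x, e⟫ + (-(N * l) - 1)) := by
        refine Real.exp_le_exp.2 ?_
        have := mul_le_mul_of_nonneg_left h2 hNpos.le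
        rw [mul_sub, mul_one_div_cancel hNpos.ne'] at this
        linarith
      have a3 : 1 / 2 * N ^ 2 * Real.exp (-2) ≤
          1 / 2 * N ^ 2 * Real.exp (N * ⟪x, e⟫ + (-(N * l) - 1)) := by gcongr
      have a4 : 0 ≤ h ^ 2 * ‖x‖ ^ (-2 : ℝ) := by positivity
      have a5 : V x < h ^ 2 * ‖x‖ ^ (-2 : ℝ) +
          1 / 2 * N ^ 2 * Real.exp (N * ⟪x, e⟫ + (-(N * l) - 1)) := by linarith
      exact a5

lemma isClosed_moved (hf : ∀ x : 𝔼, x ≠ 0 → ContinuousAt f x)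
    (hg : ∀ x : 𝔼, x ≠ 0 → ContinuousAt g x) : IsClosed {l | Moved e f g l} := by
  rw [← isOpen_compl_iff, isOpen_iff_mem_nhds]
  intro l hl
  simp only [Set.mem_compl_iff, Set.mem_ofPred_eq, Moved, not_forall] at hl
  obtain ⟨x, hx, hr, hnot⟩ := hl
  have hc : Continuous fun l' : ℝ => refl e l' x :=
    (continuous_refl_prod e).comp (continuous_id.prodMk continuous_const)
  have ev1 : ∀ᶠ l' in 𝓝 l, ⟪x, e⟫ < l' := Ioi_mem_nhds hx
  have ev2 : ∀ᶠ l' in 𝓝 l, refl e l' x ≠ 0 := hc.continuousAt.eventually_ne hr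
  have fc : ContinuousAt (fun l' => f (refl e l' x)) l :=
    ContinuousAt.comp (f := fun l' => refl e l' x) (g := f) (hf _ hr) hc.continuousAt
  have gc : ContinuousAt (fun l' => g (refl e l' x)) l :=
    ContinuousAt.comp (f := fun l' => refl e l' x) (g := g) (hg _ hr) hc.continuousAt
  have ev3 : ∀ᶠ l' in 𝓝 l, ¬(f x ≤ f (refl e l' x) ∧ g x ≤ g (refl e l' x)) := by
    rw [not_and_or, not_le, not_le] at hnot
    rcases hnot with h1 | h1
    · filter_upwards [fc.eventually_lt continuousAt_const h1] with l' h2 h3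
      exact absurd h3.1 (not_le.2 h2)
    · filter_upwards [gc.eventually_lt continuousAt_const h1] with l' h2 h3
      exact absurd h3.2 (not_le.2 h2)
  filter_upwards [ev1, ev2, ev3] with l' h1 h2 h3 hmoved
  exact h3 (hmoved x h1 h2)

lemma System.moved_zero (H : System h μ s p c c' α β f g) (hd : Decays h f g) (he : ‖e‖ = 1) :
    Moved e f g 0 := by
  have hcl : IsClosed {l | Moved e f g l} :=
    isClosed_moved (fun x hx => (H.left.contDiffAt x hx).continuousAt)
      (fun x hx => (H.right.contDiffAt x hx).continuousAt)
  have hsub : Set.Iio (0 : ℝ) ⊆ {l | Moved e f g l} ∩ Set.Iio 0 := by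
    refine isPreconnected_Iio.subset_of_closure_inter_subset ?_ ?_ ?_
    · rw [isOpen_iff_mem_nhds]
      rintro l ⟨hl1, hl2⟩
      exact inter_mem (H.eventually_moved hd he hl2 hl1) (Iio_mem_nhds hl2)
    · obtain ⟨l, hl, hm⟩ := H.exists_moved hd he
      exact ⟨l, hl, hm, hl⟩
    · rintro l ⟨hl1, hl2⟩
      exact ⟨closure_minimal Set.inter_subset_left hcl hl1, hl2⟩
  have h0 : (0 : ℝ) ∈ closure (Set.Iio (0 : ℝ)) := by
    rw [closure_Iio]
    exact Set.mem_Iic.2 le_rfl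
  exact closure_minimal (hsub.trans Set.inter_subset_left) hcl h0

lemma System.le_of_norm_eq (H : System h μ s p c c' α β f g) (hd : Decays h f g) {x y : 𝔼}
    (hy : y ≠ 0) (hxy : ‖x‖ = ‖y‖) : f x ≤ f y ∧ g x ≤ g y := by
  by_cases hne : x = y
  · subst hne
    exact ⟨le_rfl, le_rfl⟩
  have hd0 : 0 < ‖y - x‖ := norm_pos_iff.2 (sub_ne_zero.2 (Ne.symm hne))
  set e : 𝔼 := ‖y - x‖⁻¹ • (y - x) with he'
  have he : ‖e‖ = 1 := by
    rw [he', norm_smul, _root_.norm_inv, norm_norm, inv_mul_cancel₀ hd0.ne']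
  have h1 : ‖y - x‖ ^ 2 = 2 * (‖x‖ ^ 2 - ⟪x, y⟫) := by
    rw [norm_sub_sq_real, ← hxy, real_inner_comm]
    ring
  have h2 : ⟪x, e⟫ = -(‖y - x‖ / 2) := by
    rw [he', real_inner_smul_right, inner_sub_right, real_inner_self_eq_norm_sq,
      show ⟪x, y⟫ - ‖x‖ ^ 2 = -(‖y - x‖ ^ 2 / 2) by linarith]
    field_simp
  have h3 : refl e 0 x = y := by
    rw [refl, h2, he', smul_smul,
      show 2 * (0 - -(‖y - x‖ / 2)) * ‖y - x‖⁻¹ = 1 by field_simp; ring, one_smul]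
    abel
  have := H.moved_zero hd he x (by rw [h2]; linarith) (by rwa [h3])
  rwa [h3] at this

/-- Decaying solutions of the transformed system are radial. -/
theorem System.radial (H : System h μ s p c c' α β f g) (hd : Decays h f g) {x y : 𝔼}
    (hx : x ≠ 0) (hy : y ≠ 0) (hxy : ‖x‖ = ‖y‖) : f x = f y ∧ g x = g y := by
  have h1 := H.le_of_norm_eq hd hy hxy
  have h2 := H.le_of_norm_eq hd hx hxy.symm
  exact ⟨h1.1.antisymm h2.1, h1.2.antisymm h2.2⟩

end Continuation

/-- The kernel `(1 - |y|²)₊`. -/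
def tent (y : EuclideanSpace ℝ (Fin n)) : ℝ := max 0 (1 - ‖y‖ ^ 2)

lemma tent_nonneg (y : 𝔼) : 0 ≤ tent y := le_max_left _ _

lemma tent_le_one (y : 𝔼) : tent y ≤ 1 := max_le zero_le_one (by linarith [sq_nonneg ‖y‖])

lemma tent_eq_zero {y : 𝔼} (hy : 1 ≤ ‖y‖) : tent y = 0 := max_eq_left (by nlinarith)

@[fun_prop]
lemma continuous_tent : Continuous (tent : 𝔼 → ℝ) := by unfold tent; fun_prop

lemma hasCompactSupport_tent : HasCompactSupport (tent : 𝔼 → ℝ) :=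
  HasCompactSupport.intro (isCompact_closedBall 0 1) fun y hy =>
    tent_eq_zero (by simpa using (not_le.1 (fun h => hy (by simpa using h))).le)

lemma integrable_tent_mul {f : 𝔼 → ℝ} (hf : Continuous f) : Integrable fun y => tent y * f y :=
  (continuous_tent.mul hf).integrable_of_hasCompactSupport hasCompactSupport_tent.mul_right

lemma integral_tent_pos : 0 < ∫ y : 𝔼, tent y :=
  continuous_tent.integral_pos_of_hasCompactSupport_nonneg_nonzero hasCompactSupport_tent
    tent_nonneg (x := 0) (by simp [tent])

lemma integral_tent_sq_nonneg : 0 ≤ ∫ y : 𝔼, tent y * tent y :=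
  integral_nonneg fun y => mul_nonneg (tent_nonneg y) (tent_nonneg y)

lemma tent_mul_le_tent_mul {f g : 𝔼 → ℝ} (h : ∀ y, ‖y‖ < 1 → f y ≤ g y) (y : 𝔼) :
    tent y * f y ≤ tent y * g y := by
  rcases lt_or_ge ‖y‖ 1 with hy | hy
  · exact mul_le_mul_of_nonneg_left (h y hy) (tent_nonneg y)
  · simp [tent_eq_zero hy]

lemma integral_tent_mul_mono {f g : 𝔼 → ℝ} (hf : Continuous f) (hg : Continuous g)
    (h : ∀ y, ‖y‖ < 1 → f y ≤ g y) : ∫ y, tent y * f y ≤ ∫ y, tent y * g y :=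
  integral_mono (integrable_tent_mul hf) (integrable_tent_mul hg) (tent_mul_le_tent_mul h)

lemma integral_tent_mul_congr {f g : 𝔼 → ℝ} (h : ∀ y, ‖y‖ < 1 → f y = g y) :
    ∫ y, tent y * f y = ∫ y, tent y * g y := by
  refine integral_congr_ae (.of_forall fun y => le_antisymm ?_ ?_)
  · exact tent_mul_le_tent_mul (fun y hy => (h y hy).le) y
  · exact tent_mul_le_tent_mul (fun y hy => (h y hy).ge) y

lemma hasDerivAt_max_zero_sq (t : ℝ) :
    HasDerivAt (fun t : ℝ => max 0 t * max 0 t) (2 * max 0 t) t := by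
  rcases lt_trichotomy t 0 with ht | rfl | ht
  · rw [max_eq_left ht.le, mul_zero]
    refine (hasDerivAt_const t (0 : ℝ)).congr_of_eventuallyEq ?_
    filter_upwards [Iio_mem_nhds ht] with y hy
    simp [max_eq_left (le_of_lt (Set.mem_Iio.1 hy))]
  · rw [hasDerivAt_iff_tendsto_slope]
    have h1 : Tendsto (fun t : ℝ => max 0 t) (𝓝[≠] 0) (𝓝 (2 * max 0 0)) := by
      have : Continuous fun t : ℝ => max 0 t := by fun_prop
      simpa using (this.tendsto 0).mono_left nhdsWithin_le_nhds
    refine h1.congr' ?_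
    filter_upwards [self_mem_nhdsWithin] with y hy
    have hy' : y ≠ 0 := hy
    rw [slope_def_field]
    rcases le_total y 0 with h | h
    · simp [max_eq_left h]
    · simp [max_eq_right h]
  · rw [max_eq_right ht.le]
    have h1 : HasDerivAt (fun t : ℝ => t * t) (2 * t) t := by
      simpa [two_mul] using (hasDerivAt_id' t).fun_mul (hasDerivAt_id' t)
    refine h1.congr_of_eventuallyEq ?_
    filter_upwards [Ioi_mem_nhds ht] with y hy
    simp [max_eq_right (le_of_lt (Set.mem_Ioi.1 hy))]

lemma hasFDerivAt_tent_sq (y : 𝔼) :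
    HasFDerivAt (fun y : 𝔼 => tent y * tent y) ((-4 * tent y) • innerSL ℝ y) y := by
  have h1 : HasFDerivAt (fun y : 𝔼 => 1 - ‖y‖ ^ 2) (-(2 • innerSL ℝ y)) y :=
    (HasStrictFDerivAt.hasFDerivAt (hasStrictFDerivAt_norm_sq y)).const_sub 1
  refine ((hasDerivAt_max_zero_sq (1 - ‖y‖ ^ 2)).comp_hasFDerivAt y h1).congr_fderiv ?_
  ext v
  simp [tent]
  ring

lemma hasDerivAt_integral_tent {F : 𝔼 → ℝ} (hF : ContDiff ℝ 1 F) {P Q : 𝔼 → 𝔼}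
    (hP : Continuous P) (hQ : Continuous Q) (t : ℝ) :
    HasDerivAt (fun t => ∫ y, tent y * F (P y + t • Q y))
      (∫ y, tent y * fderiv ℝ F (P y + t • Q y) (Q y)) t := by
  have hF' : Continuous (fderiv ℝ F) := hF.continuous_fderiv one_ne_zero
  have hFc : Continuous F := hF.continuous
  have hc : Continuous fun q : ℝ × 𝔼 => fderiv ℝ F (P q.2 + q.1 • Q q.2) (Q q.2) := by fun_prop
  obtain ⟨C, hC⟩ := ((isCompact_Icc (a := t - 1) (b := t + 1)).prod
    (isCompact_closedBall (0 : 𝔼) 1)).exists_bound_of_continuousOn hc.continuousOn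
  refine (hasDerivAt_integral_of_dominated_loc_of_deriv_le (bound := fun y => tent y * C)
    (F := fun t y => tent y * F (P y + t • Q y))
    (F' := fun t y => tent y * fderiv ℝ F (P y + t • Q y) (Q y))
    (Icc_mem_nhds (show t - 1 < t by linarith) (show t < t + 1 by linarith)) ?_ ?_ ?_ ?_ ?_ ?_).2
  · refine .of_forall fun τ => Continuous.aestronglyMeasurable ?_
    fun_prop
  · exact integrable_tent_mul (by fun_prop)
  · refine Continuous.aestronglyMeasurable ?_
    fun_prop
  · refine .of_forall fun y τ hτ => ?_
    rw [norm_mul, Real.norm_of_nonneg (tent_nonneg y)]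
    refine tent_mul_le_tent_mul (f := fun y => ‖fderiv ℝ F (P y + τ • Q y) (Q y)‖)
      (g := fun _ => C) (fun y hy => ?_) y
    exact hC (τ, y) ⟨hτ, by simpa using hy.le⟩
  · exact integrable_tent_mul continuous_const
  · refine .of_forall fun y τ _ => HasDerivAt.const_mul _ ?_
    have h1 : HasDerivAt (fun τ : ℝ => P y + τ • Q y) (Q y) τ := by
      simpa using ((hasDerivAt_id τ).smul_const (Q y)).const_add (P y)
    exact ((hF.differentiable one_ne_zero _).hasFDerivAt).comp_hasDerivAt τ h1

lemma le_of_hasDerivAt_nonneg {φ φ' : ℝ → ℝ} {a b : ℝ} (hab : a ≤ b)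
    (hd : ∀ t ∈ Set.Icc a b, HasDerivAt φ (φ' t) t) (h0 : ∀ t ∈ Set.Icc a b, 0 ≤ φ' t) :
    φ a ≤ φ b := by
  refine monotoneOn_of_deriv_nonneg (convex_Icc a b)
    (fun t ht => (hd t ht).continuousAt.continuousWithinAt)
    (fun t ht => (hd t (interior_subset ht)).differentiableAt.differentiableWithinAt)
    (fun t ht => ?_) (Set.left_mem_Icc.2 hab) (Set.right_mem_Icc.2 hab) hab
  rw [(hd t (interior_subset ht)).deriv]
  exact h0 t (interior_subset ht)

lemma exists_contDiff_eventuallyEq {f : 𝔼 → ℝ} (hf : ∀ x ≠ 0, ContDiffAt ℝ 2 f x) {ρ : ℝ}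
    (hρ : 0 < ρ) : ∃ F : 𝔼 → ℝ, ContDiff ℝ 2 F ∧ ∀ x, ρ < ‖x‖ → F =ᶠ[𝓝 x] f := by
  let χ : ContDiffBump (0 : 𝔼) := ⟨ρ / 2, ρ, by positivity, by linarith⟩
  refine ⟨fun x => (1 - χ x) * f x, contDiff_iff_contDiffAt.2 fun x => ?_, fun x hx => ?_⟩
  · rcases eq_or_ne x 0 with rfl | hx
    · refine (contDiffAt_const (c := (0 : ℝ))).congr_of_eventuallyEq ?_
      filter_upwards [χ.eventuallyEq_one] with y hy
      rw [hy]
      simp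
    · exact (contDiffAt_const.sub χ.contDiffAt).mul (hf x hx)
  · filter_upwards [(isOpen_lt continuous_const continuous_norm).mem_nhds hx] with y hy
    rw [χ.zero_of_le_dist (by simpa using le_of_lt (show ρ < ‖y‖ from hy))]
    ring

/-- Integration by parts against the kernel: `∫ k ∂_y F(z + ρ y) = (ρ / 4) ∫ k² ΔF(z + ρ y)`. -/
lemma integral_tent_mul_fderiv_self {F : 𝔼 → ℝ} (hF : ContDiff ℝ 2 F) (z : 𝔼) (ρ : ℝ) :
    ∫ y, tent y * fderiv ℝ F (z + ρ • y) y =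
      ρ / 4 * ∫ y, tent y * (tent y * lapl F (z + ρ • y)) := by
  have hF1 : ContDiff ℝ 1 (fderiv ℝ F) := hF.fderiv_right (by norm_num)
  have hF1c : Continuous (fderiv ℝ F) := hF1.continuous
  have hF2c : Continuous (fderiv ℝ (fderiv ℝ F)) := hF1.continuous_fderiv one_ne_zero
  have hd (x : 𝔼) (i : Fin n) : HasFDerivAt (fun y => fderiv ℝ F y (bv i))
      ((ContinuousLinearMap.apply ℝ ℝ (bv i)).comp (fderiv ℝ (fderiv ℝ F) x)) x :=
    (ContinuousLinearMap.apply ℝ ℝ (bv i)).hasFDerivAt.comp x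
      (hF1.differentiable one_ne_zero x).hasFDerivAt
  have hlap (x : 𝔼) : lapl F x = ∑ i, fderiv ℝ (fderiv ℝ F) x (bv i) (bv i) :=
    lapl_eq_sum hF.contDiffAt
  have hd' (y : 𝔼) (i : Fin n) : fderiv ℝ (fun y => fderiv ℝ F (z + ρ • y) (bv i)) y (bv i) =
      ρ * fderiv ℝ (fderiv ℝ F) (z + ρ • y) (bv i) (bv i) := by
    have h1 : HasFDerivAt (fun y : 𝔼 => z + ρ • y) (ρ • ContinuousLinearMap.id ℝ 𝔼) y :=
      ((hasFDerivAt_id y).const_smul ρ).const_add z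
    have h2 := (hd (z + ρ • y) i).comp y h1
    rw [Function.comp_def] at h2
    rw [h2.fderiv]
    simp
  have hdiff (i : Fin n) : Differentiable ℝ fun y => fderiv ℝ F (z + ρ • y) (bv i) := by
    have := hF1.differentiable one_ne_zero
    fun_prop
  have key (i : Fin n) : ∫ y, tent y * (tent y * (ρ * fderiv ℝ (fderiv ℝ F) (z + ρ • y) (bv i)
      (bv i))) = 4 * ∫ y, tent y * (fderiv ℝ F (z + ρ • y) (bv i) * y i) := by
    have e1 : ∀ y : 𝔼, fderiv ℝ (fun y : 𝔼 => tent y * tent y) y (bv i) = -4 * (tent y * y i) := by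
      intro y
      rw [(hasFDerivAt_tent_sq y).fderiv]
      simp [inner_bv]
      ring
    have h := integral_mul_fderiv_eq_neg_fderiv_mul_of_integrable (μ := (volume : Measure 𝔼))
      (f := fun y : 𝔼 => tent y * tent y) (g := fun y => fderiv ℝ F (z + ρ • y) (bv i))
      (v := bv i) ?_ ?_ ?_ (fun y _ => (hasFDerivAt_tent_sq y).differentiableAt)
      (fun y _ => hdiff i y)
    · simp only [hd', e1] at h
      calc _ = ∫ y, tent y * tent y * (ρ * fderiv ℝ (fderiv ℝ F) (z + ρ • y) (bv i) (bv i)) := by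
            simp only [mul_assoc]
        _ = _ := h
        _ = _ := by
          rw [← integral_neg, ← integral_const_mul]
          congr 1 with y
          ring
    · simp only [e1]
      refine (integrable_tent_mul (f := fun y : 𝔼 => -4 * y i * fderiv ℝ F (z + ρ • y) (bv i))
        (by fun_prop)).congr (.of_forall fun y => ?_)
      dsimp only
      ring
    · simp only [hd', mul_assoc]
      exact integrable_tent_mul (by fun_prop)
    · simp only [mul_assoc]
      exact integrable_tent_mul (by fun_prop)
  have e2 : ∀ y : 𝔼, fderiv ℝ F (z + ρ • y) y = ∑ i, fderiv ℝ F (z + ρ • y) (bv i) * y i :=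
    fun y => (sum_clm_mul_coord _ _).symm.trans (Finset.sum_congr rfl fun i _ => mul_comm _ _)
  calc ∫ y, tent y * fderiv ℝ F (z + ρ • y) y
      = ∫ y, ∑ i, tent y * (fderiv ℝ F (z + ρ • y) (bv i) * y i) := by
        simp only [e2, Finset.mul_sum]
    _ = ∑ i, ∫ y, tent y * (fderiv ℝ F (z + ρ • y) (bv i) * y i) :=
        integral_finsetSum _ fun i _ => integrable_tent_mul (by fun_prop)
    _ = ∑ i, 1 / 4 * ∫ y, tent y * (tent y * (ρ * fderiv ℝ (fderiv ℝ F) (z + ρ • y) (bv i)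
          (bv i))) := Finset.sum_congr rfl fun i _ => by rw [key i]; ring
    _ = 1 / 4 * ∫ y, ∑ i, tent y * (tent y * (ρ * fderiv ℝ (fderiv ℝ F) (z + ρ • y) (bv i)
          (bv i))) := by
        rw [integral_finsetSum _ fun i _ => integrable_tent_mul (by fun_prop), Finset.mul_sum]
    _ = _ := by
        rw [← integral_const_mul, ← integral_const_mul]
        congr 1 with y
        rw [hlap, Finset.mul_sum, Finset.mul_sum, Finset.mul_sum, Finset.mul_sum]
        refine Finset.sum_congr rfl fun i _ => by ring

lemma continuous_lapl {F : 𝔼 → ℝ} (hF : ContDiff ℝ 2 F) : Continuous (lapl F) := by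
  have hF1 : ContDiff ℝ 1 (fderiv ℝ F) := hF.fderiv_right (by norm_num)
  have hF2c : Continuous (fderiv ℝ (fderiv ℝ F)) := hF1.continuous_fderiv one_ne_zero
  have : lapl F = fun x => ∑ i, fderiv ℝ (fderiv ℝ F) x (bv i) (bv i) :=
    funext fun x => lapl_eq_sum hF.contDiffAt
  rw [this]
  fun_prop

lemma half_norm_le {z y : 𝔼} {r : ℝ} (hr : 0 ≤ r) (hr2 : r ≤ ‖z‖ / 2) (hy : ‖y‖ ≤ 1) :
    ‖z‖ / 2 ≤ ‖z + r • y‖ ∧ ‖z + r • y‖ ≤ 2 * ‖z‖ := by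
  have h1 : ‖r • y‖ ≤ ‖z‖ / 2 := by
    rw [norm_smul, Real.norm_of_nonneg hr]
    exact (mul_le_of_le_one_right hr hy).trans hr2
  have h2 := norm_add_le z (r • y)
  have h3 := norm_sub_norm_le z (-(r • y))
  rw [sub_neg_eq_add, norm_neg] at h3
  constructor <;> linarith [norm_nonneg z]

/-- One-sided mean value inequality with the kernel `tent`. -/
lemma integral_tent_mul_self_le {S : 𝔼 → ℝ} (hS : ∀ x ≠ 0, ContDiffAt ℝ 2 S x) {z : 𝔼}
    (hz : z ≠ 0) {r D : ℝ} (hr : 0 < r) (hr2 : r ≤ ‖z‖ / 2)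
    (hD : ∀ x, ‖x - z‖ ≤ r → -lapl S x ≤ D) :
    (∫ y : 𝔼, tent y) * S z ≤ (∫ y, tent y * S (z + r • y)) +
      r ^ 2 / 8 * (∫ y : 𝔼, tent y * tent y) * D := by
  have hz0 : 0 < ‖z‖ := norm_pos_iff.2 hz
  obtain ⟨F, hF, hFS⟩ := exists_contDiff_eventuallyEq hS (ρ := ‖z‖ / 4) (by positivity)
  have hF1 : ContDiff ℝ 1 F := hF.of_le (by norm_num)
  have hLc := continuous_lapl hF
  have hnear {ρ : ℝ} (h0 : 0 ≤ ρ) (h1 : ρ ≤ r) {y : 𝔼} (hy : ‖y‖ < 1) :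
      F =ᶠ[𝓝 (z + ρ • y)] S :=
    hFS _ (by linarith [(half_norm_le h0 (h1.trans hr2) hy.le).1])
  have h := le_of_hasDerivAt_nonneg
    (φ := fun ρ => (∫ y, tent y * F (z + ρ • y)) + ρ ^ 2 / 8 * (∫ y : 𝔼, tent y * tent y) * D)
    (φ' := fun ρ => (∫ y, tent y * fderiv ℝ F (z + ρ • y) y) +
      ρ / 4 * (∫ y : 𝔼, tent y * tent y) * D) hr.le ?_ ?_
  · simp only [zero_smul, add_zero, (hFS z (by linarith)).eq_of_nhds, integral_mul_const] at h
    rw [integral_tent_mul_congr fun y hy => (hnear hr.le le_rfl hy).eq_of_nhds] at h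
    linarith
  · intro ρ _
    refine (hasDerivAt_integral_tent hF1 continuous_const continuous_id ρ).add ?_
    refine ((((hasDerivAt_pow 2 ρ).div_const 8).mul_const _).mul_const D).congr_deriv ?_
    simp only [Nat.add_one_sub_one, pow_one, Nat.cast_ofNat]
    ring
  · intro ρ hρ
    rw [integral_tent_mul_fderiv_self hF]
    have h1 : ∫ y : 𝔼, tent y * (tent y * -D) ≤ ∫ y, tent y * (tent y * lapl F (z + ρ • y)) := by
      refine integral_tent_mul_mono (by fun_prop) (by fun_prop) fun y hy => ?_
      refine mul_le_mul_of_nonneg_left ?_ (tent_nonneg y)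
      rw [lapl_congr (hnear hρ.1 hρ.2 hy)]
      refine neg_le.1 (hD _ ?_)
      rw [add_sub_cancel_left, norm_smul, Real.norm_of_nonneg hρ.1]
      exact (mul_le_of_le_one_right hρ.1 hy.le).trans hρ.2
    simp only [← mul_assoc, integral_mul_const] at h1
    simp only [← mul_assoc] at h1 ⊢
    have h2 := mul_le_mul_of_nonneg_left h1 (show 0 ≤ ρ / 4 by linarith [hρ.1])
    linarith

/-- Scale-invariant bound of the gradient average by the local energy. -/
lemma integral_tent_mul_norm_fderiv_le {a : ℝ} (ha : 0 ≤ a) {U F : 𝔼 → ℝ} (hF : ContDiff ℝ 1 F)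
    {z : 𝔼} (hz : z ≠ 0) (hFU : ∀ x, ‖z‖ / 4 < ‖x‖ → F =ᶠ[𝓝 x] U)
    (hψ : Integrable fun x => ‖x‖ ^ (-(2 * a)) * ‖fderiv ℝ U x‖ ^ 2) {ρ η : ℝ} (hρ : 0 < ρ)
    (hρ2 : ρ ≤ ‖z‖ / 2) (hη : 0 < η)
    (he : ∫ x in Metric.closedBall 0 (2 * ‖z‖), ‖x‖ ^ (-(2 * a)) * ‖fderiv ℝ U x‖ ^ 2 ≤ η ^ 2) :
    ∫ y, tent y * ‖fderiv ℝ F (z + ρ • y)‖ ≤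
      ((∫ y : 𝔼, tent y) + 4 ^ a) / 2 * (ρ ^ (-(n / 2 : ℝ)) * ‖z‖ ^ a * η) := by
  have hz0 : 0 < ‖z‖ := norm_pos_iff.2 hz
  have hF' : Continuous (fderiv ℝ F) := hF.continuous_fderiv one_ne_zero
  set ψ : 𝔼 → ℝ := fun x => ‖x‖ ^ (-(2 * a)) * ‖fderiv ℝ U x‖ ^ 2 with hψdef
  have hψ0 : ∀ x, 0 ≤ ψ x := fun x => by positivity
  set G : 𝔼 → ℝ := (Metric.closedBall 0 (2 * ‖z‖)).indicator ψ with hG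
  have hGi : Integrable G := hψ.indicator Metric.isClosed_closedBall.measurableSet
  set l : ℝ := ρ ^ (-(n / 2 : ℝ)) * ‖z‖ ^ a * η with hl
  have hl0 : 0 < l := by positivity
  have hsq : ∫ y, tent y * ‖fderiv ℝ F (z + ρ • y)‖ ^ 2 ≤ 4 ^ a * l ^ 2 := by
    have hi : Integrable fun y : 𝔼 => G (z + ρ • y) := by
      have := (hGi.comp_add_left z).comp_smul hρ.ne'
      exact this
    calc ∫ y, tent y * ‖fderiv ℝ F (z + ρ • y)‖ ^ 2
        ≤ ∫ y, (2 * ‖z‖) ^ (2 * a) * G (z + ρ • y) := by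
          refine integral_mono (integrable_tent_mul (by fun_prop)) (hi.const_mul _) fun y => ?_
          dsimp only
          rcases lt_or_ge ‖y‖ 1 with hy | hy
          · obtain ⟨h1, h2⟩ := half_norm_le hρ.le hρ2 hy.le
            have h3 : 0 < ‖z + ρ • y‖ := by linarith
            have h4 : G (z + ρ • y) = ψ (z + ρ • y) :=
              Set.indicator_of_mem (by simpa using h2) _
            rw [h4, (hFU _ (by linarith)).fderiv_eq, hψdef]
            dsimp only
            calc tent y * ‖fderiv ℝ U (z + ρ • y)‖ ^ 2
                ≤ 1 * ‖fderiv ℝ U (z + ρ • y)‖ ^ 2 := by gcongr; exact tent_le_one y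
              _ = ‖z + ρ • y‖ ^ (2 * a) * ‖z + ρ • y‖ ^ (-(2 * a)) *
                    ‖fderiv ℝ U (z + ρ • y)‖ ^ 2 := by
                  rw [← rpow_add h3]; simp
              _ ≤ _ := by
                  rw [mul_assoc]
                  gcongr
          · rw [tent_eq_zero hy, zero_mul]
            exact mul_nonneg (by positivity) (Set.indicator_nonneg (fun x _ => hψ0 x) _)
      _ = (2 * ‖z‖) ^ (2 * a) * (ρ ^ (-(n : ℝ)) * ∫ x in Metric.closedBall 0 (2 * ‖z‖), ψ x) := by
          rw [integral_const_mul, Measure.integral_comp_smul volume (fun w => G (z + w)) ρ,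
            integral_add_left_eq_self, hG,
            integral_indicator Metric.isClosed_closedBall.measurableSet, finrank_euclideanSpace,
            Fintype.card_fin, abs_of_pos (by positivity), rpow_neg hρ.le, rpow_natCast, smul_eq_mul]
      _ ≤ (2 * ‖z‖) ^ (2 * a) * (ρ ^ (-(n : ℝ)) * η ^ 2) := by gcongr
      _ = 4 ^ a * l ^ 2 := by
          rw [hl, mul_pow, mul_pow, ← rpow_natCast (ρ ^ _), ← rpow_mul hρ.le,
            ← rpow_natCast (‖z‖ ^ a), ← rpow_mul hz0.le, mul_rpow zero_le_two hz0.le,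
            rpow_mul zero_le_two, mul_comm a]
          norm_num
          ring
  calc ∫ y, tent y * ‖fderiv ℝ F (z + ρ • y)‖
      ≤ ∫ y, tent y * (l / 2 + 1 / (2 * l) * ‖fderiv ℝ F (z + ρ • y)‖ ^ 2) := by
        refine integral_tent_mul_mono (by fun_prop) (by fun_prop) fun y _ => ?_
        rw [← sub_nonneg]
        have : l / 2 + 1 / (2 * l) * ‖fderiv ℝ F (z + ρ • y)‖ ^ 2 - ‖fderiv ℝ F (z + ρ • y)‖ =
          (l - ‖fderiv ℝ F (z + ρ • y)‖) ^ 2 / (2 * l) := by field_simp; ring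
        rw [this]
        positivity
    _ = l / 2 * (∫ y : 𝔼, tent y) +
          1 / (2 * l) * ∫ y, tent y * ‖fderiv ℝ F (z + ρ • y)‖ ^ 2 := by
        rw [← integral_const_mul, ← integral_const_mul, ← integral_add]
        · congr 1 with y
          ring
        · simpa only [mul_comm] using integrable_tent_mul (f := fun _ : 𝔼 => l / 2) (by fun_prop)
        · exact (integrable_tent_mul (by fun_prop)).const_mul _
    _ ≤ l / 2 * (∫ y : 𝔼, tent y) + 1 / (2 * l) * (4 ^ a * l ^ 2) := by gcongr
    _ = _ := by field_simp

lemma neg_mul_le_integral_tent_fderiv {F : 𝔼 → ℝ} (hF : ContDiff ℝ 1 F) {P Q : 𝔼 → 𝔼}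
    (hP : Continuous P) (hQ : Continuous Q) {C B : ℝ} (hQC : ∀ y, ‖y‖ < 1 → ‖Q y‖ ≤ C)
    (hC : 0 ≤ C) (hB : ∫ y, tent y * ‖fderiv ℝ F (P y)‖ ≤ B) :
    -(C * B) ≤ ∫ y, tent y * fderiv ℝ F (P y) (Q y) := by
  have hF' : Continuous (fderiv ℝ F) := hF.continuous_fderiv one_ne_zero
  have h1 : ∫ y, tent y * (-C * ‖fderiv ℝ F (P y)‖) ≤ ∫ y, tent y * fderiv ℝ F (P y) (Q y) := by
    refine integral_tent_mul_mono (by fun_prop) (by fun_prop) fun y hy => ?_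
    have h2 := ((fderiv ℝ F (P y)).le_opNorm (Q y)).trans
      (mul_le_mul_of_nonneg_left (hQC y hy) (norm_nonneg _))
    rw [Real.norm_eq_abs] at h2
    linarith [neg_abs_le (fderiv ℝ F (P y) (Q y))]
  have h2 : ∫ y, tent y * (-C * ‖fderiv ℝ F (P y)‖) =
      -C * ∫ y, tent y * ‖fderiv ℝ F (P y)‖ := by
    rw [← integral_const_mul]
    congr 1 with y
    ring
  rw [h2] at h1
  linarith [mul_le_mul_of_nonneg_left hB hC]

section Average

variable {a h η : ℝ} {U : EuclideanSpace ℝ (Fin n) → ℝ}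

/-- Shrinking the averaging radius about a fixed centre. -/
lemma integral_tent_le_of_energy (ha : 0 ≤ a) (hh : 0 < h) (hn : 2 * h = n - 2)
    (hU : ∀ x ≠ 0, ContDiffAt ℝ 2 U x)
    (hψ : Integrable fun x => ‖x‖ ^ (-(2 * a)) * ‖fderiv ℝ U x‖ ^ 2) (hη : 0 < η)
    {z : 𝔼} (hz : z ≠ 0)
    (he : ∫ x in Metric.closedBall 0 (2 * ‖z‖), ‖x‖ ^ (-(2 * a)) * ‖fderiv ℝ U x‖ ^ 2 ≤ η ^ 2)
    {r : ℝ} (hr : 0 < r) (hr2 : r ≤ ‖z‖ / 2) :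
    ∫ y, tent y * U (z + r • y) ≤ (∫ y, tent y * U (z + (‖z‖ / 2) • y)) +
      ((∫ y : 𝔼, tent y) + 4 ^ a) / 2 / h * (η * ‖z‖ ^ a * r ^ (-h)) := by
  have hz0 : 0 < ‖z‖ := norm_pos_iff.2 hz
  obtain ⟨F, hF, hFU⟩ := exists_contDiff_eventuallyEq hU (ρ := ‖z‖ / 4) (by positivity)
  have hF1 : ContDiff ℝ 1 F := hF.of_le (by norm_num)
  have hcongr {ρ : ℝ} (h0 : 0 ≤ ρ) (h1 : ρ ≤ ‖z‖ / 2) :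
      ∫ y, tent y * U (z + ρ • y) = ∫ y, tent y * F (z + ρ • y) :=
    integral_tent_mul_congr fun y hy =>
      ((hFU _ (by linarith [(half_norm_le h0 h1 hy.le).1])).eq_of_nhds).symm
  rw [hcongr hr.le hr2, hcongr (by positivity) le_rfl]
  set C₀ : ℝ := ((∫ y : 𝔼, tent y) + 4 ^ a) / 2 with hC₀
  have hC₀0 : 0 < C₀ := by have := integral_tent_pos (n := n); positivity
  set D : ℝ := C₀ / h * (η * ‖z‖ ^ a) with hD
  have key := le_of_hasDerivAt_nonneg
    (φ := fun ρ => (∫ y, tent y * F (z + ρ • y)) - D * ρ ^ (-h))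
    (φ' := fun ρ => (∫ y, tent y * fderiv ℝ F (z + ρ • y) y) - D * (-h * ρ ^ (-h - 1)))
    hr2 (fun ρ hρ => ?_) (fun ρ hρ => ?_)
  · have h0 : 0 ≤ D * (‖z‖ / 2) ^ (-h) := by positivity
    have e : C₀ / h * (η * ‖z‖ ^ a * r ^ (-h)) = D * r ^ (-h) := by rw [hD]; ring
    rw [e]
    linarith
  · have hρ0 : 0 < ρ := hr.trans_le hρ.1
    exact (hasDerivAt_integral_tent hF1 continuous_const continuous_id ρ).sub
      ((hasDerivAt_rpow_const (Or.inl hρ0.ne')).const_mul D)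
  · have hρ0 : 0 < ρ := hr.trans_le hρ.1
    have h1 := neg_mul_le_integral_tent_fderiv hF1 (P := fun y => z + ρ • y) (Q := fun y => y)
      (by fun_prop) continuous_id (C := 1) (fun y hy => hy.le) zero_le_one
      (integral_tent_mul_norm_fderiv_le ha hF1 hz hFU hψ hρ0 hρ.2 hη he)
    have e : C₀ * (ρ ^ (-(n / 2 : ℝ)) * ‖z‖ ^ a * η) = D * h * ρ ^ (-h - 1) := by
      rw [show -(n / 2 : ℝ) = -h - 1 by linarith, hD]
      field_simp
    rw [← hC₀, e] at h1
    linarith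

/-- Moving the centre radially, with averaging radius half its distance to the origin. -/
lemma integral_tent_half_le_of_energy (ha : 0 ≤ a) (hah : a < h) (hn : 2 * h = n - 2)
    (hU : ∀ x ≠ 0, ContDiffAt ℝ 2 U x)
    (hψ : Integrable fun x => ‖x‖ ^ (-(2 * a)) * ‖fderiv ℝ U x‖ ^ 2) (hη : 0 < η) {δ M : ℝ}
    (he : ∫ x in Metric.closedBall 0 (2 * δ), ‖x‖ ^ (-(2 * a)) * ‖fderiv ℝ U x‖ ^ 2 ≤ η ^ 2)
    (hM : ∀ x, δ / 2 ≤ ‖x‖ → ‖x‖ ≤ 2 * δ → U x ≤ M) {z : 𝔼} (hz : z ≠ 0) (hzδ : ‖z‖ ≤ δ) :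
    ∫ y, tent y * U (z + (‖z‖ / 2) • y) ≤ M * (∫ y : 𝔼, tent y) +
      3 / 2 * (((∫ y : 𝔼, tent y) + 4 ^ a) / 2) * 2 ^ (n / 2 : ℝ) / (h - a) *
        (η * ‖z‖ ^ (a - h)) := by
  have hz0 : 0 < ‖z‖ := norm_pos_iff.2 hz
  have hah' : 0 < h - a := by linarith
  set e : 𝔼 := ‖z‖⁻¹ • z with he_def
  have hen : ‖e‖ = 1 := by rw [he_def, norm_smul, _root_.norm_inv, norm_norm]; field_simp
  have hze : z = ‖z‖ • e := by rw [he_def, smul_smul, mul_inv_cancel₀ hz0.ne', one_smul]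
  have hte {t : ℝ} (ht : 0 ≤ t) : ‖t • e‖ = t := by
    rw [norm_smul, hen, mul_one, Real.norm_of_nonneg ht]
  obtain ⟨F, hF, hFU⟩ := exists_contDiff_eventuallyEq hU (ρ := ‖z‖ / 4) (by positivity)
  have hF1 : ContDiff ℝ 1 F := hF.of_le (by norm_num)
  have hsplit (t : ℝ) (y : 𝔼) : (0 : 𝔼) + t • (e + (1 / 2 : ℝ) • y) = t • e + (t / 2) • y := by
    rw [zero_add, smul_add, smul_smul t (1 / 2) y, mul_one_div]
  have hball {t : ℝ} (ht : ‖z‖ ≤ t) {y : 𝔼} (hy : ‖y‖ < 1) :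
      t / 2 ≤ ‖t • e + (t / 2) • y‖ ∧ ‖t • e + (t / 2) • y‖ ≤ 2 * t := by
    have ht0 := hz0.le.trans ht
    have := half_norm_le (z := t • e) (r := t / 2) (by linarith) (by rw [hte ht0]) hy.le
    rwa [hte ht0] at this
  set C₀ : ℝ := ((∫ y : 𝔼, tent y) + 4 ^ a) / 2 with hC₀
  have hC₀0 : 0 < C₀ := by have := integral_tent_pos (n := n); positivity
  set D : ℝ := 3 / 2 * C₀ * 2 ^ (n / 2 : ℝ) / (h - a) * η with hD
  have key := le_of_hasDerivAt_nonneg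
    (φ := fun t => (∫ y, tent y * F (0 + t • (e + (1 / 2 : ℝ) • y))) - D * t ^ (a - h))
    (φ' := fun t => (∫ y, tent y * fderiv ℝ F (0 + t • (e + (1 / 2 : ℝ) • y))
      (e + (1 / 2 : ℝ) • y)) - D * ((a - h) * t ^ (a - h - 1)))
    hzδ (fun t ht => ?_) (fun t ht => ?_)
  · simp only [hsplit] at key
    have hδ0 : 0 < δ := hz0.trans_le hzδ
    have e1 : ∫ y, tent y * U (z + (‖z‖ / 2) • y) =
        ∫ y, tent y * F (‖z‖ • e + (‖z‖ / 2) • y) := by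
      refine integral_tent_mul_congr fun y hy => ?_
      rw [(hFU _ (by linarith [(hball le_rfl hy).1])).eq_of_nhds, ← hze]
    have e2 : ∫ y, tent y * F (δ • e + (δ / 2) • y) ≤ ∫ y : 𝔼, tent y * M := by
      refine integral_tent_mul_mono (by have := hF.continuous; fun_prop) continuous_const
        fun y hy => ?_
      obtain ⟨h1, h2⟩ := hball hzδ hy
      rw [(hFU _ (by linarith)).eq_of_nhds]
      exact hM _ h1 h2
    rw [integral_mul_const, mul_comm _ M] at e2
    have h0 : 0 ≤ D * δ ^ (a - h) := by positivity
    rw [e1, ← mul_assoc _ η]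
    linarith
  · have ht0 : 0 < t := hz0.trans_le ht.1
    exact (hasDerivAt_integral_tent hF1 continuous_const (by fun_prop) t).sub
      ((hasDerivAt_rpow_const (Or.inl ht0.ne')).const_mul D)
  · have ht0 : 0 < t := hz0.trans_le ht.1
    have h2 : ∫ x in Metric.closedBall 0 (2 * ‖t • e‖), ‖x‖ ^ (-(2 * a)) * ‖fderiv ℝ U x‖ ^ 2
        ≤ η ^ 2 := by
      refine (setIntegral_mono_set hψ.integrableOn (.of_forall fun x => by positivity)
        (LE.le.eventuallyLE ?_)).trans he
      rw [hte ht0.le]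
      exact Metric.closedBall_subset_closedBall (by linarith [ht.2])
    have h3 := integral_tent_mul_norm_fderiv_le ha hF1 (z := t • e) (ρ := t / 2) (η := η)
      (by rw [← norm_pos_iff, hte ht0.le]; exact ht0)
      (fun x hx => hFU x (by rw [hte ht0.le] at hx; linarith [ht.1])) hψ (by linarith)
      (by rw [hte ht0.le]) hη h2
    have h1 := neg_mul_le_integral_tent_fderiv hF1 (P := fun y => t • e + (t / 2) • y)
      (Q := fun y => e + (1 / 2 : ℝ) • y) (by fun_prop) (by fun_prop) (C := 3 / 2)
      (fun y hy => ?_) (by norm_num) h3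
    · simp only [hsplit]
      have e3 : 3 / 2 * (C₀ * ((t / 2) ^ (-(n / 2 : ℝ)) * ‖t • e‖ ^ a * η)) =
          D * ((h - a) * t ^ (a - h - 1)) := by
        rw [hte ht0.le, div_rpow ht0.le zero_le_two, rpow_neg zero_le_two, div_inv_eq_mul,
          show a - h - 1 = -(n / 2 : ℝ) + a by linarith, rpow_add ht0, hD]
        field_simp
      rw [← hC₀, e3] at h1
      linarith
    · refine (norm_add_le _ _).trans ?_
      rw [hen, norm_smul]
      norm_num
      linarith

lemma exists_energy_le (hn : 3 ≤ n) {ψ : 𝔼 → ℝ} (hψ : Integrable ψ) {ε : ℝ} (hε : 0 < ε) :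
    ∃ δ > 0, ∫ x in Metric.closedBall 0 (2 * δ), ψ x ≤ ε := by
  have : Nonempty (Fin n) := ⟨⟨0, by omega⟩⟩
  have h1 : Tendsto ((volume : Measure 𝔼) ∘ fun δ : ℝ => Metric.closedBall 0 (2 * δ))
      (𝓝[>] 0) (𝓝 0) := by
    have hc : Continuous fun δ : ℝ => volume (Metric.closedBall (0 : 𝔼) (2 * δ)) := by
      simp_rw [EuclideanSpace.volume_closedBall]
      refine (ENNReal.continuous_mul_const ENNReal.ofReal_ne_top).comp ?_
      exact (ENNReal.continuous_pow _).comp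
        (ENNReal.continuous_ofReal.comp (continuous_const_mul 2))
    have := (hc.tendsto 0).mono_left (nhdsWithin_le_nhds (s := Set.Ioi 0))
    simpa [Function.comp_def] using this
  have h2 := (hψ.tendsto_setIntegral_nhds_zero h1).eventually_le_const hε
  obtain ⟨δ, h3, h4⟩ := (h2.and self_mem_nhdsWithin).exists
  exact ⟨δ, h4, h3⟩

/-- Averages of `|x|⁻ᵃ U` at scale `r` near the origin are `o(1) r⁻ʰ`. -/
lemma exists_average_le (hn3 : 3 ≤ n) (ha : 0 ≤ a) (hah : a < h) (hn : 2 * h = n - 2)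
    (hU : ∀ x ≠ 0, ContDiffAt ℝ 2 U x) (hU0 : ∀ x ≠ 0, 0 ≤ U x)
    (hψ : Integrable fun x => ‖x‖ ^ (-(2 * a)) * ‖fderiv ℝ U x‖ ^ 2) {S : 𝔼 → ℝ}
    (hS : ∀ x ≠ 0, ContDiffAt ℝ 2 S x) (hSU : ∀ x ≠ 0, S x = ‖x‖ ^ (-a) * U x)
    {ε : ℝ} (hε : 0 < ε) :
    ∃ δ > 0, ∀ z : 𝔼, z ≠ 0 → ‖z‖ ≤ δ → ∀ r, 0 < r → r ≤ ‖z‖ / 2 →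
      ∫ y, tent y * S (z + r • y) ≤ ε * r ^ (-h) := by
  have hh : 0 < h := by linarith
  have hκ := integral_tent_pos (n := n)
  set C₀ : ℝ := ((∫ y : 𝔼, tent y) + 4 ^ a) / 2 with hC₀
  have hC₀0 : 0 < C₀ := by positivity
  set C₁ : ℝ := 3 / 2 * C₀ * 2 ^ (n / 2 : ℝ) / (h - a) with hC₁
  have hah' : 0 < h - a := by linarith
  have hC₁0 : 0 < C₁ := by positivity
  set η : ℝ := ε / (2 ^ a * (1 + C₁ + C₀ / h)) with hη_def
  have hη : 0 < η := by positivity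
  obtain ⟨δ₁, hδ₁, he⟩ := exists_energy_le hn3 hψ (sq_pos_of_pos hη)
  obtain ⟨M, hM⟩ : ∃ M : ℝ, ∀ x : 𝔼, δ₁ / 2 ≤ ‖x‖ → ‖x‖ ≤ 2 * δ₁ → U x ≤ M := by
    have hK : IsCompact (Metric.closedBall (0 : 𝔼) (2 * δ₁) ∩ {x | δ₁ / 2 ≤ ‖x‖}) :=
      (isCompact_closedBall _ _).inter_right (isClosed_le continuous_const continuous_norm)
    obtain ⟨M, hM⟩ := hK.exists_bound_of_continuousOn (f := U) fun x hx =>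
      (hU x (norm_pos_iff.1 (lt_of_lt_of_le (by positivity)
        (show δ₁ / 2 ≤ ‖x‖ from hx.2)))).continuousAt.continuousWithinAt
    exact ⟨M, fun x h1 h2 => (le_abs_self _).trans (hM x ⟨by simpa using h2, h1⟩)⟩
  obtain ⟨δ₂, hδ₂, hδ₂'⟩ : ∃ δ > 0, ∀ t, 0 < t → t ≤ δ →
      M * (∫ y : 𝔼, tent y) ≤ η * t ^ (-(h - a)) := by
    obtain ⟨δ, h1, -, h3⟩ := exists_rpow_neg_ge (M := M * (∫ y : 𝔼, tent y) / η) hah' one_pos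
    refine ⟨δ, h1, fun t ht htδ => ?_⟩
    rw [div_le_iff₀' hη] at h3
    refine h3.trans ?_
    gcongr ?_ * ?_
    exact rpow_le_rpow_of_nonpos ht htδ (by linarith)
  refine ⟨min δ₁ δ₂, lt_min hδ₁ hδ₂, fun z hz hzδ r hr hr2 => ?_⟩
  have hz0 : 0 < ‖z‖ := norm_pos_iff.2 hz
  have hz1 := hzδ.trans (min_le_left _ _)
  have he' : ∫ x in Metric.closedBall 0 (2 * ‖z‖), ‖x‖ ^ (-(2 * a)) * ‖fderiv ℝ U x‖ ^ 2
      ≤ η ^ 2 := by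
    refine (setIntegral_mono_set hψ.integrableOn (.of_forall fun x => by positivity)
      (LE.le.eventuallyLE ?_)).trans he
    exact Metric.closedBall_subset_closedBall (by linarith)
  have k1 := integral_tent_le_of_energy ha hh hn hU hψ hη hz he' hr hr2
  have k2 := integral_tent_half_le_of_energy ha hah hn hU hψ hη he hM hz hz1
  have k3 := hδ₂' ‖z‖ hz0 (hzδ.trans (min_le_right _ _))
  rw [← hC₀] at k1 k2
  rw [← hC₁] at k2
  rw [neg_sub] at k3
  have k4 : ‖z‖ ^ (a - h) ≤ ‖z‖ ^ a * r ^ (-h) := by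
    rw [sub_eq_add_neg, rpow_add hz0]
    gcongr ?_ * ?_
    exact rpow_le_rpow_of_nonpos hr (by linarith) (by linarith)
  have k5 : ∫ y, tent y * U (z + r • y) ≤
      η * (1 + C₁ + C₀ / h) * (‖z‖ ^ a * r ^ (-h)) := by
    have := mul_le_mul_of_nonneg_left k4 (show 0 ≤ η * (1 + C₁) by positivity)
    linarith
  obtain ⟨F, hF, hFU⟩ := exists_contDiff_eventuallyEq hU (ρ := ‖z‖ / 4) (by positivity)
  obtain ⟨G, hG, hGS⟩ := exists_contDiff_eventuallyEq hS (ρ := ‖z‖ / 4) (by positivity)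
  have hFc := hF.continuous
  have hGc := hG.continuous
  have hb {y : 𝔼} (hy : ‖y‖ < 1) := half_norm_le hr.le hr2 hy.le
  calc ∫ y, tent y * S (z + r • y) = ∫ y, tent y * G (z + r • y) :=
        integral_tent_mul_congr fun y hy => ((hGS _ (by linarith [(hb hy).1])).eq_of_nhds).symm
    _ ≤ ∫ y, tent y * ((‖z‖ / 2) ^ (-a) * F (z + r • y)) := by
        refine integral_tent_mul_mono (by fun_prop) (by fun_prop) fun y hy => ?_
        have h1 := (hb hy).1
        have h2 : z + r • y ≠ 0 := norm_pos_iff.1 (by linarith)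
        rw [(hGS _ (by linarith)).eq_of_nhds, (hFU _ (by linarith)).eq_of_nhds, hSU _ h2]
        exact mul_le_mul_of_nonneg_right
          (rpow_le_rpow_of_nonpos (by positivity) h1 (by linarith)) (hU0 _ h2)
    _ = (‖z‖ / 2) ^ (-a) * ∫ y, tent y * F (z + r • y) := by
        rw [← integral_const_mul]
        congr 1 with y
        ring
    _ = (‖z‖ / 2) ^ (-a) * ∫ y, tent y * U (z + r • y) := by
        congr 1
        exact integral_tent_mul_congr fun y hy => (hFU _ (by linarith [(hb hy).1])).eq_of_nhds
    _ ≤ (‖z‖ / 2) ^ (-a) * (η * (1 + C₁ + C₀ / h) * (‖z‖ ^ a * r ^ (-h))) := by gcongr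
    _ = ε * r ^ (-h) := by
        rw [hη_def, div_rpow hz0.le zero_le_two, rpow_neg zero_le_two, rpow_neg hz0.le]
        field_simp

end Average

lemma integral_tent_sq_le : ∫ y : 𝔼, tent y * tent y ≤ ∫ y : 𝔼, tent y := by
  have := integral_tent_mul_mono (f := (tent : 𝔼 → ℝ)) (g := fun _ => 1) continuous_tent
    continuous_const fun y _ => tent_le_one y
  simpa using this

section Decay

variable {h μ s p c c' α β : ℝ} {f g : EuclideanSpace ℝ (Fin n) → ℝ}

lemma System.contDiffAt_add (H : System h μ s p c c' α β f g) {x : 𝔼} (hx : x ≠ 0) :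
    ContDiffAt ℝ 2 (fun y => f y + g y) x :=
  (H.left.contDiffAt x hx).add (H.right.contDiffAt x hx)

lemma System.add_pos (H : System h μ s p c c' α β f g) {x : 𝔼} (hx : x ≠ 0) : 0 < f x + g x :=
  _root_.add_pos (H.left.pos x hx) (H.right.pos x hx)

/-- On a ball where `f + g` is comparable to its value at the centre, that value is controlled by
averages at the natural scale. -/
lemma System.half_le_average (H : System h μ s p c c' α β f g) {A q r σ : ℝ}
    (hA : A = 2 ^ h * (μ + 4 * (2 + c + c'))) {z : 𝔼} (hσ : 0 < σ)
    (hz : ∀ x, ‖x - z‖ ≤ σ / 2 → σ ≤ ‖x‖ ∧ f x + g x ≤ 2 ^ h * (f z + g z))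
    (hq : q = σ ^ h * (f z + g z)) (hr : r = 1 / (2 + A) * (1 + q) ^ (-(1 / h)) * σ) :
    0 < r ∧ r ≤ ‖z‖ / 2 ∧
      (∫ y : 𝔼, tent y) / 2 * (f z + g z) ≤ ∫ y, tent y * (f (z + r • y) + g (z + r • y)) := by
  have hh := H.params.h_pos
  have hp := H.params.two_lt_p
  have hc := H.params.c_pos
  have hc' := H.params.c'_pos
  have hμ := H.params.μ_nonneg
  have hs := H.params.s_nonneg
  have hA0 : 0 < A := by rw [hA]; positivity
  have hzσ : σ ≤ ‖z‖ := (hz z (by simpa using by positivity)).1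
  have hz0 : z ≠ 0 := norm_pos_iff.1 (hσ.trans_le hzσ)
  set Sz := f z + g z with hSz
  have hSz0 : 0 < Sz := H.add_pos hz0
  have hq0 : 0 < q := by rw [hq]; positivity
  have hr0 : 0 < r := by rw [hr]; positivity
  have hrσ : r ≤ σ / 2 := by
    have h1 : (1 + q) ^ (-(1 / h)) ≤ 1 :=
      rpow_le_one_of_one_le_of_nonpos (by linarith) (by simp [hh.le])
    have h2 : 1 / (2 + A) ≤ 1 / 2 := one_div_le_one_div_of_le two_pos (by linarith)
    calc r ≤ 1 / 2 * 1 * σ := by rw [hr]; gcongr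
      _ = σ / 2 := by ring
  have hr2 : r ≤ ‖z‖ / 2 := by linarith
  refine ⟨hr0, hr2, ?_⟩
  set D : ℝ := A * (σ ^ (-2 : ℝ) * (1 + q) ^ (2 / h)) * Sz with hD
  have hlap : ∀ x, ‖x - z‖ ≤ r → -lapl (fun y => f y + g y) x ≤ D := by
    intro x hx
    obtain ⟨h1, h2⟩ := hz x (hx.trans hrσ)
    have hx0 : 0 < ‖x‖ := hσ.trans_le h1
    have hx0' : x ≠ 0 := norm_pos_iff.1 hx0
    refine (H.neg_lapl_add_le hx0').trans ?_
    have hSx := H.add_pos hx0'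
    have e1 : ‖x‖ ^ (-2 : ℝ) ≤ σ ^ (-2 : ℝ) := rpow_le_rpow_of_nonpos hσ h1 (by norm_num)
    have e2 : ‖x‖ ^ (-s) ≤ σ ^ (-s) := rpow_le_rpow_of_nonpos hσ h1 (by linarith)
    have e3 : (f x + g x) ^ (p - 2) ≤ 4 * σ ^ (s - 2) * (1 + q) ^ (2 / h) := by
      have e4 : f x + g x ≤ 2 ^ h * (σ ^ (-h) * q) := by
        rw [hq, ← mul_assoc (σ ^ (-h)), ← rpow_add hσ]
        simpa using h2
      calc (f x + g x) ^ (p - 2) ≤ (2 ^ h * (σ ^ (-h) * q)) ^ (p - 2) :=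
            rpow_le_rpow hSx.le e4 (by linarith)
        _ = 2 ^ (2 - s) * σ ^ (s - 2) * q ^ (p - 2) := by
            rw [mul_rpow (by positivity) (by positivity), mul_rpow (by positivity) hq0.le,
              ← rpow_mul zero_le_two, ← rpow_mul hσ.le, neg_mul, H.params.scaling, neg_sub,
              mul_assoc]
        _ ≤ 2 ^ (2 : ℝ) * σ ^ (s - 2) * (1 + q) ^ (2 / h) := by
            gcongr ?_ * _ * ?_
            · exact rpow_le_rpow_of_exponent_le one_le_two (by linarith)
            · have h3 : p - 2 ≤ 2 / h := by
                rw [le_div_iff₀ hh]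
                linarith [H.params.scaling]
              calc q ^ (p - 2) ≤ (1 + q) ^ (p - 2) :=
                    rpow_le_rpow hq0.le (by linarith) (by linarith)
                _ ≤ (1 + q) ^ (2 / h) := rpow_le_rpow_of_exponent_le (by linarith) h3
        _ = _ := by norm_num
    have e5 : 1 ≤ (1 + q) ^ (2 / h) := one_le_rpow (by linarith) (by positivity)
    calc (μ * ‖x‖ ^ (-2 : ℝ) + (2 + c + c') * (‖x‖ ^ (-s) * (f x + g x) ^ (p - 2))) * (f x + g x)
        ≤ (μ * (σ ^ (-2 : ℝ) * (1 + q) ^ (2 / h)) + (2 + c + c') *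
            (σ ^ (-s) * (4 * σ ^ (s - 2) * (1 + q) ^ (2 / h)))) * (2 ^ h * Sz) := by
          gcongr
          exact e1.trans (le_mul_of_one_le_right (by positivity) e5)
      _ = D := by
          have : σ ^ (-s) * σ ^ (s - 2) = σ ^ (-2 : ℝ) := by
            rw [← rpow_add hσ]; congr 1; ring
          rw [hD, hA, ← this]
          ring
  have hmv := integral_tent_mul_self_le (fun x hx => H.contDiffAt_add hx) hz0 hr0 hr2 hlap
  have hrD : r ^ 2 * D = (1 / (2 + A)) ^ 2 * A * Sz := by
    have h1 : ((1 + q) ^ (-(1 / h))) ^ 2 * (1 + q) ^ (2 / h) = 1 := by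
      have h2 : -(1 / h) * ((2 : ℕ) : ℝ) + 2 / h = 0 := by push_cast; ring
      rw [← rpow_natCast, ← rpow_mul (by linarith), ← rpow_add (by linarith), h2, rpow_zero]
    have h2 : σ ^ 2 * σ ^ (-2 : ℝ) = 1 := by
      rw [← rpow_natCast, ← rpow_add hσ]
      norm_num
    calc r ^ 2 * D = (1 / (2 + A)) ^ 2 * A * Sz *
          (((1 + q) ^ (-(1 / h))) ^ 2 * (1 + q) ^ (2 / h)) * (σ ^ 2 * σ ^ (-2 : ℝ)) := by
          rw [hr, hD]; ring
      _ = _ := by rw [h1, h2]; ring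
  have hA1 : (1 / (2 + A)) ^ 2 * A ≤ 1 := by
    rw [div_pow, div_mul_eq_mul_div, one_pow, one_mul, div_le_one (by positivity)]
    nlinarith
  have hI0 := integral_tent_sq_nonneg (n := n)
  have hI1 := integral_tent_sq_le (n := n)
  have h3 : r ^ 2 / 8 * (∫ y : 𝔼, tent y * tent y) * D ≤ (∫ y : 𝔼, tent y) / 2 * Sz := by
    calc r ^ 2 / 8 * (∫ y : 𝔼, tent y * tent y) * D
        = 1 / 8 * (∫ y : 𝔼, tent y * tent y) * ((1 / (2 + A)) ^ 2 * A * Sz) := by rw [← hrD]; ring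
      _ ≤ 1 / 2 * (∫ y : 𝔼, tent y) * (1 * Sz) := by
        have hI2 := (integral_tent_pos (n := n)).le
        gcongr
        norm_num
      _ = _ := by ring
  linarith

/-- Small averages near the origin give pointwise smallness. -/
lemma System.exists_le_of_average (H : System h μ s p c c' α β f g)
    (hav : ∀ ε > 0, ∃ δ > 0, ∀ z : 𝔼, z ≠ 0 → ‖z‖ ≤ δ → ∀ r, 0 < r → r ≤ ‖z‖ / 2 →
      ∫ y, tent y * (f (z + r • y) + g (z + r • y)) ≤ ε * r ^ (-h)) {ε : ℝ} (hε : 0 < ε) :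
    ∃ δ > 0, ∀ x : 𝔼, x ≠ 0 → ‖x‖ ≤ δ → f x + g x ≤ ε * ‖x‖ ^ (-h) := by
  have hh := H.params.h_pos
  have hκ := integral_tent_pos (n := n)
  obtain ⟨A, hA⟩ : ∃ A, A = 2 ^ h * (μ + 4 * (2 + c + c')) := ⟨_, rfl⟩
  have hA0 : 0 < A := by
    have hc := H.params.c_pos
    have hc' := H.params.c'_pos
    have hμ := H.params.μ_nonneg
    rw [hA]; positivity
  set C : ℝ := 2 * (1 / (2 + A)) ^ (-h) / (∫ y : 𝔼, tent y) with hC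
  have hC0 : 0 < C := by positivity
  set η : ℝ := min (1 / (2 * C)) (ε / (2 ^ h * 2 * C)) with hη_def
  have hη : 0 < η := by positivity
  have hη1 : C * η ≤ 1 / 2 := by
    have := min_le_left (1 / (2 * C)) (ε / (2 ^ h * 2 * C))
    rw [← hη_def, le_div_iff₀ (by positivity)] at this
    linarith
  have hη2 : 2 ^ h * (2 * (C * η)) ≤ ε := by
    have := min_le_right (1 / (2 * C)) (ε / (2 ^ h * 2 * C))
    rw [← hη_def, le_div_iff₀ (by positivity)] at this
    linarith
  obtain ⟨δ, hδ, hav⟩ := hav η hη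
  refine ⟨δ / 2, by positivity, fun x₀ hx₀ hxδ => ?_⟩
  have hR : 0 < ‖x₀‖ := norm_pos_iff.2 hx₀
  set R := ‖x₀‖ with hR_def
  have hball {x : 𝔼} (hx : ‖x - x₀‖ ≤ R / 2) : R - ‖x - x₀‖ ≤ ‖x‖ ∧ x ≠ 0 := by
    have h1 := norm_sub_norm_le x₀ x
    rw [norm_sub_rev] at h1
    exact ⟨by linarith, norm_pos_iff.1 (by linarith)⟩
  have hcont : ContinuousOn (fun x => (R / 2 - ‖x - x₀‖) ^ h * (f x + g x))
      (Metric.closedBall x₀ (R / 2)) := by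
    intro x hx
    have hx0 := (hball (by simpa [dist_eq_norm] using hx)).2
    refine ContinuousAt.continuousWithinAt (ContinuousAt.mul ?_ (H.contDiffAt_add hx0).continuousAt)
    exact ContinuousAt.rpow_const (by fun_prop) (Or.inr hh.le)
  obtain ⟨z, hzmem, hzmax⟩ := (isCompact_closedBall x₀ (R / 2)).exists_isMaxOn
    ⟨x₀, Metric.mem_closedBall_self (by positivity)⟩ hcont
  have hzx : ‖z - x₀‖ ≤ R / 2 := by simpa [dist_eq_norm] using hzmem
  have hmax {x : 𝔼} (hx : ‖x - x₀‖ ≤ R / 2) :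
      (R / 2 - ‖x - x₀‖) ^ h * (f x + g x) ≤ (R / 2 - ‖z - x₀‖) ^ h * (f z + g z) :=
    hzmax (by simpa [dist_eq_norm] using hx)
  have hz0 := (hball hzx).2
  have hSz := H.add_pos hz0
  have hx₀z := hmax (x := x₀) (by simpa using by positivity)
  rw [sub_self, norm_zero, sub_zero] at hx₀z
  set σ := R / 2 - ‖z - x₀‖ with hσ_def
  have hσ : 0 < σ := by
    rcases (sub_nonneg.2 hzx).eq_or_lt with h0 | h0
    · have h1 := H.add_pos hx₀
      rw [hσ_def, ← h0, zero_rpow hh.ne', zero_mul] at hx₀z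
      have : 0 < (R / 2) ^ h * (f x₀ + g x₀) := by positivity
      linarith
    · exact h0
  have hz : ∀ x, ‖x - z‖ ≤ σ / 2 → σ ≤ ‖x‖ ∧ f x + g x ≤ 2 ^ h * (f z + g z) := by
    intro x hx
    have h1 : ‖x - x₀‖ ≤ R / 2 - σ / 2 := by
      have := norm_add_le (x - z) (z - x₀)
      rw [sub_add_sub_cancel] at this
      linarith
    have h2 : ‖x - x₀‖ ≤ R / 2 := by linarith
    obtain ⟨h3, h4⟩ := hball h2
    refine ⟨by linarith [norm_nonneg (z - x₀)], ?_⟩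
    have h5 := H.add_pos h4
    have h6 : (σ / 2) ^ h * (f x + g x) ≤ σ ^ h * (f z + g z) := by
      refine le_trans ?_ (hmax h2)
      gcongr
      linarith
    rw [div_rpow hσ.le zero_le_two, div_mul_eq_mul_div, div_le_iff₀ (by positivity)] at h6
    have h7 : 0 < σ ^ h := by positivity
    refine le_of_mul_le_mul_left ?_ h7
    linarith
  obtain ⟨q, hq⟩ : ∃ q, q = σ ^ h * (f z + g z) := ⟨_, rfl⟩
  have hq0 : 0 < q := by rw [hq]; positivity
  obtain ⟨r, hr⟩ : ∃ r, r = 1 / (2 + A) * (1 + q) ^ (-(1 / h)) * σ := ⟨_, rfl⟩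
  obtain ⟨hr0, hr2, hmv⟩ := H.half_le_average hA hσ hz hq hr
  have hzδ : ‖z‖ ≤ δ := by
    have := norm_sub_norm_le z x₀
    linarith
  have h1 := hmv.trans (hav z hz0 hzδ r hr0 hr2)
  have hrh : r ^ (-h) = (1 / (2 + A)) ^ (-h) * (1 + q) * σ ^ (-h) := by
    have hq1 : 0 < 1 + q := by linarith
    rw [hr, mul_rpow (by positivity) hσ.le, mul_rpow (by positivity) (by positivity),
      ← rpow_mul hq1.le, show -(1 / h) * -h = 1 by field_simp, rpow_one]
  have hqle : q ≤ C * η * (1 + q) := by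
    have hσh : σ ^ h * σ ^ (-h) = 1 := by rw [← rpow_add hσ]; simp
    rw [hrh] at h1
    have h2 := mul_le_mul_of_nonneg_left h1 (show 0 ≤ σ ^ h by positivity)
    have h3 : (∫ y : 𝔼, tent y) / 2 * q ≤ η * ((1 / (2 + A)) ^ (-h) * (1 + q)) := by
      calc _ = σ ^ h * ((∫ y : 𝔼, tent y) / 2 * (f z + g z)) := by rw [hq]; ring
        _ ≤ _ := h2
        _ = η * ((1 / (2 + A)) ^ (-h) * (1 + q)) * (σ ^ h * σ ^ (-h)) := by ring
        _ = _ := by rw [hσh, mul_one]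
    have e : C * η * (1 + q) = η * ((1 / (2 + A)) ^ (-h) * (1 + q)) /
        ((∫ y : 𝔼, tent y) / 2) := by rw [hC]; field_simp
    rw [e, le_div_iff₀ (by positivity)]
    linarith
  have hq2 : q ≤ 2 * (C * η) := by nlinarith
  rw [← hq, div_rpow hR.le zero_le_two] at hx₀z
  have h2 : R ^ h * (f x₀ + g x₀) ≤ ε := by
    rw [div_mul_eq_mul_div, div_le_iff₀ (by positivity)] at hx₀z
    have := mul_le_mul_of_nonneg_left hq2 (show (0 : ℝ) ≤ 2 ^ h by positivity)
    linarith
  rw [rpow_neg hR.le, ← div_eq_mul_inv, le_div_iff₀ (by positivity)]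
  linarith

end Decay

section Conclusion

variable {h μ s p c c' α β a : ℝ} {f g w w' : EuclideanSpace ℝ (Fin n) → ℝ}

lemma nonlinearity_smul {t F G : ℝ} (ht : 0 < t) (hF : 0 < F) (hG : 0 < G) (hp : α + β = p) :
    (t * F) ^ (p - 1) + c * (t * F) ^ (α - 1) * (t * G) ^ β =
      t ^ (p - 1) * (F ^ (p - 1) + c * F ^ (α - 1) * G ^ β) := by
  have h1 : t ^ (p - 1) = t ^ (α - 1) * t ^ β := by
    rw [← rpow_add ht, ← hp]; congr 1; ring
  rw [mul_rpow ht.le hF.le, mul_rpow ht.le hF.le, mul_rpow ht.le hG.le]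
  linear_combination (-(c * F ^ (α - 1) * G ^ β)) * h1

lemma HalfSystem.kelvin (H : HalfSystem μ s p c α β f g) (hp : α + β = p)
    (hn : 2 * h = n - 2) (hs : h * (p - 2) = 2 - s) :
    HalfSystem μ s p c α β (kelvin f) (kelvin g) where
  contDiffAt x hx := contDiffAt_kelvin hx (H.contDiffAt _ (inv_ne_zero hx))
  pos x hx := mul_pos (rpow_pos_of_pos (norm_pos_iff.2 hx) _) (H.pos _ (inv_ne_zero hx))
  pos' x hx := mul_pos (rpow_pos_of_pos (norm_pos_iff.2 hx) _) (H.pos' _ (inv_ne_zero hx))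
  eq x hx := by
    have hρ : 0 < ‖x‖ := norm_pos_iff.2 hx
    have hx' := inv_ne_zero hx
    rw [lapl_kelvin hx (H.contDiffAt _ hx'), ← mul_neg, H.eq _ hx', norm_inv]
    simp only [HenonSobolev.kelvin]
    rw [nonlinearity_smul (rpow_pos_of_pos hρ _) (H.pos _ hx') (H.pos' _ hx') hp,
      inv_rpow hρ.le, inv_rpow hρ.le, ← rpow_neg hρ.le, ← rpow_neg hρ.le, neg_neg, neg_neg,
      ← rpow_mul hρ.le]
    have h1 : ‖x‖ ^ (-(n : ℝ) - 2) * ‖x‖ ^ (2 : ℝ) = ‖x‖ ^ (-2 : ℝ) * ‖x‖ ^ (2 - n : ℝ) := by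
      rw [← rpow_add hρ, ← rpow_add hρ]; congr 1; ring
    have h2 : ‖x‖ ^ (-(n : ℝ) - 2) * ‖x‖ ^ s = ‖x‖ ^ (-s) * ‖x‖ ^ ((2 - n : ℝ) * (p - 1)) := by
      rw [← rpow_add hρ, ← rpow_add hρ]; congr 1
      linear_combination 2 * hs - (p - 2) * hn
    linear_combination μ * f (inv x) * h1 + (f (inv x) ^ (p - 1) +
      c * f (inv x) ^ (α - 1) * g (inv x) ^ β) * h2

lemma System.kelvin (H : System h μ s p c c' α β f g) :
    System h μ s p c c' α β (kelvin f) (kelvin g) where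
  params := H.params
  left := H.left.kelvin H.params.add_eq H.params.two_mul_h H.params.scaling
  right := H.right.kelvin (by rw [add_comm, H.params.add_eq]) H.params.two_mul_h H.params.scaling

/-- Smallness at the origin becomes decay at infinity under the Kelvin transform. -/
lemma decays_kelvin (hn : 2 * h = n - 2)
    (hd : ∀ ε > 0, ∃ δ > 0, ∀ x : 𝔼, x ≠ 0 → ‖x‖ ≤ δ → f x + g x ≤ ε * ‖x‖ ^ (-h)) :
    Decays h (kelvin f) (kelvin g) := by
  intro ε hε
  obtain ⟨δ, hδ, H⟩ := hd ε hε
  refine ⟨δ⁻¹, inv_pos.2 hδ, fun x hx => ?_⟩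
  have hρ : 0 < ‖x‖ := (inv_pos.2 hδ).trans_le hx
  have h1 := H (inv x) (inv_ne_zero (norm_pos_iff.1 hρ))
    (by rw [norm_inv]; exact inv_le_of_inv_le₀ hδ hx)
  rw [norm_inv, inv_rpow hρ.le, ← rpow_neg hρ.le, neg_neg] at h1
  calc HenonSobolev.kelvin f x + HenonSobolev.kelvin g x
      = ‖x‖ ^ (2 - n : ℝ) * (f (inv x) + g (inv x)) := by simp only [HenonSobolev.kelvin]; ring
    _ ≤ ‖x‖ ^ (2 - n : ℝ) * (ε * ‖x‖ ^ h) := by gcongr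
    _ = ε * (‖x‖ ^ (2 - n : ℝ) * ‖x‖ ^ h) := by ring
    _ = ε * ‖x‖ ^ (-h) := by
        rw [← rpow_add hρ]; congr 2; linarith

lemma inner_gradient_self {x : 𝔼} : ⟪x, gradient w x⟫ = fderiv ℝ w x x := by
  rw [real_inner_comm, gradient, InnerProductSpace.toDual_symm_apply]

lemma norm_gradient {x : 𝔼} : ‖gradient w x‖ = ‖fderiv ℝ w x‖ := by
  rw [gradient, LinearIsometryEquiv.norm_map]

/-- The substitution `w ↦ |x|⁻ᵃ w` turns the weighted operator into a Laplacian with an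
inverse-square potential. -/
lemma neg_lapl_norm_rpow_mul {x : 𝔼} (hx : x ≠ 0) (hw : ContDiffAt ℝ 2 w x) :
    -lapl (fun y => ‖y‖ ^ (-a) * w y) x =
      a * (n - 2 - a) * ‖x‖ ^ (-2 : ℝ) * (‖x‖ ^ (-a) * w x) + ‖x‖ ^ a * -wdiv a w x := by
  have hρ : 0 < ‖x‖ := norm_pos_iff.2 hx
  rw [lapl_norm_rpow_mul _ hx hw, wdiv, inner_gradient_self]
  have h1 : ‖x‖ ^ (-a - 2) = ‖x‖ ^ (-2 : ℝ) * ‖x‖ ^ (-a) := by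
    rw [← rpow_add hρ]; congr 1; ring
  have h2 : ‖x‖ ^ (-a) = ‖x‖ ^ a * ‖x‖ ^ (-(2 * a)) := by
    rw [← rpow_add hρ]; congr 1; ring
  have h3 : fderiv ℝ w x x / ‖x‖ ^ 2 = ‖x‖ ^ (-2 : ℝ) * fderiv ℝ w x x := by
    rw [rpow_neg hρ.le, rpow_two]; ring
  rw [h1, mul_div_assoc, h3]
  linear_combination (-(lapl w x) + 2 * a * ‖x‖ ^ (-2 : ℝ) * fderiv ℝ w x x) * h2

lemma halfSystem_of_wdiv {b : ℝ} (hp : α + β = p)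
    (hw : ∀ x : 𝔼, x ≠ 0 → ContDiffAt ℝ 2 w x)
    (hpos : ∀ x : 𝔼, x ≠ 0 → 0 < w x) (hpos' : ∀ x : 𝔼, x ≠ 0 → 0 < w' x)
    (heq : ∀ x : 𝔼, x ≠ 0 → -wdiv a w x =
      ‖x‖ ^ (-(b * p)) * (w x ^ (p - 1) + c * w x ^ (α - 1) * w' x ^ β)) :
    HalfSystem (a * (n - 2 - a)) ((b - a) * p) p c α β
      (fun x => ‖x‖ ^ (-a) * w x) (fun x => ‖x‖ ^ (-a) * w' x) where
  contDiffAt x hx := (contDiffAt_norm_rpow _ hx).mul (hw x hx)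
  pos x hx := mul_pos (rpow_pos_of_pos (norm_pos_iff.2 hx) _) (hpos x hx)
  pos' x hx := mul_pos (rpow_pos_of_pos (norm_pos_iff.2 hx) _) (hpos' x hx)
  eq x hx := by
    have hρ : 0 < ‖x‖ := norm_pos_iff.2 hx
    rw [neg_lapl_norm_rpow_mul hx (hw x hx), heq x hx,
      nonlinearity_smul (rpow_pos_of_pos hρ _) (hpos x hx) (hpos' x hx) hp, ← rpow_mul hρ.le]
    have h1 : ‖x‖ ^ a * ‖x‖ ^ (-(b * p)) = ‖x‖ ^ (-((b - a) * p)) * ‖x‖ ^ (-a * (p - 1)) := by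
      rw [← rpow_add hρ, ← rpow_add hρ]; congr 1; ring
    linear_combination (w x ^ (p - 1) + c * w x ^ (α - 1) * w' x ^ β) * h1

lemma params_of_exponents {b ν : ℝ} (hn : 3 ≤ n) (ha0 : 0 ≤ a) (ha : a < ((n : ℝ) - 2) / 2)
    (hb0 : 0 < b) (hab : a ≤ b) (hba : b < a + 1)
    (hp : p = 2 * (n : ℝ) / ((n : ℝ) - 2 + 2 * (b - a))) (hν : 0 < ν) (hα : 1 < α) (hβ : 1 < β)
    (hαβ : α + β = p) :
    Params n (((n : ℝ) - 2) / 2) (a * (n - 2 - a)) ((b - a) * p) p (ν * α) (ν * β) α β where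
  three_le := hn
  two_mul_h := by ring
  μ_nonneg := mul_nonneg ha0 (by linarith)
  μ_lt := by nlinarith [pow_pos (sub_pos.2 ha) 2]
  s_nonneg := mul_nonneg (by linarith) (by linarith)
  μ_add_s := by
    have h1 : 0 ≤ (b - a) * p := mul_nonneg (by linarith) (by linarith)
    rcases ha0.eq_or_lt with rfl | h0
    · have : 0 < b * p := mul_pos hb0 (by linarith)
      linarith
    · have : 0 < a * (n - 2 - a) := mul_pos h0 (by linarith)
      linarith
  c_pos := by positivity
  c'_pos := by positivity
  one_lt_α := hα
  one_lt_β := hβ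
  add_eq := hαβ
  scaling := by
    have h1 : p * ((n : ℝ) - 2 + 2 * (b - a)) = 2 * n := by
      rw [hp]; exact div_mul_cancel₀ _ (by linarith)
    linear_combination h1 / 2

lemma integrable_energy_add (hw : ∀ x : 𝔼, x ≠ 0 → ContDiffAt ℝ 2 w x)
    (hw' : ∀ x : 𝔼, x ≠ 0 → ContDiffAt ℝ 2 w' x)
    (hE : finiteEnergy a w) (hE' : finiteEnergy a w') :
    Integrable fun x => ‖x‖ ^ (-(2 * a)) * ‖fderiv ℝ (fun x => w x + w' x) x‖ ^ 2 := by
  have hE2 := (hE.add hE').const_mul 2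
  refine Integrable.mono hE2 ?_ ?_
  · exact (Measurable.mul (by fun_prop)
      ((measurable_fderiv ℝ _).norm.pow_const 2)).aestronglyMeasurable
  by_cases hn : n = 0
  · subst hn
    refine Filter.Eventually.of_forall fun x => ?_
    have : fderiv ℝ (fun x => w x + w' x) x = 0 := by
      ext v; simp [Subsingleton.elim v 0]
    rw [this]
    simp
  have : Nonempty (Fin n) := ⟨⟨0, Nat.pos_of_ne_zero hn⟩⟩
  filter_upwards [Measure.ae_ne volume (0 : 𝔼)] with x hx
  have h1 := fderiv_fun_add ((hw x hx).differentiableAt (by norm_num))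
    ((hw' x hx).differentiableAt (by norm_num))
  have h2 : ‖fderiv ℝ (fun x => w x + w' x) x‖ ^ 2 ≤
      2 * (‖fderiv ℝ w x‖ ^ 2 + ‖fderiv ℝ w' x‖ ^ 2) := by
    rw [h1]
    have := norm_add_le (fderiv ℝ w x) (fderiv ℝ w' x)
    nlinarith [norm_nonneg (fderiv ℝ w x + fderiv ℝ w' x),
      sq_nonneg (‖fderiv ℝ w x‖ - ‖fderiv ℝ w' x‖)]
  simp only [Pi.add_apply, norm_gradient]
  rw [Real.norm_of_nonneg (by positivity), Real.norm_of_nonneg (by positivity)]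
  calc _ ≤ ‖x‖ ^ (-(2 * a)) * (2 * (‖fderiv ℝ w x‖ ^ 2 + ‖fderiv ℝ w' x‖ ^ 2)) := by gcongr
    _ = _ := by ring

lemma eq_of_kelvin_inv_eq {x y : 𝔼} (hx : x ≠ 0) (hy : y ≠ 0) (hxy : ‖x‖ = ‖y‖)
    (hk : kelvin (fun z => ‖z‖ ^ (-a) * w z) (inv x) = kelvin (fun z => ‖z‖ ^ (-a) * w z) (inv y)) :
    w x = w y := by
  have hρ : 0 < ‖y‖ := norm_pos_iff.2 hy
  simp only [kelvin, norm_inv, inv_inv hx, inv_inv hy, hxy] at hk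
  exact mul_left_cancel₀ (rpow_pos_of_pos hρ _).ne'
    (mul_left_cancel₀ (rpow_pos_of_pos (inv_pos.2 hρ) _).ne' hk)

end Conclusion

end HenonSobolev

theorem stmt {n : ℕ} (hn : 3 ≤ n) (a b p ν α β : ℝ)
    (ha0 : 0 ≤ a) (ha : a < ((n:ℝ)-2)/2) (hb0 : 0 < b) (hab : a ≤ b) (hba : b < a + 1)
    (hp : p = 2*(n:ℝ)/((n:ℝ)-2+2*(b-a))) (hν : 0 < ν) (hα : 1 < α) (hβ : 1 < β)
    (hαβ : α + β = p)
    (u v : EuclideanSpace ℝ (Fin n) → ℝ)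
    (hu : ContDiffOn ℝ 2 u {0}ᶜ) (hv : ContDiffOn ℝ 2 v {0}ᶜ)
    (hupos : ∀ x : EuclideanSpace ℝ (Fin n), x ≠ 0 → 0 < u x)
    (hvpos : ∀ x : EuclideanSpace ℝ (Fin n), x ≠ 0 → 0 < v x)
    (hueq : ∀ x : EuclideanSpace ℝ (Fin n), x ≠ 0 →
      -(wdiv a u x) = ‖x‖ ^ (-(b*p)) * (u x ^ (p-1) + ν*α * u x ^ (α-1) * v x ^ β))
    (hveq : ∀ x : EuclideanSpace ℝ (Fin n), x ≠ 0 →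
      -(wdiv a v x) = ‖x‖ ^ (-(b*p)) * (v x ^ (p-1) + ν*β * u x ^ α * v x ^ (β-1)))
    (hEu : finiteEnergy a u) (hEv : finiteEnergy a v) :
    ∀ x y : EuclideanSpace ℝ (Fin n), x ≠ 0 → y ≠ 0 → ‖x‖ = ‖y‖ →
      u x = u y ∧ v x = v y := by
  have hu' (x) (hx : x ≠ 0) : ContDiffAt ℝ 2 u x := hu.contDiffAt (compl_singleton_mem_nhds hx)
  have hv' (x) (hx : x ≠ 0) : ContDiffAt ℝ 2 v x := hv.contDiffAt (compl_singleton_mem_nhds hx)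
  have H : HenonSobolev.System (((n : ℝ) - 2) / 2) (a * (n - 2 - a)) ((b - a) * p) p (ν * α)
      (ν * β) α β (fun x => ‖x‖ ^ (-a) * u x) (fun x => ‖x‖ ^ (-a) * v x) :=
    ⟨HenonSobolev.params_of_exponents hn ha0 ha hb0 hab hba hp hν hα hβ hαβ,
      HenonSobolev.halfSystem_of_wdiv hαβ hu' hupos hvpos hueq,
      HenonSobolev.halfSystem_of_wdiv (by rw [add_comm, hαβ]) hv' hvpos hupos
        fun x hx => by rw [hveq x hx]; ring⟩
  have hd := HenonSobolev.decays_kelvin H.params.two_mul_h fun ε hε => H.exists_le_of_average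
    (fun ε hε => HenonSobolev.exists_average_le hn ha0 ha H.params.two_mul_h
      (fun x hx => (hu' x hx).add (hv' x hx))
      (fun x hx => (add_pos (hupos x hx) (hvpos x hx)).le)
      (HenonSobolev.integrable_energy_add hu' hv' hEu hEv) (fun x hx => H.contDiffAt_add hx)
      (fun x _ => (mul_add _ _ _).symm) hε) hε
  intro x y hx hy hxy
  obtain ⟨h1, h2⟩ := H.kelvin.radial hd (HenonSobolev.inv_ne_zero hx) (HenonSobolev.inv_ne_zero hy)
    (by rw [HenonSobolev.norm_inv, HenonSobolev.norm_inv, hxy])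
  exact ⟨HenonSobolev.eq_of_kelvin_inv_eq hx hy hxy h1,
    HenonSobolev.eq_of_kelvin_inv_eq hx hy hxy h2⟩
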